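/- Let q be a power of an odd prime, F_q a finite field with q elements, n ≥ 1, and let J ∈ M_{2n}(F_q) be an invertible symmetric matrix that is nonsplit. Let G = GO(J) and H = O(J) = {g ∈ G : μ(g) = 1}. Let R be a complete set of irreducible complex representations of G and S a complete set of irreducible complex representations of H. Then Σ_{ρ ∈ R, character of ρ real-valued} dim ρ = Σ_{σ ∈ S} dim σ. -/

import Mathlib

open Matrix CategoryTheory
open scoped Classical

noncomputable section

/-- The Frobenius–Schur indicator of a complex-valued function on a finite group. -/
def fsIndicator (G : Type*) [Group G] [Fintype G] (χ : G → ℂ) : ℂ :=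
  (Fintype.card G : ℂ)⁻¹ * ∑ g : G, χ (g * g)

/-- The twisted Frobenius–Schur indicator of a complex-valued function on a finite group,
with respect to a map `σ`. -/
def twistedFSIndicator (G : Type*) [Group G] [Fintype G] (σ : G → G) (χ : G → ℂ) : ℂ :=
  (Fintype.card G : ℂ)⁻¹ * ∑ g : G, χ (g * σ g)

/-- A complex-valued function is real-valued if all its values are real. -/
def IsRealValued {G : Type*} (χ : G → ℂ) : Prop := ∀ g : G, ∃ r : ℝ, χ g = (r : ℂ)

/-- The Gaussian binomial coefficient `binom(m,k)_q` as a real number. -/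
def gbinom (m k : ℕ) (q : ℝ) : ℝ := ∏ i ∈ Finset.Icc 1 k, (q ^ (m - k + i) - 1) / (q ^ i - 1)

section Groups

variable {N F : Type*} [Fintype N] [DecidableEq N] [Field F]

theorem sim_one (J : Matrix N N F) :
    ((1 : GL N F) : Matrix N N F)ᵀ * J * ((1 : GL N F) : Matrix N N F) = ((1 : Fˣ) : F) • J := by
  simp

theorem sim_mul {J : Matrix N N F} (a b : GL N F) (c d : Fˣ)
    (hc : (a : Matrix N N F)ᵀ * J * (a : Matrix N N F) = (c : F) • J)
    (hd : (b : Matrix N N F)ᵀ * J * (b : Matrix N N F) = (d : F) • J) :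
    ((a * b : GL N F) : Matrix N N F)ᵀ * J * ((a * b : GL N F) : Matrix N N F)
      = ((c * d : Fˣ) : F) • J := by
  calc ((a * b : GL N F) : Matrix N N F)ᵀ * J * ((a * b : GL N F) : Matrix N N F)
      = (b : Matrix N N F)ᵀ * ((a : Matrix N N F)ᵀ * J * (a : Matrix N N F)) *
          (b : Matrix N N F) := by
        rw [show ((a * b : GL N F) : Matrix N N F) = (a : Matrix N N F) * b from rfl,
          transpose_mul]
        simp only [Matrix.mul_assoc]
    _ = (b : Matrix N N F)ᵀ * ((c : F) • J) * (b : Matrix N N F) := by rw [hc]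
    _ = (c : F) • ((b : Matrix N N F)ᵀ * J * (b : Matrix N N F)) := by
        rw [Matrix.mul_smul, Matrix.smul_mul]
    _ = (c : F) • ((d : F) • J) := by rw [hd]
    _ = ((c * d : Fˣ) : F) • J := by rw [smul_smul, Units.val_mul]

theorem sim_inv {J : Matrix N N F} (a : GL N F) (c : Fˣ)
    (hc : (a : Matrix N N F)ᵀ * J * (a : Matrix N N F) = (c : F) • J) :
    ((a⁻¹ : GL N F) : Matrix N N F)ᵀ * J * ((a⁻¹ : GL N F) : Matrix N N F)
      = ((c⁻¹ : Fˣ) : F) • J := by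
  have ht : ((a⁻¹ : GL N F) : Matrix N N F)ᵀ * (a : Matrix N N F)ᵀ = 1 := by
    rw [← transpose_mul, a.mul_inv, transpose_one]
  have key : ((a⁻¹ : GL N F) : Matrix N N F)ᵀ * ((a : Matrix N N F)ᵀ * J * (a : Matrix N N F)) *
      ((a⁻¹ : GL N F) : Matrix N N F) = J := by
    calc ((a⁻¹ : GL N F) : Matrix N N F)ᵀ * ((a : Matrix N N F)ᵀ * J * (a : Matrix N N F)) *
        ((a⁻¹ : GL N F) : Matrix N N F)
        = (((a⁻¹ : GL N F) : Matrix N N F)ᵀ * (a : Matrix N N F)ᵀ) * J *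
          ((a : Matrix N N F) * ((a⁻¹ : GL N F) : Matrix N N F)) := by
          simp only [Matrix.mul_assoc]
      _ = J := by rw [ht, a.mul_inv, Matrix.one_mul, Matrix.mul_one]
  have key2 : ((a⁻¹ : GL N F) : Matrix N N F)ᵀ * ((c : F) • J) * ((a⁻¹ : GL N F) : Matrix N N F)
      = (c : F) • (((a⁻¹ : GL N F) : Matrix N N F)ᵀ * J * ((a⁻¹ : GL N F) : Matrix N N F)) := by
    rw [Matrix.mul_smul, Matrix.smul_mul]
  have h3 : (c : F) • (((a⁻¹ : GL N F) : Matrix N N F)ᵀ * J *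
      ((a⁻¹ : GL N F) : Matrix N N F)) = J := by rw [← key2, ← hc, key]
  calc ((a⁻¹ : GL N F) : Matrix N N F)ᵀ * J * ((a⁻¹ : GL N F) : Matrix N N F)
      = ((c⁻¹ : Fˣ) : F) • ((c : F) • (((a⁻¹ : GL N F) : Matrix N N F)ᵀ * J *
          ((a⁻¹ : GL N F) : Matrix N N F))) := by
        rw [smul_smul, ← Units.val_mul, inv_mul_cancel, Units.val_one, one_smul]
    _ = ((c⁻¹ : Fˣ) : F) • J := by rw [h3]

/-- The similitude group of the bilinear form given by the matrix `J`:  all invertible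
matrices `g` with `gᵀ * J * g = c • J` for some nonzero scalar `c` (the similitude of `g`). -/
def similitudeGroup (J : Matrix N N F) : Subgroup (GL N F) where
  carrier := {g | ∃ c : Fˣ, (g : Matrix N N F)ᵀ * J * (g : Matrix N N F) = (c : F) • J}
  one_mem' := ⟨1, sim_one J⟩
  mul_mem' := by rintro a b ⟨c, hc⟩ ⟨d, hd⟩; exact ⟨c * d, sim_mul a b c d hc hd⟩
  inv_mem' := by rintro a ⟨c, hc⟩; exact ⟨c⁻¹, sim_inv a c hc⟩

/-- The isometry group of the bilinear form given by the matrix `J`:  all invertible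
matrices `g` with `gᵀ * J * g = J`. -/
def fixGroup (J : Matrix N N F) : Subgroup (GL N F) where
  carrier := {g | (g : Matrix N N F)ᵀ * J * (g : Matrix N N F) = J}
  one_mem' := by simp
  mul_mem' := by
    intro a b ha hb
    have := sim_mul (J := J) a b 1 1 (by simpa using ha) (by simpa using hb)
    simpa using this
  inv_mem' := by
    intro a ha
    have := sim_inv (J := J) a 1 (by simpa using ha)
    simpa using this

/-- The group of isometries of determinant one of the bilinear form given by the matrix `J`. -/
def specialFixGroup (J : Matrix N N F) : Subgroup (GL N F) where
  carrier := {g | (g : Matrix N N F)ᵀ * J * (g : Matrix N N F) = J ∧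
    ((g : Matrix N N F)).det = 1}
  one_mem' := ⟨by simp, by simp⟩
  mul_mem' := by
    rintro a b ⟨ha1, ha2⟩ ⟨hb1, hb2⟩
    refine ⟨(fixGroup J).mul_mem ha1 hb1, ?_⟩
    rw [show ((a * b : GL N F) : Matrix N N F) = (a : Matrix N N F) * b from rfl,
      Matrix.det_mul, ha2, hb2, one_mul]
  inv_mem' := by
    rintro a ⟨ha1, ha2⟩
    refine ⟨(fixGroup J).inv_mem ha1, ?_⟩
    have h := congrArg Matrix.det a.mul_inv
    rw [Matrix.det_mul, ha2, one_mul, Matrix.det_one] at h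
    exact h

/-- The connected component of the similitude group of the symmetric bilinear form on a
`2 * m`-dimensional space given by the matrix `J`:  all similitudes `g`, with similitude
character `μ`, such that `det g = μ(g) ^ m`. -/
def connSimilitudeGroup (J : Matrix N N F) (m : ℕ) : Subgroup (GL N F) where
  carrier := {g | ∃ c : Fˣ, (g : Matrix N N F)ᵀ * J * (g : Matrix N N F) = (c : F) • J ∧
    ((g : Matrix N N F)).det = (c : F) ^ m}
  one_mem' := ⟨1, sim_one J, by simp⟩
  mul_mem' := by
    rintro a b ⟨c, hc1, hc2⟩ ⟨d, hd1, hd2⟩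
    refine ⟨c * d, sim_mul a b c d hc1 hd1, ?_⟩
    rw [show ((a * b : GL N F) : Matrix N N F) = (a : Matrix N N F) * b from rfl,
      Matrix.det_mul, hc2, hd2, Units.val_mul, mul_pow]
  inv_mem' := by
    rintro a ⟨c, hc1, hc2⟩
    refine ⟨c⁻¹, sim_inv a c hc1, ?_⟩
    have h := congrArg Matrix.det a.mul_inv
    rw [Matrix.det_mul, hc2, Matrix.det_one] at h
    have hc : ((c : F) ^ m)⁻¹ = ((c⁻¹ : Fˣ) : F) ^ m := by
      rw [← inv_pow]
      norm_cast
    rw [← hc]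
    exact (inv_eq_of_mul_eq_one_right h).symm

theorem neg_one_mem_similitudeGroup (J : Matrix N N F) : (-1 : GL N F) ∈ similitudeGroup J := by
  refine ⟨1, ?_⟩
  have h : ((-1 : GL N F) : Matrix N N F) = -1 := by simp
  rw [h]
  simp

/-- The standard symplectic form matrix `[[0, I], [-I, 0]]`. -/
def Jsp (n : ℕ) (F : Type*) [Field F] : Matrix (Fin n ⊕ Fin n) (Fin n ⊕ Fin n) F :=
  Matrix.fromBlocks 0 1 (-1) 0

/-- The standard split symmetric form matrix `[[0, I], [I, 0]]`. -/
def Jsplit (n : ℕ) (F : Type*) [Field F] : Matrix (Fin n ⊕ Fin n) (Fin n ⊕ Fin n) F :=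
  Matrix.fromBlocks 0 1 1 0

/-- A symmetric matrix `J` of size `2n` is split if it is congruent to `[[0, I], [I, 0]]`. -/
def IsSplit {n : ℕ} (J : Matrix (Fin n ⊕ Fin n) (Fin n ⊕ Fin n) F) : Prop :=
  ∃ P : GL (Fin n ⊕ Fin n) F,
    (P : Matrix (Fin n ⊕ Fin n) (Fin n ⊕ Fin n) F)ᵀ * J * P = Jsplit n F

/-- The symplectic similitude group `GSp(2n, F)`. -/
def GSp (n : ℕ) (F : Type*) [Field F] : Subgroup (GL (Fin n ⊕ Fin n) F) :=
  similitudeGroup (Jsp n F)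

/-- The symplectic group `Sp(2n, F)`. -/
def Sp (n : ℕ) (F : Type*) [Field F] : Subgroup (GL (Fin n ⊕ Fin n) F) :=
  fixGroup (Jsp n F)


/-- The underlying matrix of an element of a matrix subgroup. -/
def matOf {S : Subgroup (GL N F)} (g : ↥S) : Matrix N N F := ((g : GL N F) : Matrix N N F)

end Groups

noncomputable instance subgroupFintype {G : Type*} [Group G] [Finite G] (S : Subgroup G) :
    Fintype S := Fintype.ofFinite _

namespace OrthRep

/-- A subspace stable under a representation. -/
def Stable {G W : Type*} [Group G] [AddCommGroup W] [Module ℂ W] (ρ : Representation ℂ G W)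
    (p : Submodule ℂ W) : Prop := ∀ g, ∀ w ∈ p, ρ g w ∈ p

/-- Irreducibility of a representation in terms of stable subspaces. -/
structure Irr {G W : Type*} [Group G] [AddCommGroup W] [Module ℂ W]
    (ρ : Representation ℂ G W) : Prop where
  nontrivial : Nontrivial W
  eq_bot_or_top : ∀ p : Submodule ℂ W, Stable ρ p → p = ⊥ ∨ p = ⊤

/-- Invariance of a bilinear form. -/
def Inv {G W : Type*} [Group G] [AddCommGroup W] [Module ℂ W] (ρ : Representation ℂ G W)
    (B : W →ₗ[ℂ] W →ₗ[ℂ] ℂ) : Prop := ∀ g x y, B (ρ g x) (ρ g y) = B x y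

/-- No irreducible representation carries a nonzero invariant alternating form. -/
def NoSymplectic (G : Type) [Group G] : Prop :=
  ∀ (W : Type) [AddCommGroup W] [Module ℂ W] [FiniteDimensional ℂ W] (ρ : Representation ℂ G W),
    Irr ρ → ∀ B, Inv ρ B → (∀ x, B x x = 0) → B = 0

/-- Every irreducible representation carries a nonzero invariant symmetric form. -/
def TotOrth (G : Type) [Group G] : Prop :=
  ∀ (W : Type) [AddCommGroup W] [Module ℂ W] [FiniteDimensional ℂ W] (ρ : Representation ℂ G W),
    Irr ρ → ∃ B, Inv ρ B ∧ (∀ x y, B x y = B y x) ∧ B ≠ 0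

section Basic

variable {G W : Type*} [Group G] [AddCommGroup W] [Module ℂ W] {ρ : Representation ℂ G W}

/-- The restriction of a representation to a stable subspace. -/
def subRep (ρ : Representation ℂ G W) (p : Submodule ℂ W) (hp : Stable ρ p) :
    Representation ℂ G p where
  toFun g := (ρ g).restrict (hp g)
  map_one' := by ext; simp
  map_mul' a b := by ext; simp

@[simp] theorem subRep_coe (p : Submodule ℂ W) (hp : Stable ρ p) (g : G) (x : p) :
    ((subRep ρ p hp g x : p) : W) = ρ g x := rfl

theorem rep_inv_self (g : G) (x : W) : ρ g⁻¹ (ρ g x) = x := by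
  rw [← Module.End.mul_apply, ← map_mul]; simp

theorem rep_self_inv (g : G) (x : W) : ρ g (ρ g⁻¹ x) = x := by
  rw [← Module.End.mul_apply, ← map_mul]; simp

theorem rep_mul (a b : G) (x : W) : ρ (a * b) x = ρ a (ρ b x) := by
  rw [map_mul]; rfl

theorem Stable.sup {p q : Submodule ℂ W} (hp : Stable ρ p) (hq : Stable ρ q) :
    Stable ρ (p ⊔ q) := by
  intro g w hw
  obtain ⟨a, ha, b, hb, rfl⟩ := Submodule.mem_sup.1 hw
  rw [map_add]
  exact Submodule.mem_sup.2 ⟨_, hp g a ha, _, hq g b hb, rfl⟩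

theorem Stable.inf {p q : Submodule ℂ W} (hp : Stable ρ p) (hq : Stable ρ q) :
    Stable ρ (p ⊓ q) := fun g w hw => ⟨hp g w hw.1, hq g w hw.2⟩

theorem Inv.ker_stable {B : W →ₗ[ℂ] W →ₗ[ℂ] ℂ} (hB : Inv ρ B) : Stable ρ (LinearMap.ker B) := by
  intro g w hw
  rw [LinearMap.mem_ker] at hw ⊢
  ext y
  rw [← rep_self_inv (ρ := ρ) g y, hB g, hw]; rfl

theorem Inv.injective_of_irr {B : W →ₗ[ℂ] W →ₗ[ℂ] ℂ} (hρ : Irr ρ) (hB : Inv ρ B) (h0 : B ≠ 0) :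
    ∀ x, B x = 0 → x = 0 := by
  intro x hx
  rcases hρ.eq_bot_or_top _ hB.ker_stable with h | h
  · have : x ∈ LinearMap.ker B := hx
    rwa [h, Submodule.mem_bot] at this
  · exact absurd (LinearMap.ker_eq_top.1 h) h0

theorem Inv.sub_smul {B C : W →ₗ[ℂ] W →ₗ[ℂ] ℂ} (hB : Inv ρ B) (hC : Inv ρ C) (c : ℂ) :
    Inv ρ (B - c • C) := by
  intro g x y; simp [hB g x y, hC g x y]

/-- Uniqueness of the invariant bilinear form on an irreducible representation. -/
theorem Inv.eq_smul [FiniteDimensional ℂ W] {B C : W →ₗ[ℂ] W →ₗ[ℂ] ℂ} (hρ : Irr ρ)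
    (hB : Inv ρ B) (hC : Inv ρ C) (h0 : C ≠ 0) : ∃ c : ℂ, B = c • C := by
  have := hρ.nontrivial
  have hinj : Function.Injective C := by
    rw [← LinearMap.ker_eq_bot, LinearMap.ker_eq_bot']
    exact hC.injective_of_irr hρ h0
  have hfin : Module.finrank ℂ W = Module.finrank ℂ (W →ₗ[ℂ] ℂ) :=
    (Subspace.dual_finrank_eq (K := ℂ) (V := W)).symm
  let e : W ≃ₗ[ℂ] (W →ₗ[ℂ] ℂ) := LinearEquiv.ofInjectiveOfFinrankEq C hinj hfin
  obtain ⟨c, hc⟩ := Module.End.exists_eigenvalue (e.symm.toLinearMap ∘ₗ B : Module.End ℂ W)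
  obtain ⟨x, hx⟩ := hc.exists_hasEigenvector
  refine ⟨c, ?_⟩
  by_contra hne
  have h1 := (hB.sub_smul hC c).injective_of_irr hρ (sub_ne_zero.2 hne) x ?_
  · exact hx.2 h1
  · have h2 := hx.apply_eq_smul
    have h3 : B x = e (c • x) := by rw [← h2]; simp
    rw [map_smul] at h3
    have h4 : e x = C x := rfl
    simp [h3, h4]

theorem not_sym_and_alt [FiniteDimensional ℂ W] {B C : W →ₗ[ℂ] W →ₗ[ℂ] ℂ} (hρ : Irr ρ)
    (hB : Inv ρ B) (hBs : ∀ x y, B x y = B y x) (hC : Inv ρ C) (hCa : ∀ x, C x x = 0)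
    (hC0 : C ≠ 0) : B = 0 := by
  obtain ⟨c, rfl⟩ := hB.eq_smul hρ hC hC0
  ext x y
  have h1 := hBs x y
  have h2 := hCa (x + y)
  simp only [map_add, LinearMap.add_apply, hCa, zero_add, add_zero] at h2
  have h3 : C y x = - C x y := by linear_combination h2
  simp only [LinearMap.smul_apply, smul_eq_mul, h3] at h1 ⊢
  simp only [LinearMap.zero_apply]
  linear_combination h1 / 2

theorem exists_irr_le [FiniteDimensional ℂ W] (p : Submodule ℂ W) (hp : Stable ρ p)
    (h0 : p ≠ ⊥) : ∃ q ≤ p, ∃ hq : Stable ρ q, Irr (subRep ρ q hq) := by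
  obtain ⟨q, ⟨hq1, hq2, hq3⟩, hmin⟩ := (wellFounded_lt (α := Submodule ℂ W)).has_min
    {q | q ≤ p ∧ Stable ρ q ∧ q ≠ ⊥} ⟨p, le_rfl, hp, h0⟩
  refine ⟨q, hq1, hq2, ⟨(Submodule.nontrivial_iff_ne_bot).2 hq3, fun r hr => ?_⟩⟩
  by_contra! hcon
  refine hmin (r.map q.subtype) ⟨(Submodule.map_subtype_le q r).trans hq1, ?_, ?_⟩ ?_
  · rintro g _ ⟨x, hx, rfl⟩
    exact ⟨_, hr g x hx, rfl⟩
  · intro h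
    exact hcon.1 (Submodule.map_injective_of_injective q.injective_subtype (by simpa using h))
  · refine lt_of_le_of_ne (Submodule.map_subtype_le q r) fun h => hcon.2 ?_
    rw [eq_top_iff]
    rintro ⟨x, hx⟩ -
    rw [← h] at hx
    obtain ⟨y, hy, rfl⟩ := hx
    exact hy

theorem Irr.isIrreducible (hρ : Irr ρ) : ρ.IsIrreducible where
  exists_pair_ne := ⟨⊥, ⊤, fun h => by
    obtain ⟨x, hx⟩ := @exists_ne _ hρ.nontrivial (0 : W)
    have : x ∈ (⊤ : Subrepresentation ρ) := trivial
    rw [← h] at this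
    exact hx this⟩
  eq_bot_or_eq_top p := by
    rcases hρ.eq_bot_or_top p.toSubmodule (fun g w hw => p.apply_mem_toSubmodule g hw) with h | h
    · exact Or.inl (Subrepresentation.toSubmodule_injective h)
    · exact Or.inr (Subrepresentation.toSubmodule_injective h)

theorem exists_compl [Finite G] (p : Submodule ℂ W) (hp : Stable ρ p) :
    ∃ q, Stable ρ q ∧ IsCompl p q := by
  have : NeZero (Nat.card G : ℂ) := ⟨Nat.cast_ne_zero.2 Nat.card_pos.ne'⟩
  obtain ⟨q, hq⟩ := exists_isCompl (⟨p, fun g v hv => hp g v hv⟩ : Subrepresentation ρ)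
  refine ⟨q.toSubmodule, fun g w hw => q.apply_mem_toSubmodule g hw, ?_⟩
  rw [isCompl_iff, disjoint_iff, codisjoint_iff] at hq ⊢
  have h1 := congrArg Subrepresentation.toSubmodule hq.1
  have h2 := congrArg Subrepresentation.toSubmodule hq.2
  exact ⟨h1, h2⟩

/-- A stable projection onto a stable subspace. -/
theorem exists_proj [Finite G] (p : Submodule ℂ W) (hp : Stable ρ p) :
    ∃ f : W →ₗ[ℂ] p, (∀ x : p, f x = x) ∧ ∀ g x, f (ρ g x) = subRep ρ p hp g (f x) := by
  obtain ⟨q, hq, hc⟩ := exists_compl p hp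
  refine ⟨Submodule.projectionOnto p q hc, Submodule.projectionOnto_apply_left hc, ?_⟩
  intro g x
  obtain ⟨a, ha, b, hb, rfl⟩ := Submodule.mem_sup.1 (hc.sup_eq_top ▸ Submodule.mem_top : x ∈ p ⊔ q)
  simp only [map_add]
  have e1 : Submodule.projectionOnto p q hc a = ⟨a, ha⟩ :=
    Submodule.projectionOnto_apply_left hc ⟨a, ha⟩
  have e2 : Submodule.projectionOnto p q hc (ρ g a) = ⟨ρ g a, hp g a ha⟩ :=
    Submodule.projectionOnto_apply_left hc ⟨_, hp g a ha⟩
  have e3 : Submodule.projectionOnto p q hc b = 0 :=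
    (Submodule.projectionOnto_apply_eq_zero_iff hc).2 hb
  have e4 : Submodule.projectionOnto p q hc (ρ g b) = 0 :=
    (Submodule.projectionOnto_apply_eq_zero_iff hc).2 (hq g b hb)
  rw [e1, e2, e3, e4]
  simp [Subtype.ext_iff]

end Basic

section Transport

variable {G H W : Type*} [Group G] [Group H] [AddCommGroup W] [Module ℂ W]

theorem Irr.comp_surjective {ρ : Representation ℂ H W} (hρ : Irr ρ) (f : G →* H)
    (hf : Function.Surjective f) : Irr (ρ.comp f : Representation ℂ G W) :=
  ⟨hρ.nontrivial, fun p hp => hρ.eq_bot_or_top p fun h => by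
    obtain ⟨g, rfl⟩ := hf h; exact hp g⟩

theorem TotOrth.of_surjective {G H : Type} [Group G] [Group H] (h : TotOrth G) (f : G →* H)
    (hf : Function.Surjective f) : TotOrth H := by
  intro W _ _ _ ρ hρ
  obtain ⟨B, h1, h2⟩ := h W _ (hρ.comp_surjective f hf)
  refine ⟨B, fun k => ?_, h2⟩
  obtain ⟨g, rfl⟩ := hf k
  exact h1 g

theorem NoSymplectic.of_surjective {G H : Type} [Group G] [Group H] (h : NoSymplectic G)
    (f : G →* H) (hf : Function.Surjective f) : NoSymplectic H := by
  intro W _ _ _ ρ hρ B h1 h2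
  exact h W _ (hρ.comp_surjective f hf) B (fun g => h1 (f g)) h2

theorem TotOrth.noSymplectic {G : Type} [Group G] (h : TotOrth G) : NoSymplectic G := by
  intro W _ _ _ ρ hρ B h1 h2
  obtain ⟨C, c1, c2, c3⟩ := h W ρ hρ
  by_contra h0
  exact c3 (not_sym_and_alt hρ c1 c2 h1 h2 h0)

end Transport

section RealChar

variable {G W : Type} [Group G] [Fintype G] [AddCommGroup W] [Module ℂ W] [FiniteDimensional ℂ W]
  {ρ : Representation ℂ G W}

theorem sum_char_mul_char_inv (hρ : Irr ρ) :
    ∑ g, ρ.character g * ρ.character g⁻¹ = Fintype.card G := by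
  have := hρ.isIrreducible
  have hc : (Nat.card G : ℂ) ≠ 0 := Nat.cast_ne_zero.2 Nat.card_pos.ne'
  let _ : Invertible (Nat.card G : ℂ) := invertibleOfNonzero hc
  have h := Representation.card_inv_mul_sum_char_mul_char_eq_finrank ρ ρ
  rw [Representation.IsIrreducible.finrank_intertwiningMap_self] at h
  rw [← Nat.card_eq_fintype_card]
  field_simp at h
  simpa using h

theorem exists_inv_form (hρ : Irr ρ) (hr : ∀ g, ρ.character g⁻¹ = ρ.character g) :
    ∃ B, Inv ρ B ∧ B ≠ 0 := by
  have hc : (Nat.card G : ℂ) ≠ 0 := Nat.cast_ne_zero.2 Nat.card_pos.ne'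
  let _ : Invertible (Nat.card G : ℂ) := invertibleOfNonzero hc
  have h := Representation.card_inv_mul_sum_char_mul_char_eq_finrank ρ ρ.dual
  have h2 : ∑ g, ρ.dual.character g * ρ.character g⁻¹ = Fintype.card G := by
    rw [← sum_char_mul_char_inv hρ]
    refine Finset.sum_congr rfl fun g _ => ?_
    rw [Representation.char_dual, hr g]
  rw [h2] at h
  have h3 : Module.finrank ℂ (Representation.IntertwiningMap ρ ρ.dual) ≠ 0 := by
    intro h0
    rw [h0] at h
    simp at h
  have h4 : Nontrivial (Representation.IntertwiningMap ρ ρ.dual) := by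
    by_contra hn
    rw [not_nontrivial_iff_subsingleton] at hn
    exact h3 Module.finrank_zero_of_subsingleton
  obtain ⟨f, hf⟩ := exists_ne (0 : Representation.IntertwiningMap ρ ρ.dual)
  refine ⟨f.toLinearMap, ?_, fun h0 => hf (Representation.IntertwiningMap.ext h0)⟩
  intro g x y
  have := Representation.IntertwiningMap.isIntertwining _ _ f g x
  have h5 : f.toLinearMap (ρ g x) = ρ.dual g (f.toLinearMap x) := this
  rw [h5, Representation.dual_apply]
  simp [Module.Dual.transpose_apply]

theorem exists_sym_or_alt (hρ : Irr ρ) (hr : ∀ g, ρ.character g⁻¹ = ρ.character g) :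
    (∃ B, Inv ρ B ∧ (∀ x y, B x y = B y x) ∧ B ≠ 0) ∨
    (∃ B, Inv ρ B ∧ (∀ x, B x x = 0) ∧ B ≠ 0) := by
  obtain ⟨B, hB, h0⟩ := exists_inv_form hρ hr
  by_cases hs : B + B.flip = 0
  · right
    refine ⟨B, hB, fun x => ?_, h0⟩
    have := LinearMap.congr_fun₂ hs x x
    simp only [LinearMap.add_apply, LinearMap.flip_apply, LinearMap.zero_apply] at this
    linear_combination this / 2
  · left
    refine ⟨B + B.flip, fun g x y => ?_, fun x y => ?_, hs⟩
    · simp [hB g x y, hB g y x]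
    · simp [add_comm]

theorem NoSymplectic.totOrth {G : Type} [Group G] [Finite G] (h : NoSymplectic G)
    (hreal : ∀ g : G, IsConj g g⁻¹) : TotOrth G := by
  have := Fintype.ofFinite G
  intro W _ _ _ ρ hρ
  have hr : ∀ g, ρ.character g⁻¹ = ρ.character g := fun g => by
    obtain ⟨c, hc⟩ := isConj_iff.1 (hreal g)
    rw [← hc, Representation.char_conj]
  rcases exists_sym_or_alt hρ hr with hs | ⟨B, h1, h2, h3⟩
  · exact hs
  · exact absurd (h W ρ hρ B h1 h2) h3

end RealChar

section Clifford

/-- An irreducible representation with an invariant alternating form whose restriction to a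
subgroup of index at most two contains an irreducible with an invariant symmetric form. -/
theorem index_two_form {G W : Type} [Group G] [Finite G] [AddCommGroup W] [Module ℂ W]
    [FiniteDimensional ℂ W] {ρ : Representation ℂ G W} (hρ : Irr ρ)
    {C : W →ₗ[ℂ] W →ₗ[ℂ] ℂ} (hC : Inv ρ C) (hCa : ∀ x, C x x = 0) (hC0 : C ≠ 0)
    (N : Subgroup G) (hN : N.index ≤ 2) (p : Submodule ℂ W)
    (hp : Stable (ρ.comp N.subtype : Representation ℂ N W) p)
    (hirr : Irr (subRep (ρ.comp N.subtype : Representation ℂ N W) p hp))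
    {β : p →ₗ[ℂ] p →ₗ[ℂ] ℂ} (hβ : Inv (subRep (ρ.comp N.subtype : Representation ℂ N W) p hp) β)
    (hβs : ∀ x y, β x y = β y x) : β = 0 := by
  obtain ⟨w, hw1, hw2, hw3⟩ : ∃ w : G, w * w ∈ N ∧ (∀ n ∈ N, w * n * w⁻¹ ∈ N) ∧
      ∀ g, g ∈ N ∨ w⁻¹ * g ∈ N := by
    have h0 : N.index ≠ 0 := Subgroup.FiniteIndex.index_ne_zero
    rcases (by omega : N.index = 1 ∨ N.index = 2) with h | h
    · rw [Subgroup.index_eq_one] at h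
      exact ⟨1, by simp [h]⟩
    · have hnorm := Subgroup.normal_of_index_eq_two h
      obtain ⟨w, hw⟩ : ∃ w, w ∉ N := by
        by_contra! hcon
        rw [(Subgroup.eq_top_iff' N).2 hcon] at h
        simp at h
      refine ⟨w, Subgroup.mul_self_mem_of_index_two h w, fun n hn => hnorm.conj_mem n hn w, ?_⟩
      intro g
      rw [Subgroup.mul_mem_iff_of_index_two h, inv_mem_iff]
      tauto
  by_contra hβ0
  obtain ⟨f, hf1, hf2⟩ := exists_proj p hp
  have hf2' : ∀ n ∈ N, ∀ x, (f (ρ n x) : W) = ρ n (f x) := fun n hn x =>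
    congrArg Subtype.val (hf2 ⟨n, hn⟩ x)
  let b1 : W →ₗ[ℂ] W →ₗ[ℂ] ℂ := β.compl₁₂ f f
  have hb1 : ∀ x y, b1 x y = β (f x) (f y) := fun x y => rfl
  have hb1N : ∀ n ∈ N, ∀ x y, b1 (ρ n x) (ρ n y) = b1 x y := fun n hn x y => by
    rw [hb1, hb1]
    have e1 := hf2 ⟨n, hn⟩ x
    have e2 := hf2 ⟨n, hn⟩ y
    simp only [MonoidHom.comp_apply, Subgroup.subtype_apply] at e1 e2
    rw [e1, e2, hβ]
  let b2 : W →ₗ[ℂ] W →ₗ[ℂ] ℂ := b1 + b1.compl₁₂ (ρ w) (ρ w)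
  have hb2 : ∀ x y, b2 x y = b1 x y + b1 (ρ w x) (ρ w y) := fun x y => rfl
  have hb2N : ∀ n ∈ N, ∀ x y, b2 (ρ n x) (ρ n y) = b2 x y := fun n hn x y => by
    rw [hb2, hb2, hb1N n hn]
    have e : ∀ z, ρ w (ρ n z) = ρ (w * n * w⁻¹) (ρ w z) := fun z => by
      rw [← rep_mul, ← rep_mul]; simp
    rw [e, e, hb1N _ (hw2 n hn)]
  have hb2w : ∀ x y, b2 (ρ w x) (ρ w y) = b2 x y := fun x y => by
    rw [hb2, hb2, ← rep_mul, ← rep_mul, hb1N _ hw1, add_comm]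
  have hb2i : Inv ρ b2 := fun g x y => by
    rcases hw3 g with h | h
    · exact hb2N g h x y
    · have e : ∀ z, ρ g z = ρ w (ρ (w⁻¹ * g) z) := fun z => by rw [← rep_mul]; simp
      rw [e, e, hb2w, hb2N _ h]
  have hz : b2 = 0 := not_sym_and_alt hρ hb2i
    (fun x y => by rw [hb2, hb2, hb1, hb1, hb1, hb1, hβs, hβs (f (ρ w x))]) hC hCa hC0
  have hneg : ∀ x y, b1 (ρ w x) (ρ w y) = - b1 x y := fun x y => by
    have := hb2 x y
    rw [hz] at this
    simp only [LinearMap.zero_apply] at this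
    linear_combination -this
  have hinj := hβ.injective_of_irr hirr hβ0
  have hsurj : ∀ z : p, ∃ y, f y = z := fun z => ⟨z, hf1 z⟩
  have hker : ∀ x, (∀ y, b1 x y = 0) ↔ f x = 0 := fun x => by
    constructor
    · intro h
      refine hinj _ ?_
      ext z
      rw [← hf1 z]; exact h z
    · intro h y
      rw [hb1, h]; simp
  have hst : Stable ρ (LinearMap.ker f) := by
    intro g x hx
    rw [LinearMap.mem_ker] at hx ⊢
    have hNst : ∀ n ∈ N, ∀ x, f x = 0 → f (ρ n x) = 0 := fun n hn x hx => by
      have := hf2' n hn x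
      rw [hx] at this
      simpa using this
    rcases hw3 g with h | h
    · exact hNst g h x hx
    · have e : ∀ z, ρ g z = ρ w (ρ (w⁻¹ * g) z) := fun z => by rw [← rep_mul]; simp
      rw [e]
      have h2 := hNst _ h x hx
      generalize ρ (w⁻¹ * g) x = x' at h2
      rw [← hker] at h2 ⊢
      intro y
      rw [← rep_self_inv (ρ := ρ) w y, hneg, h2, neg_zero]
  rcases hρ.eq_bot_or_top _ hst with h | h
  · have hfinj : Function.Injective f := LinearMap.ker_eq_bot.1 h
    have hall : ∀ x, (f x : W) = x := fun x => hfinj (hf1 (f x))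
    have hirrW : Irr (ρ.comp N.subtype : Representation ℂ N W) := by
      refine ⟨hρ.nontrivial, fun q hq => ?_⟩
      have hpt : p = ⊤ := by
        rw [eq_top_iff]; intro x _; rw [← hall x]; exact (f x).2
      rcases hirr.eq_bot_or_top (q.comap p.subtype) (fun g x hx => hq g x hx) with h1 | h1
      · left
        rw [eq_bot_iff]
        intro x hx
        have hm : (⟨x, hpt ▸ trivial⟩ : p) ∈ q.comap p.subtype := hx
        rw [h1] at hm
        simpa using hm
      · right
        rw [eq_top_iff]
        intro x _
        have hm : (⟨x, hpt ▸ trivial⟩ : p) ∈ q.comap p.subtype := h1 ▸ trivial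
        exact hm
    have := not_sym_and_alt hirrW (B := b1) (C := C) (fun n x y => hb1N n n.2 x y)
      (fun x y => by rw [hb1, hb1, hβs]) (fun n x y => hC n x y) hCa hC0
    refine hβ0 ?_
    ext x y
    have h5 := LinearMap.congr_fun₂ this x y
    rw [hb1, hf1, hf1] at h5
    exact h5
  · have hf0 : f = 0 := LinearMap.ker_eq_top.1 h
    obtain ⟨z, hz⟩ := @exists_ne _ hirr.nontrivial (0 : p)
    exact hz (by rw [← hf1 z, hf0]; rfl)

theorem NoSymplectic.of_index_le_two {G : Type} [Group G] [Finite G] (N : Subgroup G)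
    (hN : N.index ≤ 2) (h : TotOrth N) : NoSymplectic G := by
  intro W _ _ _ ρ hρ C hC hCa
  by_contra hC0
  have := hρ.nontrivial
  obtain ⟨p, -, hp, hirr⟩ := exists_irr_le (ρ := (ρ.comp N.subtype : Representation ℂ N W)) ⊤
    (fun _ _ _ => trivial) top_ne_bot
  obtain ⟨β, h1, h2, h3⟩ := h p _ hirr
  exact h3 (index_two_form hρ hC hCa hC0 N hN p hp hirr h1 h2)

end Clifford

section Product

theorem NoSymplectic.prod {H K : Type} [Group H] [Group K] (hH : TotOrth H)
    (hK : NoSymplectic K) : NoSymplectic (H × K) := by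
  intro W _ _ _ ρ hρ ω hω hωa
  have := hρ.nontrivial
  let ρ1 : Representation ℂ H W := ρ.comp (MonoidHom.inl H K)
  let ρ2 : Representation ℂ K W := ρ.comp (MonoidHom.inr H K)
  have hcomm : ∀ h k x, ρ1 h (ρ2 k x) = ρ2 k (ρ1 h x) := fun h k x => by
    change ρ (h, 1) (ρ (1, k) x) = ρ (1, k) (ρ (h, 1) x)
    rw [← rep_mul, ← rep_mul]; simp
  have hsplit : ∀ h k x, ρ (h, k) x = ρ1 h (ρ2 k x) := fun h k x => by
    change _ = ρ (h, 1) (ρ (1, k) x)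
    rw [← rep_mul]; simp
  obtain ⟨p, -, hp, hirr⟩ := exists_irr_le (ρ := ρ1) ⊤ (fun _ _ _ => trivial) top_ne_bot
  obtain ⟨β, hβ, hβs, hβ0⟩ := hH p _ hirr
  let σ : Representation ℂ K (p →ₗ[ℂ] W) :=
    { toFun := fun k => LinearMap.compRight ℂ (ρ2 k)
      map_one' := by ext; simp
      map_mul' := fun a b => by ext; simp }
  have hσ : ∀ k f x, σ k f x = ρ2 k (f x) := fun k f x => rfl
  let E : Submodule ℂ (p →ₗ[ℂ] W) :=
    { carrier := {f | ∀ h x, f (subRep ρ1 p hp h x) = ρ1 h (f x)}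
      add_mem' := fun {a b} ha hb h x => by simp [ha h x, hb h x]
      zero_mem' := fun h x => by simp
      smul_mem' := fun c f hf h x => by simp [hf h x] }
  have hE : Stable σ E := fun k f hf h x => by
    rw [hσ, hσ, hf h x, hcomm]
  have hE0 : E ≠ ⊥ := by
    intro h
    have : p.subtype ∈ E := fun h x => rfl
    rw [h, Submodule.mem_bot] at this
    obtain ⟨z, hz⟩ := @exists_ne _ hirr.nontrivial (0 : p)
    exact hz (Subtype.ext (LinearMap.congr_fun this z))
  obtain ⟨n, hnE, hn, hnirr⟩ := exists_irr_le E hE hE0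
  obtain ⟨w1, w2, hw⟩ : ∃ w1 w2, β w1 w2 ≠ 0 := by
    by_contra! hcon
    exact hβ0 (LinearMap.ext₂ hcon)
  let c : n →ₗ[ℂ] n →ₗ[ℂ] ℂ :=
    ω.compl₁₂ ((LinearMap.applyₗ w1).comp n.subtype) ((LinearMap.applyₗ w2).comp n.subtype)
  have hc : ∀ f f' : n, c f f' = ω (f.1 w1) (f'.1 w2) := fun f f' => rfl
  have hinv : ∀ f ∈ E, ∀ f' ∈ E, Inv (subRep ρ1 p hp) (ω.compl₁₂ f f') := by
    intro f hf f' hf' h x y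
    simp only [LinearMap.compl₁₂_apply]
    rw [hf h, hf' h]
    exact hω (h, 1) _ _
  have hc0 : c = 0 := by
    refine hK n _ hnirr c (fun k f f' => ?_) fun f => ?_
    · rw [hc, hc]
      exact hω (1, k) _ _
    · rw [hc]
      by_contra h0
      refine hβ0 (not_sym_and_alt hirr hβ hβs (hinv f (hnE f.2) f (hnE f.2))
        (fun x => hωa _) fun h => h0 ?_)
      exact LinearMap.congr_fun₂ h w1 w2
  have hall : ∀ f ∈ n, ∀ f' ∈ n, ∀ x y, ω (f x) (f' y) = 0 := by
    intro f hf f' hf' x y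
    obtain ⟨a, ha⟩ := (hinv f (hnE hf) f' (hnE hf')).eq_smul hirr hβ hβ0
    have h1 := LinearMap.congr_fun₂ ha w1 w2
    have h2 := LinearMap.congr_fun₂ ha x y
    have h3 : c ⟨f, hf⟩ ⟨f', hf'⟩ = 0 := by rw [hc0]; rfl
    rw [hc] at h3
    simp only [LinearMap.compl₁₂_apply, LinearMap.smul_apply, smul_eq_mul] at h1 h2
    rw [h3] at h1
    have : a = 0 := by simpa [hw] using h1.symm
    simpa [this] using h2
  let P : Submodule ℂ W := Submodule.span ℂ {y | ∃ f ∈ n, ∃ x, f x = y}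
  have hP : Stable ρ P := by
    rintro ⟨h, k⟩ w hw
    induction hw using Submodule.span_induction with
    | mem y hy =>
      obtain ⟨f, hf, x, rfl⟩ := hy
      refine Submodule.subset_span ⟨σ k f, hn k f hf, subRep ρ1 p hp h x, ?_⟩
      rw [hsplit, hσ, hnE hf h, hcomm]
    | zero => simp
    | add x y _ _ hx hy => rw [map_add]; exact P.add_mem hx hy
    | smul a x _ hx => rw [map_smul]; exact P.smul_mem a hx
  rcases hρ.eq_bot_or_top P hP with h | h
  · exfalso
    obtain ⟨⟨f, hf⟩, hf0⟩ := @exists_ne _ hnirr.nontrivial (0 : n)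
    refine hf0 (Subtype.ext (LinearMap.ext fun x => ?_))
    have : f x ∈ P := Submodule.subset_span ⟨f, hf, x, rfl⟩
    rw [h] at this
    simpa using this
  · ext x y
    have hx : x ∈ P := h ▸ trivial
    have hy : y ∈ P := h ▸ trivial
    simp only [LinearMap.zero_apply]
    induction hx using Submodule.span_induction with
    | mem x hx =>
      obtain ⟨f, hf, x, rfl⟩ := hx
      induction hy using Submodule.span_induction with
      | mem y hy => obtain ⟨f', hf', y, rfl⟩ := hy; exact hall f hf f' hf' x y
      | zero => simp
      | add a b _ _ ha hb => simp [ha, hb]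
      | smul a b _ hb => simp [hb]
    | zero => simp
    | add a b _ _ ha hb => simp [ha, hb]
    | smul a b _ hb => simp [hb]

end Product

section Dihedral

theorem TotOrth.dihedral {G : Type} [Group G] [Finite G] (g τ : G) (hτ : τ * τ = 1)
    (hg : τ * g * τ = g⁻¹) (hall : ∀ t : G, ∃ k : ℕ, t = g ^ k ∨ t = g ^ k * τ) : TotOrth G := by
  have hτ' : τ⁻¹ = τ := inv_eq_of_mul_eq_one_left hτ
  have hconj : ∀ k : ℕ, τ * g ^ k * τ = (g ^ k)⁻¹ := fun k => by
    have := conj_pow (i := k) (a := τ) (b := g)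
    rw [hτ', hg] at this
    rw [← this, inv_pow]
  refine NoSymplectic.totOrth ?_ fun t => ?_
  · intro W _ _ _ ρ hρ ω hω hωa
    have := hρ.nontrivial
    obtain ⟨c, hc⟩ := Module.End.exists_eigenvalue (ρ g)
    obtain ⟨v, hv⟩ := hc.exists_hasEigenvector
    have hgv : ρ g v = c • v := hv.apply_eq_smul
    let P : Submodule ℂ W := Submodule.span ℂ {v, ρ τ v}
    have hv1 : v ∈ P := Submodule.subset_span (by simp)
    have hv2 : ρ τ v ∈ P := Submodule.subset_span (by simp)
    have hPτ : ∀ x ∈ P, ρ τ x ∈ P := by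
      intro x hx
      obtain ⟨a, b, rfl⟩ := Submodule.mem_span_pair.1 hx
      rw [map_add, map_smul, map_smul, ← rep_mul, hτ]
      exact P.add_mem (P.smul_mem _ hv2) (P.smul_mem _ (by simpa using hv1))
    have hgτ : ρ g (ρ τ v) ∈ P := by
      have hc0 : c ≠ 0 := by
        rintro rfl
        have := rep_inv_self (ρ := ρ) g v
        rw [hgv] at this
        exact hv.2 (by simpa using this.symm)
      have h1 : ρ g⁻¹ v = c⁻¹ • v := by
        have := rep_inv_self (ρ := ρ) g v
        rw [hgv, map_smul] at this
        rw [eq_inv_smul_iff₀ hc0, this]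
      have h2 : g * τ = τ * g⁻¹ := by
        rw [← hg]; simp only [← mul_assoc, hτ, one_mul]
      rw [← rep_mul, h2, rep_mul, h1, map_smul]
      exact P.smul_mem _ hv2
    have hPg : ∀ x ∈ P, ρ g x ∈ P := by
      intro x hx
      obtain ⟨a, b, rfl⟩ := Submodule.mem_span_pair.1 hx
      rw [map_add, map_smul, map_smul, hgv]
      exact P.add_mem (P.smul_mem _ (P.smul_mem _ hv1)) (P.smul_mem _ hgτ)
    have hPk : ∀ k : ℕ, ∀ x ∈ P, ρ (g ^ k) x ∈ P := by
      intro k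
      induction k with
      | zero => intro x hx; simpa using hx
      | succ k ih => intro x hx; rw [pow_succ, rep_mul]; exact ih _ (hPg x hx)
    have hP : Stable ρ P := by
      intro t x hx
      obtain ⟨k, rfl | rfl⟩ := hall t
      · exact hPk k x hx
      · rw [rep_mul]; exact hPk k _ (hPτ x hx)
    by_contra hω0
    refine hv.2 (hω.injective_of_irr hρ hω0 v ?_)
    have h1 : ω v (ρ τ v) = 0 := by
      have h := hω τ v (ρ τ v)
      rw [← rep_mul, hτ, map_one, Module.End.one_apply] at h
      have h2 := hωa (v + ρ τ v)
      simp only [map_add, LinearMap.add_apply, hωa, zero_add, add_zero] at h2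
      linear_combination (h2 - h) / 2
    have hPt : P = ⊤ := (hρ.eq_bot_or_top P hP).resolve_left fun h => by
      rw [h] at hv1; exact hv.2 (by simpa using hv1)
    ext x
    have hx : x ∈ P := hPt ▸ trivial
    obtain ⟨a, b, rfl⟩ := Submodule.mem_span_pair.1 hx
    simp [hωa, h1]
  · obtain ⟨k, rfl | rfl⟩ := hall t
    · exact isConj_iff.2 ⟨τ, by rw [hτ', hconj]⟩
    · have : (g ^ k * τ)⁻¹ = g ^ k * τ := by
        rw [_root_.mul_inv_rev, hτ', ← hconj k]
        simp only [← mul_assoc, hτ, one_mul]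
      rw [this]

end Dihedral

section Integrality

theorem isIntegral_trace_of_pow {M : Type*} [AddCommGroup M] [Module ℂ M] [FiniteDimensional ℂ M]
    (A : Module.End ℂ M) (n : ℕ) (hn : n ≠ 0) (hA : A ^ (n + 1) = A) :
    IsIntegral ℤ (LinearMap.trace ℂ M A) := by
  rw [Module.End.trace_eq_sum_roots_charpoly_of_splits (IsAlgClosed.splits _)]
  refine Subalgebra.multiset_sum_mem (S := integralClosure ℤ ℂ) (h := fun c hc => ?_)
  have hc' : Module.End.HasEigenvalue A c :=
    (Module.End.hasEigenvalue_iff_isRoot_charpoly A c).2 (Polynomial.isRoot_of_mem_roots hc)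
  obtain ⟨v, hv⟩ := hc'.exists_hasEigenvector
  have h1 : c ^ (n + 1) = c := by
    have h2 := hv.pow_apply (n + 1)
    rw [hA, hv.apply_eq_smul] at h2
    exact (smul_left_injective ℂ hv.2 h2).symm
  refine ⟨Polynomial.X ^ (n + 1) - Polynomial.X, ?_, ?_⟩
  · refine Polynomial.monic_X_pow_sub ?_
    rw [Polynomial.degree_X]
    exact_mod_cast Nat.succ_lt_succ (Nat.pos_of_ne_zero hn)
  · simp [h1]

theorem isIntegral_average_char {G M : Type*} [Group G] [Finite G] [AddCommGroup M] [Module ℂ M]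
    [FiniteDimensional ℂ M] (σ : Representation ℂ G M) (y : G) (Q : Subgroup G) [Fintype Q]
    (hQ : ∀ t ∈ Q, t * y = y * t) :
    IsIntegral ℤ ((Nat.card Q : ℂ)⁻¹ * ∑ t : Q, σ.character (y * t)) := by
  have hc : (Nat.card Q : ℂ) ≠ 0 := Nat.cast_ne_zero.2 Nat.card_pos.ne'
  let e : Module.End ℂ M := (Nat.card Q : ℂ)⁻¹ • ∑ t : Q, σ t
  have hte : ∀ t : Q, σ t * e = e := fun t => by
    simp only [e, mul_smul_comm, Finset.mul_sum]
    congr 1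
    exact Fintype.sum_equiv (Equiv.mulLeft t) _ _ fun s => by simp
  have hee : e * e = e := by
    nth_rw 1 [show e = (Nat.card Q : ℂ)⁻¹ • ∑ t : Q, σ t from rfl]
    rw [smul_mul_assoc, Finset.sum_mul, Finset.sum_congr rfl fun t _ => hte t]
    rw [Finset.sum_const, Finset.card_univ, ← Nat.card_eq_fintype_card, ← Nat.cast_smul_eq_nsmul ℂ,
      smul_smul, inv_mul_cancel₀ hc, one_smul]
  have hye : Commute (σ y) e := by
    simp only [e, Commute, SemiconjBy, mul_smul_comm, smul_mul_assoc, Finset.mul_sum,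
      Finset.sum_mul]
    congr 1
    refine Finset.sum_congr rfl fun t _ => ?_
    rw [← map_mul, ← map_mul, hQ t t.2]
  have htr : (Nat.card Q : ℂ)⁻¹ * ∑ t : Q, σ.character (y * t) =
      LinearMap.trace ℂ M (σ y * e) := by
    simp only [e, mul_smul_comm, Finset.mul_sum, map_smul, map_sum, smul_eq_mul,
      Representation.character, map_mul]
  rw [htr]
  refine isIntegral_trace_of_pow _ (Nat.card G) Nat.card_pos.ne' ?_
  have he : ∀ n : ℕ, e ^ (n + 1) = e := fun n => by
    induction n with
    | zero => simp
    | succ n ih => rw [pow_succ, ih, hee]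
  rw [hye.mul_pow, he, ← map_pow, pow_succ, pow_card_eq_one', one_mul]

end Integrality

section Lagrangian

variable {G M : Type} [Group G] [Finite G] [AddCommGroup M] [Module ℂ M] [FiniteDimensional ℂ M]

/-- The character of a symplectic representation of a group with no irreducible symplectic
representations has the form `ψ + conj ψ`. -/
theorem exists_char_eq_add (hG : NoSymplectic G) (ρ : Representation ℂ G M)
    (ω : M →ₗ[ℂ] M →ₗ[ℂ] ℂ) (hω : Inv ρ ω) (hωa : ∀ x, ω x x = 0)
    (hω0 : ∀ x, ω x = 0 → x = 0) :
    ∃ (p : Submodule ℂ M) (σ : Representation ℂ G p),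
      ∀ g, ρ.character g = σ.character g + σ.character g⁻¹ := by
  have hsk : ∀ x y, ω x y = - ω y x := fun x y => by
    have h2 := hωa (x + y)
    simp only [map_add, LinearMap.add_apply, hωa, zero_add, add_zero] at h2
    linear_combination h2
  obtain ⟨L, ⟨hL, hLi⟩, hmax⟩ := (wellFounded_gt (α := Submodule ℂ M)).has_min
    {p | Stable ρ p ∧ ∀ x ∈ p, ∀ y ∈ p, ω x y = 0}
    ⟨⊥, fun g w hw => by rw [Submodule.mem_bot] at hw ⊢; rw [hw, map_zero],
      fun x hx y hy => by rw [(Submodule.mem_bot ℂ).1 hx]; simp⟩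
  let P : Submodule ℂ M :=
    { carrier := {x | ∀ y ∈ L, ω x y = 0}
      add_mem' := fun {a b} ha hb y hy => by simp [ha y hy, hb y hy]
      zero_mem' := fun y _ => by simp
      smul_mem' := fun c x hx y hy => by simp [hx y hy] }
  have hP : Stable ρ P := fun g x hx y hy => by
    rw [← rep_self_inv (ρ := ρ) g y, hω g]
    exact hx _ (hL g⁻¹ y hy)
  have hPL : ∀ x, (∀ y ∈ L, ω x y = 0) → x ∈ L := by
    obtain ⟨K, hK, hLK⟩ := exists_compl L hL
    by_cases hK0 : K ⊓ P = ⊥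
    · intro x hx
      obtain ⟨a, ha, b, hb, rfl⟩ := Submodule.mem_sup.1
        (hLK.sup_eq_top ▸ Submodule.mem_top : x ∈ L ⊔ K)
      have hbP : b ∈ K ⊓ P := ⟨hb, fun y hy => by
        have := hx y hy
        rwa [map_add, LinearMap.add_apply, hLi a ha y hy, zero_add] at this⟩
      rw [hK0, Submodule.mem_bot] at hbP
      simpa [hbP] using ha
    · exfalso
      obtain ⟨q, hq, hqs, hqi⟩ := exists_irr_le (K ⊓ P) (hK.inf hP) hK0
      have h0 := hG q _ hqi (ω.compl₁₂ q.subtype q.subtype) (fun g x y => hω g x y)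
        (fun x => hωa x)
      have hqq : ∀ x ∈ q, ∀ y ∈ q, ω x y = 0 := fun x hx y hy =>
        LinearMap.congr_fun₂ h0 ⟨x, hx⟩ ⟨y, hy⟩
      have hLq : ∀ x ∈ L, ∀ y ∈ q, ω x y = 0 := fun x hx y hy => by
        rw [hsk, (hq hy).2 x hx, neg_zero]
      refine hmax (L ⊔ q) ⟨hL.sup hqs, ?_⟩ ?_
      · intro x hx y hy
        obtain ⟨a, ha, b, hb, rfl⟩ := Submodule.mem_sup.1 hx
        obtain ⟨c, hc, d, hd, rfl⟩ := Submodule.mem_sup.1 hy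
        simp [hLi a ha c hc, hqq b hb d hd, hLq a ha d hd, (hq hb).2 c hc]
      · refine lt_of_le_of_ne le_sup_left fun h => ?_
        have hqL : q ≤ L := h ▸ le_sup_right
        obtain ⟨z, hz⟩ := @exists_ne _ hqi.nontrivial (0 : q)
        refine hz (Subtype.ext ?_)
        have : (z : M) ∈ L ⊓ K := ⟨hqL z.2, (hq z.2).1⟩
        rw [hLK.inf_eq_bot] at this
        simpa using this
  obtain ⟨K, hK, hLK⟩ := exists_compl L hL
  let f : K →ₗ[ℂ] Module.Dual ℂ L := ω.compl₁₂ K.subtype L.subtype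
  let f' : L →ₗ[ℂ] Module.Dual ℂ K := ω.compl₁₂ L.subtype K.subtype
  have hf : Function.Injective f := by
    rw [← LinearMap.ker_eq_bot, LinearMap.ker_eq_bot']
    intro x hx
    have : (x : M) ∈ L ⊓ K := ⟨hPL x fun y hy => LinearMap.congr_fun hx ⟨y, hy⟩, x.2⟩
    rw [hLK.inf_eq_bot] at this
    exact Subtype.ext (by simpa using this)
  have hf' : Function.Injective f' := by
    rw [← LinearMap.ker_eq_bot, LinearMap.ker_eq_bot']
    intro x hx
    refine Subtype.ext (hω0 x (LinearMap.ext fun z => ?_))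
    obtain ⟨a, ha, b, hb, rfl⟩ := Submodule.mem_sup.1
        (hLK.sup_eq_top ▸ Submodule.mem_top : z ∈ L ⊔ K)
    rw [map_add, hLi x x.2 a ha, zero_add]
    exact LinearMap.congr_fun hx ⟨b, hb⟩
  have hfin : Module.finrank ℂ K = Module.finrank ℂ (Module.Dual ℂ L) := by
    refine le_antisymm (LinearMap.finrank_le_finrank_of_injective hf) ?_
    rw [Subspace.dual_finrank_eq, ← Subspace.dual_finrank_eq (K := ℂ) (V := K)]
    exact LinearMap.finrank_le_finrank_of_injective hf'
  let e : K ≃ₗ[ℂ] Module.Dual ℂ L := LinearEquiv.ofInjectiveOfFinrankEq f hf hfin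
  have he : ∀ x y, e x y = ω x y := fun x y => rfl
  refine ⟨L, subRep ρ L hL, fun g => ?_⟩
  have h1 : (subRep ρ K hK).character = (subRep ρ L hL).dual.character := by
    refine Representation.char_iso (Representation.Equiv.mk e fun g => ?_)
    ext x y
    simp only [LinearMap.comp_apply, LinearEquiv.coe_coe, Representation.dual_apply,
      Module.Dual.transpose_apply]
    rw [he, he, subRep_coe, subRep_coe, ← hω g x, rep_self_inv]
  rw [← Representation.char_dual, ← h1]
  have h2 : ρ g = (Submodule.prodEquivOfIsCompl L K hLK).conj
      ((subRep ρ L hL g).prodMap (subRep ρ K hK g)) := by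
    refine LinearMap.ext fun x => ?_
    obtain ⟨⟨a, b⟩, rfl⟩ := (Submodule.prodEquivOfIsCompl L K hLK).surjective x
    rw [LinearEquiv.conj_apply_apply, LinearEquiv.symm_apply_apply]
    simp
  rw [Representation.character, h2, LinearMap.trace_conj', LinearMap.trace_prodMap']
  rfl

end Lagrangian

section Doubling

/-- Twice-divisibility of the averaged square of a character of the form `ψ + conj ψ`. -/
theorem isIntegral_half_average {G M : Type*} [Group G] [Finite G] [AddCommGroup M] [Module ℂ M]
    [FiniteDimensional ℂ M] (σ : Representation ℂ G M) (y g : G) (Q : Subgroup G) [Fintype Q]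
    (hQ : ∀ t ∈ Q, t * y = y * t) (hg : g * y * g⁻¹ = y⁻¹) (hgQ : ∀ t ∈ Q, g * t * g⁻¹ ∈ Q) :
    IsIntegral ℤ ((2 : ℂ)⁻¹ * ((Nat.card Q : ℂ)⁻¹ *
      ∑ t : Q, (σ.character (y * t) + σ.character (y * t)⁻¹) ^ 2)) := by
  have h1 := isIntegral_average_char (σ.tprod σ) y Q hQ
  have h2 := isIntegral_average_char (σ.tprod σ.dual) y Q hQ
  have hinj : Function.Injective fun t : Q => (⟨g * (t : G)⁻¹ * g⁻¹, hgQ _ (Q.inv_mem t.2)⟩ : Q) := by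
    intro a b h
    have h' := congrArg Subtype.val h
    exact Subtype.ext (inv_injective (mul_left_cancel (mul_right_cancel h')))
  have h3 : ∑ t : Q, σ.character (y * t)⁻¹ ^ 2 = ∑ t : Q, σ.character (y * t) ^ 2 := by
    refine Fintype.sum_bijective _ (Finite.injective_iff_bijective.1 hinj) _ _ fun t => ?_
    rw [← Representation.char_conj σ (y * t)⁻¹ g]
    congr 2
    have : g * y⁻¹ * g⁻¹ = y := by
      have h5 := congrArg (·⁻¹) hg
      simp only [_root_.mul_inv_rev, inv_inv, mul_assoc] at h5 ⊢
      exact h5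
    calc g * (y * (t : G))⁻¹ * g⁻¹ = g * (t : G)⁻¹ * g⁻¹ * (g * y⁻¹ * g⁻¹) := by group
      _ = g * (t : G)⁻¹ * g⁻¹ * y := by rw [this]
      _ = _ := hQ _ (hgQ _ (Q.inv_mem t.2))
  have h4 : (2 : ℂ)⁻¹ * ((Nat.card Q : ℂ)⁻¹ *
      ∑ t : Q, (σ.character (y * t) + σ.character (y * t)⁻¹) ^ 2) =
      (Nat.card Q : ℂ)⁻¹ * ∑ t : Q, (σ.tprod σ).character (y * t) +
      (Nat.card Q : ℂ)⁻¹ * ∑ t : Q, (σ.tprod σ.dual).character (y * t) := by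
    simp only [Representation.char_tensor, Pi.mul_apply, Representation.char_dual, add_sq,
      Finset.sum_add_distrib, h3, mul_assoc, ← Finset.mul_sum, ← pow_two]
    ring
  rw [h4]
  exact h1.add h2

end Doubling

section OrbitSum

theorem exists_isIntegral_sum_eq {Γ Y : Type*} [Group Γ] [Finite Γ] [Fintype Y] [MulAction Γ Y]
    (f : Y → ℂ) (hinv : ∀ (γ : Γ) p, f (γ • p) = f p)
    (hinteg : ∀ p, IsIntegral ℤ (f p / Nat.card (MulAction.stabilizer Γ p))) :
    ∃ c, IsIntegral ℤ c ∧ ∑ p, f p = Nat.card Γ * c := by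
  have := Fintype.ofFinite Γ
  refine ⟨∑ ω : MulAction.orbitRel.Quotient Γ Y,
    f ω.out / Nat.card (MulAction.stabilizer Γ ω.out), IsIntegral.sum _ fun ω _ => hinteg _, ?_⟩
  rw [← Finset.sum_fiberwise (s := Finset.univ)
    (g := fun p => (Quotient.mk'' p : MulAction.orbitRel.Quotient Γ Y)), Finset.mul_sum]
  refine Finset.sum_congr rfl fun ω _ => ?_
  have h1 : ∀ p ∈ Finset.univ.filter
      (fun p => (Quotient.mk'' p : MulAction.orbitRel.Quotient Γ Y) = ω), f p = f ω.out := by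
    intro p hp
    have h2 := (Finset.mem_filter.1 hp).2
    rw [← Quotient.out_eq' ω, Quotient.eq''] at h2
    obtain ⟨γ, hγ⟩ := (MulAction.orbitRel_apply.1 h2)
    rw [← hγ]
    exact hinv γ _
  rw [Finset.sum_congr rfl h1, Finset.sum_const, nsmul_eq_mul]
  have h3 : (Finset.univ.filter
      (fun p => (Quotient.mk'' p : MulAction.orbitRel.Quotient Γ Y) = ω)).card =
      Fintype.card (MulAction.orbit Γ ω.out) := by
    rw [Fintype.card_subtype]
    congr 1
    ext p
    simp only [Finset.mem_filter, Finset.mem_univ, true_and]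
    conv_lhs => rw [← Quotient.out_eq' ω, Quotient.eq'']
    exact MulAction.orbitRel_apply
  have h4 := MulAction.card_orbit_mul_card_stabilizer_eq_card_group Γ ω.out
  rw [h3, Nat.card_eq_fintype_card, Nat.card_eq_fintype_card, ← h4]
  have h5 : (Fintype.card (MulAction.stabilizer Γ ω.out) : ℂ) ≠ 0 :=
    Nat.cast_ne_zero.2 Fintype.card_ne_zero
  push_cast
  field_simp

end OrbitSum

section Inversion

variable {G X : Type*} [Group G] [MulAction G X]

/-- The action of `G × {±1}` on `G × X`, by conjugation and inversion on `G`. -/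
@[reducible] def conjInvAction (G X : Type*) [Group G] [MulAction G X] : MulAction (G × ℤˣ) (G × X) where
  smul γ p := (γ.1 * p.1 ^ (γ.2 : ℤ) * γ.1⁻¹, γ.1 • p.2)
  one_smul p := by
    change ((1 : G) * p.1 ^ ((1 : ℤˣ) : ℤ) * 1⁻¹, (1 : G) • p.2) = p
    simp
  mul_smul γ δ p := by
    change ((γ.1 * δ.1) * p.1 ^ ((γ.2 * δ.2 : ℤˣ) : ℤ) * (γ.1 * δ.1)⁻¹, (γ.1 * δ.1) • p.2) =
      (γ.1 * (δ.1 * p.1 ^ (δ.2 : ℤ) * δ.1⁻¹) ^ (γ.2 : ℤ) * γ.1⁻¹, γ.1 • δ.1 • p.2)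
    rw [conj_zpow, mul_smul, Units.val_mul, mul_comm (γ.2 : ℤ), _root_.zpow_mul]
    simp only [_root_.mul_inv_rev, mul_assoc]

theorem card_stabilizer_eq [Finite G] (y : G) (x : X)
    (h : ¬ ∃ g : G, g • x = x ∧ g * y * g⁻¹ = y⁻¹) :
    letI := conjInvAction G X
    Nat.card (MulAction.stabilizer (G × ℤˣ) (y, x)) =
      Nat.card (Subgroup.centralizer {y} ⊓ MulAction.stabilizer G x : Subgroup G) := by
  let _ := conjInvAction G X
  symm
  refine Nat.card_congr (Equiv.ofBijective (fun t => ⟨(t, 1), ?_⟩) ⟨?_, ?_⟩)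
  · have h1 := Subgroup.mem_centralizer_singleton_iff.1 t.2.1
    change ((t : G) * y ^ ((1 : ℤˣ) : ℤ) * (t : G)⁻¹, (t : G) • x) = (y, x)
    rw [Prod.mk.injEq]
    refine ⟨?_, t.2.2⟩
    simp [h1]
  · intro a b hab
    exact Subtype.ext (congrArg (fun z => z.1.1) hab)
  · rintro ⟨⟨g, ε⟩, hg⟩
    change (g * y ^ (ε : ℤ) * g⁻¹, g • x) = (y, x) at hg
    rw [Prod.mk.injEq] at hg
    rcases Int.units_eq_one_or ε with rfl | rfl
    · refine ⟨⟨g, Subgroup.mem_centralizer_singleton_iff.2 ?_, hg.2⟩, rfl⟩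
      have h1 := hg.1
      simp only [Units.val_one, zpow_one] at h1
      exact mul_inv_eq_iff_eq_mul.1 h1
    · refine absurd ⟨g, hg.2, ?_⟩ h
      have h1 := congrArg (·⁻¹) hg.1
      simpa [mul_assoc] using h1

theorem card_stabilizer_eq_two_mul [Finite G] (y : G) (x : X) (g : G) (hgx : g • x = x)
    (hgy : g * y * g⁻¹ = y⁻¹) :
    letI := conjInvAction G X
    Nat.card (MulAction.stabilizer (G × ℤˣ) (y, x)) =
      2 * Nat.card (Subgroup.centralizer {y} ⊓ MulAction.stabilizer G x : Subgroup G) := by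
  let _ := conjInvAction G X
  have hgy' : g * y⁻¹ * g⁻¹ = y := by
    have h1 := congrArg (·⁻¹) hgy
    simpa [mul_assoc] using h1
  have hu : (2 : ℕ) = Nat.card ℤˣ := by simp
  rw [hu, ← Nat.card_prod]
  symm
  refine Nat.card_congr (Equiv.ofBijective
    (fun t : ℤˣ × (Subgroup.centralizer {y} ⊓ MulAction.stabilizer G x : Subgroup G) =>
      ⟨(t.2 * (if t.1 = 1 then 1 else g), t.1), ?_⟩) ⟨?_, ?_⟩)
  · obtain ⟨ε, t, ht⟩ := t
    have h1 := Subgroup.mem_centralizer_singleton_iff.1 ht.1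
    have h2 : t • x = x := ht.2
    rcases Int.units_eq_one_or ε with rfl | rfl
    · change (t * (if (1 : ℤˣ) = 1 then 1 else g) * y ^ ((1 : ℤˣ) : ℤ) *
        (t * (if (1 : ℤˣ) = 1 then 1 else g))⁻¹, (t * (if (1 : ℤˣ) = 1 then 1 else g)) • x) = (y, x)
      simp [h1, h2]
    · have h3 : ¬ ((-1 : ℤˣ) = 1) := by decide
      change (t * (if (-1 : ℤˣ) = 1 then 1 else g) * y ^ ((-1 : ℤˣ) : ℤ) *
        (t * (if (-1 : ℤˣ) = 1 then 1 else g))⁻¹, (t * (if (-1 : ℤˣ) = 1 then 1 else g)) • x) =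
          (y, x)
      rw [if_neg h3, Prod.mk.injEq, mul_smul, hgx, h2]
      refine ⟨?_, rfl⟩
      simp only [Units.val_neg, Units.val_one, _root_.zpow_neg, zpow_one]
      calc t * g * y⁻¹ * (t * g)⁻¹ = t * (g * y⁻¹ * g⁻¹) * t⁻¹ := by group
        _ = y := by rw [hgy', h1]; group
  · rintro ⟨ε, a⟩ ⟨δ, b⟩ hab
    have h1 : ε = δ := congrArg (fun z => z.1.2) hab
    subst h1
    have h2 := congrArg (fun z => z.1.1) hab
    exact Prod.ext rfl (Subtype.ext (mul_right_cancel h2))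
  · rintro ⟨⟨h, ε⟩, hg⟩
    change (h * y ^ (ε : ℤ) * h⁻¹, h • x) = (y, x) at hg
    rw [Prod.mk.injEq] at hg
    rcases Int.units_eq_one_or ε with rfl | rfl
    · refine ⟨⟨1, ⟨h, Subgroup.mem_centralizer_singleton_iff.2 ?_, hg.2⟩⟩, ?_⟩
      · have h1 := hg.1
        simp only [Units.val_one, zpow_one] at h1
        exact mul_inv_eq_iff_eq_mul.1 h1
      · simp
    · have h3 : ¬ ((-1 : ℤˣ) = 1) := by decide
      refine ⟨⟨-1, ⟨h * g⁻¹, Subgroup.mem_centralizer_singleton_iff.2 ?_, ?_⟩⟩, ?_⟩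
      · have h1 := hg.1
        simp only [Units.val_neg, Units.val_one, _root_.zpow_neg, zpow_one] at h1
        rw [mul_assoc, ← mul_inv_eq_iff_eq_mul]
        calc h * (g⁻¹ * y) * (h * g⁻¹)⁻¹ = h * (g⁻¹ * y * g) * h⁻¹ := by group
          _ = h * y⁻¹ * h⁻¹ := by nth_rw 1 [← hgy']; group
          _ = y := h1
      · change (h * g⁻¹) • x = x
        rw [mul_smul, inv_smul_eq_iff.2 hgx.symm, hg.2]
      · simp [h3]

end Inversion

section Criterion

theorem char_inv_of_form {G M : Type*} [Group G] [AddCommGroup M] [Module ℂ M]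
    [FiniteDimensional ℂ M] {ρ : Representation ℂ G M} {ω : M →ₗ[ℂ] M →ₗ[ℂ] ℂ} (hω : Inv ρ ω)
    (hω0 : ∀ x, ω x = 0 → x = 0) (g : G) : ρ.character g⁻¹ = ρ.character g := by
  have hinj : Function.Injective ω := by
    rw [← LinearMap.ker_eq_bot, LinearMap.ker_eq_bot']
    exact hω0
  have hfin : Module.finrank ℂ M = Module.finrank ℂ (Module.Dual ℂ M) :=
    (Subspace.dual_finrank_eq).symm
  let e : M ≃ₗ[ℂ] Module.Dual ℂ M := LinearEquiv.ofInjectiveOfFinrankEq ω hinj hfin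
  have h1 : ρ.character = ρ.dual.character := by
    refine Representation.char_iso (Representation.Equiv.mk e fun g => ?_)
    ext x y
    simp only [LinearMap.comp_apply, LinearEquiv.coe_coe, Representation.dual_apply,
      Module.Dual.transpose_apply]
    change ω (ρ g x) y = ω x (ρ g⁻¹ y)
    rw [← hω g x, rep_self_inv]
  rw [← Representation.char_dual, ← h1]

theorem isIntegral_nat (n : ℕ) : IsIntegral ℤ (n : ℂ) := by
  simpa using isIntegral_algebraMap (R := ℤ) (A := ℂ) (x := (n : ℤ))

theorem isIntegral_char {G M : Type*} [Group G] [Finite G] [AddCommGroup M] [Module ℂ M]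
    [FiniteDimensional ℂ M] (ρ : Representation ℂ G M) (g : G) : IsIntegral ℤ (ρ.character g) := by
  refine isIntegral_trace_of_pow _ (Nat.card G) Nat.card_pos.ne' ?_
  rw [← map_pow, pow_succ, pow_card_eq_one', one_mul]

variable {G M X : Type} [Group G] [Finite G] [AddCommGroup M] [Module ℂ M] [FiniteDimensional ℂ M]
  [MulAction G X]

theorem isIntegral_orbit_term (ρ : Representation ℂ G M)
    (ω : M →ₗ[ℂ] M →ₗ[ℂ] ℂ) (hω : Inv ρ ω) (hωa : ∀ x, ω x x = 0) (hω0 : ∀ x, ω x = 0 → x = 0)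
    (x : X) (hX : IsPGroup 2 (MulAction.stabilizer G x)) (y : G)
    (hT : ∀ Q : Subgroup G, IsPGroup 2 Q → (∀ g ∈ Q, g * y * g⁻¹ = y ∨ g * y * g⁻¹ = y⁻¹) →
      ∃ T : Subgroup G, NoSymplectic T ∧ y ∈ T ∧ Q ≤ T)
    [Fintype (Subgroup.centralizer {y} ⊓ MulAction.stabilizer G x : Subgroup G)] :
    letI := conjInvAction G X
    IsIntegral ℤ ((∑ t : (Subgroup.centralizer {y} ⊓ MulAction.stabilizer G x : Subgroup G),
      ρ.character (y * t) ^ 2) / Nat.card (MulAction.stabilizer (G × ℤˣ) (y, x))) := by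
  let _ := conjInvAction G X
  have hcomm : ∀ t ∈ (Subgroup.centralizer {y} ⊓ MulAction.stabilizer G x : Subgroup G),
      t * y = y * t := fun t ht => Subgroup.mem_centralizer_singleton_iff.1 ht.1
  by_cases h : ∃ g : G, g • x = x ∧ g * y * g⁻¹ = y⁻¹
  · obtain ⟨g, hgx, hgy⟩ := h
    have hgy' : g * y⁻¹ * g⁻¹ = y := by
      have h1 := congrArg (·⁻¹) hgy
      simpa [mul_assoc] using h1
    let Q' : Subgroup G :=
      { carrier := {a | a • x = x ∧ (a * y * a⁻¹ = y ∨ a * y * a⁻¹ = y⁻¹)}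
        one_mem' := by simp
        mul_mem' := by
          rintro a b ⟨ha, ha'⟩ ⟨hb, hb'⟩
          refine ⟨by rw [mul_smul, hb, ha], ?_⟩
          have h1 : a * b * y * (a * b)⁻¹ = a * (b * y * b⁻¹) * a⁻¹ := by group
          have h2 : a * y⁻¹ * a⁻¹ = (a * y * a⁻¹)⁻¹ := by group
          rcases hb' with hb' | hb' <;> rcases ha' with ha' | ha' <;> rw [h1, hb'] <;>
            simp [ha', h2]
        inv_mem' := by
          rintro a ⟨ha, ha'⟩
          refine ⟨inv_smul_eq_iff.2 ha.symm, ?_⟩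
          rcases ha' with ha' | ha'
          · left; nth_rw 1 [← ha']; group
          · right
            have h1 : a⁻¹ * (a * y * a⁻¹)⁻¹ * a⁻¹⁻¹ = y⁻¹ := by group
            rwa [ha', inv_inv] at h1 }
    have hQ' : IsPGroup 2 Q' := hX.to_le fun a ha => ha.1
    obtain ⟨T, hT1, hyT, hQT⟩ := hT Q' hQ' fun a ha => ha.2
    obtain ⟨p, σ, hσ⟩ := exists_char_eq_add hT1 (ρ.comp T.subtype : Representation ℂ T M) ω
      (fun t => hω t) hωa hω0
    let Q : Subgroup G := Subgroup.centralizer {y} ⊓ MulAction.stabilizer G x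
    have hQQ' : Q ≤ Q' := fun t ht => ⟨ht.2, Or.inl (by rw [hcomm t ht, mul_inv_cancel_right])⟩
    have hQT' : Q ≤ T := hQQ'.trans hQT
    have hgT : g ∈ T := hQT ⟨hgx, Or.inr hgy⟩
    have hgQ : ∀ t ∈ Q, g * t * g⁻¹ ∈ Q := fun t ht => by
      refine ⟨Subgroup.mem_centralizer_singleton_iff.2 ?_, ?_⟩
      · have h1 : t * y⁻¹ = y⁻¹ * t := by
          rw [mul_inv_eq_iff_eq_mul, mul_assoc, hcomm t ht, inv_mul_cancel_left]
        calc g * t * g⁻¹ * y = g * t * g⁻¹ * (g * y⁻¹ * g⁻¹) := by rw [hgy']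
          _ = g * (t * y⁻¹) * g⁻¹ := by group
          _ = (g * y⁻¹ * g⁻¹) * (g * t * g⁻¹) := by rw [h1]; group
          _ = _ := by rw [hgy']
      · change (g * t * g⁻¹) • x = x
        have h1 : t • x = x := ht.2
        rw [mul_smul, mul_smul, inv_smul_eq_iff.2 hgx.symm, h1, hgx]
    have := Fintype.ofFinite (Q.subgroupOf T)
    have key := isIntegral_half_average σ ⟨y, hyT⟩ ⟨g, hgT⟩ (Q.subgroupOf T)
      (fun t ht => Subtype.ext (hcomm t ht)) (Subtype.ext hgy) fun t ht => hgQ t ht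
    have h1 : Nat.card (Q.subgroupOf T) = Nat.card Q :=
      Nat.card_congr (Subgroup.subgroupOfEquivOfLe hQT').toEquiv
    have h2 : ∑ t : Q.subgroupOf T,
        (σ.character ((⟨y, hyT⟩ : T) * t) + σ.character ((⟨y, hyT⟩ : T) * t)⁻¹) ^ 2 =
        ∑ t : Q, ρ.character (y * t) ^ 2 := by
      refine Fintype.sum_equiv (Subgroup.subgroupOfEquivOfLe hQT').toEquiv _ _ fun t => ?_
      rw [← hσ]
      rfl
    rw [h1, h2] at key
    rw [card_stabilizer_eq_two_mul y x g hgx hgy]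
    convert key using 1
    push_cast
    rw [div_eq_inv_mul, mul_inv, mul_assoc]
  · rw [card_stabilizer_eq y x h, div_eq_inv_mul]
    convert isIntegral_average_char (ρ.tprod ρ) y _ hcomm using 3
    rw [Representation.char_tensor, Pi.mul_apply, pow_two]

/-- A criterion for the absence of symplectic irreducible representations, by local conditions on
the extended centralizers of elements of odd order; here for a `G`-set with good fixed-point
counts. -/
theorem NoSymplectic.of_local_aux (α m : ℕ) (hcard : Nat.card G = 2 ^ α * m) (hm : Odd m)
    [Finite X] (hX : ∀ x : X, IsPGroup 2 (MulAction.stabilizer G x))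
    (hXc : ∀ t : G, t ^ 2 ^ α = 1 → ∃ d : ℕ, Nat.card {x : X // t • x = x} = 1 + 2 ^ (α + 1) * d)
    (hT : ∀ y : G, y ^ m = 1 → ∀ Q : Subgroup G, IsPGroup 2 Q →
      (∀ g ∈ Q, g * y * g⁻¹ = y ∨ g * y * g⁻¹ = y⁻¹) →
      ∃ T : Subgroup G, NoSymplectic T ∧ y ∈ T ∧ Q ≤ T) : NoSymplectic G := by
  have := Fintype.ofFinite G
  have := Fintype.ofFinite X
  intro M _ _ _ ρ hρ ω hω hωa
  by_contra hne
  have hω0 := hω.injective_of_irr hρ hne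
  have hχ : ∀ g, ρ.character g⁻¹ = ρ.character g := char_inv_of_form hω hω0
  have hcop : Nat.Coprime (2 ^ α) m := Nat.Coprime.pow_left _ hm.coprime_two_left
  obtain ⟨e, he1, he2⟩ := Nat.chineseRemainder hcop 0 1
  obtain ⟨k, hk1, hk2⟩ := Nat.chineseRemainder hcop 1 0
  have hek : ∀ g : G, g ^ e * g ^ k = g := fun g => by
    have h1 : e + k ≡ 1 [MOD Nat.card G] := by
      rw [hcard, ← Nat.modEq_and_modEq_iff_modEq_mul hcop]
      exact ⟨he1.add hk1, he2.add hk2⟩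
    rw [← pow_add]
    conv_rhs => rw [← pow_one g]
    exact pow_eq_pow_iff_modEq.2 (h1.of_dvd (orderOf_dvd_natCard g))
  have hpow1 : ∀ g : G, (g ^ e) ^ m = 1 := fun g => by
    obtain ⟨c, hc⟩ := (Nat.modEq_zero_iff_dvd).1 he1
    rw [← pow_mul, hc, mul_right_comm, ← hcard, pow_mul, pow_card_eq_one', one_pow]
  have hpow2 : ∀ g : G, (g ^ k) ^ 2 ^ α = 1 := fun g => by
    obtain ⟨c, hc⟩ := (Nat.modEq_zero_iff_dvd).1 hk2
    rw [← pow_mul, hc, mul_comm, ← mul_assoc, ← hcard, pow_mul, pow_card_eq_one', one_pow]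
  have hodd : ∀ g : G, g ^ m = 1 → g ^ e = g ∧ g ^ k = 1 := fun g hg => by
    have h1 := orderOf_dvd_of_pow_eq_one hg
    constructor
    · conv_rhs => rw [← pow_one g]
      exact pow_eq_pow_iff_modEq.2 (he2.of_dvd h1)
    · rw [← pow_zero g]
      exact pow_eq_pow_iff_modEq.2 (hk2.of_dvd h1)
  have htwo : ∀ g : G, g ^ 2 ^ α = 1 → g ^ e = 1 ∧ g ^ k = g := fun g hg => by
    have h1 := orderOf_dvd_of_pow_eq_one hg
    constructor
    · rw [← pow_zero g]
      exact pow_eq_pow_iff_modEq.2 (he1.of_dvd h1)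
    · conv_rhs => rw [← pow_one g]
      exact pow_eq_pow_iff_modEq.2 (hk1.of_dvd h1)
  have hpp : ∀ x : X, ∀ t ∈ MulAction.stabilizer G x, t ^ 2 ^ α = 1 := fun x t ht => by
    obtain ⟨j, hj⟩ := hX x ⟨t, ht⟩
    have hj' : t ^ 2 ^ j = 1 := congrArg Subtype.val hj
    have h1 := (Nat.dvd_prime_pow Nat.prime_two).1 (orderOf_dvd_of_pow_eq_one hj')
    obtain ⟨i, -, hi⟩ := h1
    have h2 := orderOf_dvd_natCard t
    rw [hcard, hi] at h2
    refine orderOf_dvd_iff_pow_eq_one.1 ?_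
    rw [hi]
    exact Nat.Coprime.dvd_of_dvd_mul_right (Nat.Coprime.pow_left _ hm.coprime_two_left) h2
  let f : G × X → ℂ := fun p =>
    ∑ g : G, if g ^ e = p.1 ∧ g ^ k • p.2 = p.2 then ρ.character g ^ 2 else 0
  let _ := conjInvAction G X
  have hinv : ∀ (γ : G × ℤˣ) p, f (γ • p) = f p := by
    rintro ⟨a, ε⟩ ⟨y, x⟩
    symm
    have hε : ((ε : ℤ) * (ε : ℤ)) = 1 := by
      rcases Int.units_eq_one_or ε with rfl | rfl <;> rfl
    have hinj : ∀ u v : G, u ^ (ε : ℤ) = v ^ (ε : ℤ) → u = v := fun u v h => by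
      have h1 := congrArg (· ^ (ε : ℤ)) h
      simpa [← _root_.zpow_mul, hε] using h1
    refine Fintype.sum_bijective (fun g => a * g ^ (ε : ℤ) * a⁻¹)
      (Finite.injective_iff_bijective.1 fun u v h =>
        hinj u v (mul_left_cancel (mul_right_cancel h))) _ _ fun g => ?_
    have h1 : ρ.character (a * g ^ (ε : ℤ) * a⁻¹) = ρ.character g := by
      rw [Representation.char_conj]
      rcases Int.units_eq_one_or ε with rfl | rfl
      · simp
      · simp [hχ]
    have h2 : (a * g ^ (ε : ℤ) * a⁻¹) ^ e = a * y ^ (ε : ℤ) * a⁻¹ ↔ g ^ e = y := by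
      rw [conj_pow, ← zpow_natCast, ← _root_.zpow_mul, mul_comm, _root_.zpow_mul, zpow_natCast]
      exact ⟨fun h => hinj _ _ (mul_left_cancel (mul_right_cancel h)), fun h => by rw [h]⟩
    have h3 : (a * g ^ (ε : ℤ) * a⁻¹) ^ k • (a • x) = a • x ↔ g ^ k • x = x := by
      rw [conj_pow, mul_smul, mul_smul, inv_smul_smul, smul_left_cancel_iff,
        ← zpow_natCast, ← _root_.zpow_mul, mul_comm, _root_.zpow_mul, zpow_natCast]
      rcases Int.units_eq_one_or ε with rfl | rfl
      · simp
      · simp only [Units.val_neg, Units.val_one, _root_.zpow_neg, zpow_one, inv_smul_eq_iff]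
        exact eq_comm
    change _ = if (a * g ^ (ε : ℤ) * a⁻¹) ^ e = a * y ^ (ε : ℤ) * a⁻¹ ∧
      (a * g ^ (ε : ℤ) * a⁻¹) ^ k • (a • x) = a • x then _ else _
    simp only [h1, h2, h3]
  have hinteg : ∀ p, IsIntegral ℤ (f p / Nat.card (MulAction.stabilizer (G × ℤˣ) p)) := by
    rintro ⟨y, x⟩
    by_cases hy : y ^ m = 1
    · have h1 : f (y, x) = ∑ t : (Subgroup.centralizer {y} ⊓ MulAction.stabilizer G x : Subgroup G),
          ρ.character (y * t) ^ 2 := by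
        simp only [f]
        rw [← Finset.sum_filter]
        symm
        refine Finset.sum_bij (fun t _ => y * (t : G)) ?_ ?_ ?_ fun _ _ => rfl
        · rintro ⟨t, ht1, ht2⟩ -
          have hc : Commute y t := (Subgroup.mem_centralizer_singleton_iff.1 ht1).symm
          have ht3 := hpp x t ht2
          have ht4 : t • x = x := ht2
          simp only [Finset.mem_filter, Finset.mem_univ, true_and]
          rw [hc.mul_pow, hc.mul_pow, (hodd y hy).1, (hodd y hy).2, (htwo t ht3).1, (htwo t ht3).2]
          simpa using ht4
        · intro a _ b _ h
          exact Subtype.ext (mul_left_cancel h)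
        · intro g hg
          simp only [Finset.mem_filter, Finset.mem_univ, true_and] at hg
          refine ⟨⟨g ^ k, Subgroup.mem_centralizer_singleton_iff.2 ?_, hg.2⟩, Finset.mem_univ _, ?_⟩
          · rw [← hg.1, ← pow_add, ← pow_add, add_comm]
          · change y * g ^ k = g
            rw [← hg.1]; exact hek g
      rw [h1]
      exact isIntegral_orbit_term ρ ω hω hωa hω0 x (hX x) y (hT y hy)
    · have h1 : f (y, x) = 0 := by
        refine Finset.sum_eq_zero fun g _ => if_neg fun h => hy ?_
        have h2 : g ^ e = y := h.1
        rw [← h2]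
        exact hpow1 g
      rw [h1, zero_div]
      exact isIntegral_zero
  obtain ⟨c, hc, hsum⟩ := exists_isIntegral_sum_eq f hinv hinteg
  choose d hd using fun g : G => hXc (g ^ k) (hpow2 g)
  have hsum2 : ∑ p, f p = ∑ g, ρ.character g ^ 2 * (1 + 2 ^ (α + 1) * d g) := by
    simp only [f]
    rw [Finset.sum_comm]
    refine Finset.sum_congr rfl fun g _ => ?_
    rw [Fintype.sum_prod_type]
    rw [Fintype.sum_eq_single (g ^ e) (fun y hy => Finset.sum_eq_zero fun x _ =>
      if_neg fun h => hy h.1.symm)]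
    simp only [true_and]
    rw [← Finset.sum_filter, Finset.sum_const, nsmul_eq_mul, mul_comm]
    congr 1
    have h1 := hd g
    rw [Nat.card_eq_fintype_card, Fintype.card_subtype] at h1
    rw [h1]
    push_cast
    ring
  have hnorm : ∑ g, ρ.character g ^ 2 = Nat.card G := by
    rw [Nat.card_eq_fintype_card, ← sum_char_mul_char_inv hρ]
    exact Finset.sum_congr rfl fun g _ => by rw [hχ, pow_two]
  have hD : IsIntegral ℤ (∑ g, ρ.character g ^ 2 * d g) :=
    IsIntegral.sum _ fun g _ => ((isIntegral_char ρ g).pow 2).mul (isIntegral_nat (d g))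
  set D := ∑ g, ρ.character g ^ 2 * d g with hDdef
  have hexp : ∑ g, ρ.character g ^ 2 * (1 + 2 ^ (α + 1) * (d g : ℂ)) =
      Nat.card G + 2 ^ (α + 1) * D := by
    rw [hDdef, ← hnorm, Finset.mul_sum, ← Finset.sum_add_distrib]
    exact Finset.sum_congr rfl fun g _ => by ring
  have hΓ : Nat.card (G × ℤˣ) = 2 * Nat.card G := by
    rw [Nat.card_prod, mul_comm]; simp
  rw [hsum2, hexp, hΓ, hcard] at hsum
  have h2 : (2 : ℂ) ^ α ≠ 0 := pow_ne_zero _ two_ne_zero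
  have hfin : (m : ℂ) = 2 * (m * c - D) := by
    apply mul_left_cancel₀ h2
    push_cast at hsum
    rw [pow_succ] at hsum
    linear_combination hsum
  have hmi : IsIntegral ℤ ((m : ℂ) * c - D) := ((isIntegral_nat m).mul hc).sub hD
  have hmq : IsIntegral ℤ ((m : ℚ) / 2) := by
    have h3 : ((m : ℂ) * c - D) = algebraMap ℚ ℂ ((m : ℚ) / 2) := by
      rw [map_div₀, map_natCast, map_ofNat]
      linear_combination (-1 / 2 : ℂ) * hfin
    rw [h3] at hmi
    exact (isIntegral_algebraMap_iff (algebraMap ℚ ℂ).injective).1 hmi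
  obtain ⟨z, hz⟩ := IsIntegrallyClosed.isIntegral_iff.1 hmq
  have hz' : (2 * z : ℤ) = m := by
    have h4 : (z : ℚ) = m / 2 := hz
    have h5 : (2 * z : ℚ) = m := by rw [h4]; ring
    exact_mod_cast h5
  obtain ⟨j, hj⟩ := hm
  omega

theorem NoSymplectic.of_local (m : ℕ) (hm : Odd m) (hmG : ∃ α, Nat.card G = 2 ^ α * m)
    (hT : ∀ y : G, y ^ m = 1 → ∀ Q : Subgroup G, IsPGroup 2 Q →
      (∀ g ∈ Q, g * y * g⁻¹ = y ∨ g * y * g⁻¹ = y⁻¹) →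
      ∃ T : Subgroup G, NoSymplectic T ∧ y ∈ T ∧ Q ≤ T) : NoSymplectic G := by
  obtain ⟨α, hcard⟩ := hmG
  have : Fact (Nat.Prime 2) := ⟨Nat.prime_two⟩
  let S : Sylow 2 G := default
  refine NoSymplectic.of_local_aux (X := Fin (2 ^ α) → G ⧸ (S : Subgroup G)) α m hcard hm ?_ ?_ hT
  · intro x
    rintro ⟨g, hg⟩
    have h1 : g • x ⟨0, by positivity⟩ = x ⟨0, by positivity⟩ := congrFun hg _
    obtain ⟨a, ha⟩ := QuotientGroup.mk_surjective (x ⟨0, by positivity⟩)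
    rw [← ha] at h1
    have h2 : a⁻¹ * (g * a) ∈ (S : Subgroup G) := by
      rw [← QuotientGroup.eq]
      exact h1.symm
    obtain ⟨j, hj⟩ := S.isPGroup' ⟨_, h2⟩
    refine ⟨j, Subtype.ext ?_⟩
    have h3 : (a⁻¹ * (g * a)) ^ 2 ^ j = 1 := congrArg Subtype.val hj
    have h4 : g = a * (a⁻¹ * (g * a)) * a⁻¹ := by group
    change g ^ 2 ^ j = 1
    rw [h4, conj_pow, h3]
    group
  · intro t ht
    have hp : IsPGroup 2 (Subgroup.zpowers t) := by
      rintro ⟨_, i, rfl⟩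
      refine ⟨α, Subtype.ext ?_⟩
      change (t ^ i) ^ 2 ^ α = 1
      rw [← zpow_natCast, zpow_comm, zpow_natCast, ht, _root_.one_zpow]
    have h1 := hp.card_modEq_card_fixedPoints (G ⧸ (S : Subgroup G))
    have h2 : ¬ 2 ∣ Nat.card (G ⧸ (S : Subgroup G)) := S.not_dvd_index
    have h3 : Odd (Nat.card (MulAction.fixedPoints (Subgroup.zpowers t) (G ⧸ (S : Subgroup G)))) := by
      rw [← Nat.not_even_iff_odd, even_iff_two_dvd]
      exact fun h => h2 (Nat.modEq_zero_iff_dvd.1 (h1.trans (Nat.modEq_zero_iff_dvd.2 h)))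
    have h4 : Nat.card {x : Fin (2 ^ α) → G ⧸ (S : Subgroup G) // t • x = x} =
        Nat.card (MulAction.fixedPoints (Subgroup.zpowers t) (G ⧸ (S : Subgroup G))) ^ 2 ^ α := by
      have h5 : MulAction.fixedPoints (Subgroup.zpowers t) (G ⧸ (S : Subgroup G)) =
          {x | t • x = x} := by
        ext x
        constructor
        · intro hx
          exact hx ⟨t, Subgroup.mem_zpowers t⟩
        · rintro hx ⟨_, i, rfl⟩
          have h6 : t ∈ MulAction.stabilizer G x := hx
          exact (MulAction.stabilizer G x).zpow_mem h6 i
      rw [h5]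
      have h6 : Nat.card (Fin (2 ^ α) → {x : G ⧸ (S : Subgroup G) | t • x = x}) =
          Nat.card {x : G ⧸ (S : Subgroup G) | t • x = x} ^ 2 ^ α := by
        rw [Nat.card_fun, Nat.card_fin]
      rw [← h6]
      refine Nat.card_congr ⟨fun x i => ⟨x.1 i, congrFun x.2 i⟩,
        fun x => ⟨fun i => (x i).1, funext fun i => (x i).2⟩, fun x => rfl, fun x => rfl⟩
    rw [h4]
    generalize Nat.card (MulAction.fixedPoints (Subgroup.zpowers t) (G ⧸ (S : Subgroup G))) = a at h3
    clear hcard hT ht h4 hp h1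
    induction α with
    | zero =>
      obtain ⟨d, hd⟩ := h3
      exact ⟨d, by simp [hd, add_comm]⟩
    | succ β ih =>
      obtain ⟨d, hd⟩ := ih
      refine ⟨d + 2 ^ β * d ^ 2, ?_⟩
      rw [pow_succ, pow_mul, hd]
      ring

end Criterion

section Isometry

variable {F V : Type*} [Field F] [AddCommGroup V] [Module F V]

/-- The isometry group of a bilinear form. -/
def isoGroup (B : V →ₗ[F] V →ₗ[F] F) : Subgroup (Module.End F V)ˣ where
  carrier := {g | ∀ x y, B (g.1 x) (g.1 y) = B x y}
  one_mem' := fun x y => rfl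
  mul_mem' := fun {a b} ha hb x y => by
    rw [Units.val_mul, Module.End.mul_apply, Module.End.mul_apply, ha, hb]
  inv_mem' := fun {a} ha x y => by
    rw [← ha, ← Module.End.mul_apply, ← Module.End.mul_apply, Units.mul_inv]; rfl

/-- The radical of the restriction of a form to a subspace is trivial. -/
def NonDegOn (B : V →ₗ[F] V →ₗ[F] F) (U : Submodule F V) : Prop :=
  ∀ x ∈ U, (∀ y ∈ U, B x y = 0) → x = 0

/-- Restriction of a form to a subspace. -/
def resForm (B : V →ₗ[F] V →ₗ[F] F) (U : Submodule F V) : U →ₗ[F] U →ₗ[F] F :=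
  B.compl₁₂ U.subtype U.subtype

@[simp] theorem resForm_apply (B : V →ₗ[F] V →ₗ[F] F) (U : Submodule F V) (x y : U) :
    resForm B U x y = B x y := rfl

/-- Stability of a subspace under an invertible operator. -/
def UStable (g : (Module.End F V)ˣ) (U : Submodule F V) : Prop :=
  (∀ x ∈ U, g.1 x ∈ U) ∧ ∀ x ∈ U, g⁻¹.1 x ∈ U

theorem unit_inv_apply (g : (Module.End F V)ˣ) (x : V) : g⁻¹.1 (g.1 x) = x := by
  rw [← Module.End.mul_apply, Units.inv_mul]; rfl

theorem unit_apply_inv (g : (Module.End F V)ˣ) (x : V) : g.1 (g⁻¹.1 x) = x := by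
  rw [← Module.End.mul_apply, Units.mul_inv]; rfl

theorem iso_adjoint {B : V →ₗ[F] V →ₗ[F] F} {g : (Module.End F V)ˣ} (hg : g ∈ isoGroup B)
    (x y : V) : B (g.1 x) y = B x (g⁻¹.1 y) := by
  rw [← hg x, unit_apply_inv]

/-- Restriction of an invertible operator to a stable subspace. -/
def resUnit (g : (Module.End F V)ˣ) (U : Submodule F V) (h : UStable g U) :
    (Module.End F U)ˣ where
  val := g.1.restrict h.1
  inv := g⁻¹.1.restrict h.2
  val_inv := LinearMap.ext fun x => Subtype.ext (unit_apply_inv g x)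
  inv_val := LinearMap.ext fun x => Subtype.ext (unit_inv_apply g x)

@[simp] theorem resUnit_apply (g : (Module.End F V)ˣ) (U : Submodule F V) (h : UStable g U) (x : U) :
    (((resUnit g U h).1 x : U) : V) = g.1 x := rfl

@[simp] theorem resUnit_inv_apply (g : (Module.End F V)ˣ) (U : Submodule F V) (h : UStable g U)
    (x : U) : (((resUnit g U h)⁻¹.1 x : U) : V) = g⁻¹.1 x := rfl

/-- The orthogonal complement of a subspace. -/
def perp (B : V →ₗ[F] V →ₗ[F] F) (U : Submodule F V) : Submodule F V where
  carrier := {x | ∀ u ∈ U, B u x = 0}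
  add_mem' := fun {a b} ha hb u hu => by rw [map_add, ha u hu, hb u hu, add_zero]
  zero_mem' := fun u _ => map_zero _
  smul_mem' := fun c x hx u hu => by rw [map_smul, hx u hu, smul_zero]

theorem UStable.perp {B : V →ₗ[F] V →ₗ[F] F} {g : (Module.End F V)ˣ} (hg : g ∈ isoGroup B)
    {U : Submodule F V} (h : UStable g U) : UStable g (perp B U) := by
  refine ⟨fun x hx u hu => ?_, fun x hx u hu => ?_⟩
  · rw [← unit_apply_inv g u, hg]
    exact hx _ (h.2 u hu)
  · rw [← iso_adjoint hg]
    exact hx _ (h.1 u hu)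

theorem isCompl_perp [FiniteDimensional F V] {B : V →ₗ[F] V →ₗ[F] F} (hs : ∀ x y, B x y = B y x)
    {U : Submodule F V} (h : NonDegOn B U) : IsCompl U (perp B U) := by
  have hinj : Function.Injective (resForm B U) := by
    rw [← LinearMap.ker_eq_bot, LinearMap.ker_eq_bot']
    exact fun x hx => Subtype.ext (h x x.2 fun y hy => LinearMap.congr_fun hx ⟨y, hy⟩)
  have hfin : Module.finrank F U = Module.finrank F (Module.Dual F U) :=
    (Subspace.dual_finrank_eq).symm
  let e : U ≃ₗ[F] Module.Dual F U := LinearEquiv.ofInjectiveOfFinrankEq (resForm B U) hinj hfin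
  rw [isCompl_iff, disjoint_iff, codisjoint_iff]
  constructor
  · rw [Submodule.eq_bot_iff]
    rintro x ⟨hx, hx'⟩
    exact h x hx fun y hy => by rw [hs, hx' y hy]
  · rw [Submodule.eq_top_iff']
    intro x
    obtain ⟨u, hu⟩ := e.surjective ((B x).comp U.subtype)
    rw [← add_sub_cancel (u : V) x]
    refine Submodule.add_mem_sup u.2 fun y hy => ?_
    have h1 : B u y = B x y := LinearMap.congr_fun hu ⟨y, hy⟩
    rw [map_sub, hs y x, hs y u, h1, sub_self]

theorem nonDegOn_perp [FiniteDimensional F V] {B : V →ₗ[F] V →ₗ[F] F} (hs : ∀ x y, B x y = B y x)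
    (hB : NonDegOn B ⊤) {U : Submodule F V} (h : NonDegOn B U) : NonDegOn B (perp B U) := by
  intro x hx hx'
  refine hB x trivial fun y _ => ?_
  obtain ⟨a, ha, b, hb, rfl⟩ := Submodule.mem_sup.1
    ((isCompl_perp hs h).sup_eq_top ▸ Submodule.mem_top : y ∈ U ⊔ perp B U)
  rw [map_add, hx' b hb, hs, hx a ha, add_zero]

theorem NonDegOn.resForm_top {B : V →ₗ[F] V →ₗ[F] F} {U : Submodule F V} (h : NonDegOn B U) :
    NonDegOn (resForm B U) ⊤ := fun x _ hx =>
  Subtype.ext (h x x.2 fun y hy => hx ⟨y, hy⟩ trivial)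

/-- Inversion by an isometric involution. -/
def Rev (B : V →ₗ[F] V →ₗ[F] F) (g : (Module.End F V)ˣ) : Prop :=
  ∃ τ : V →ₗ[F] V, (∀ x, τ (τ x) = x) ∧ (∀ x y, B (τ x) (τ y) = B x y) ∧
    ∀ x, τ (g.1 x) = g⁻¹.1 (τ x)

theorem Rev.glue [FiniteDimensional F V] {B : V →ₗ[F] V →ₗ[F] F} (hs : ∀ x y, B x y = B y x)
    {g : (Module.End F V)ˣ} (hg : g ∈ isoGroup B) {U : Submodule F V} (hU : NonDegOn B U)
    (hgU : UStable g U) (h1 : Rev (resForm B U) (resUnit g U hgU))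
    (h2 : Rev (resForm B (perp B U)) (resUnit g (perp B U) (hgU.perp hg))) : Rev B g := by
  have hc := isCompl_perp hs hU
  obtain ⟨σ, s1, s2, s3⟩ := h1
  obtain ⟨τ, t1, t2, t3⟩ := h2
  let T : V →ₗ[F] V := LinearMap.ofIsCompl hc (U.subtype.comp σ) ((perp B U).subtype.comp τ)
  have hT1 : ∀ u : U, T u = σ u := fun u => LinearMap.ofIsCompl_apply_left hc u
  have hT2 : ∀ u : perp B U, T u = τ u := fun u => LinearMap.ofIsCompl_apply_right hc u
  have hdec : ∀ x, ∃ (u : U) (w : perp B U), x = (u : V) + w := fun x => by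
    obtain ⟨a, ha, b, hb, rfl⟩ := Submodule.mem_sup.1
      (hc.sup_eq_top ▸ Submodule.mem_top : x ∈ U ⊔ perp B U)
    exact ⟨⟨a, ha⟩, ⟨b, hb⟩, rfl⟩
  have hor : ∀ (u : U) (w : perp B U), B u w = 0 := fun u w => w.2 u u.2
  have hor' : ∀ (u : U) (w : perp B U), B w u = 0 := fun u w => by rw [hs, hor]
  refine ⟨T, fun x => ?_, fun x y => ?_, fun x => ?_⟩
  · obtain ⟨u, w, rfl⟩ := hdec x
    rw [map_add, hT1, hT2, map_add, hT1, hT2, s1, t1]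
  · obtain ⟨u, w, rfl⟩ := hdec x
    obtain ⟨u', w', rfl⟩ := hdec y
    have h1 := s2 u u'
    have h2 := t2 w w'
    simp only [resForm_apply] at h1 h2
    simp only [map_add, LinearMap.add_apply, hT1, hT2, h1, h2, hor, hor']
  · obtain ⟨u, w, rfl⟩ := hdec x
    have h1 := congrArg Subtype.val (s3 u)
    have h2 := congrArg Subtype.val (t3 w)
    simp only [resUnit_inv_apply] at h1 h2
    rw [map_add, map_add, map_add, hT1, hT2, map_add, ← h1, ← h2, ← hT1, ← hT2]
    rfl

/-- The reversal of two orbits of an isometry. -/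
theorem rev_of_two_orbits {B : V →ₗ[F] V →ₗ[F] F}
    (hs : ∀ x y, B x y = B y x) {g : (Module.End F V)ˣ} (hg : g ∈ isoGroup B) (v w : V)
    (hvw : ∀ n : ℤ, B v ((g ^ n).1 w) + B v ((g ^ (-n)).1 w) = 0) (U : Submodule F V)
    (hU : U = Submodule.span F (Set.range (Sum.elim (fun n : ℤ => (g ^ n).1 v)
      (fun n : ℤ => (g ^ n).1 w)))) (hUn : NonDegOn B U) (hgU : UStable g U) :
    Rev (resForm B U) (resUnit g U hgU) := by
  let e : ℤ ⊕ ℤ → V := Sum.elim (fun n : ℤ => (g ^ n).1 v) (fun n : ℤ => (g ^ n).1 w)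
  let e' : ℤ ⊕ ℤ → V := Sum.elim (fun n : ℤ => (g ^ (-n)).1 v) (fun n : ℤ => -(g ^ (-n)).1 w)
  have hshift : ∀ (m n : ℤ) (x y : V), B ((g ^ m).1 x) ((g ^ n).1 y) = B x ((g ^ (n - m)).1 y) := by
    intro m n x y
    have h1 := (isoGroup B).zpow_mem hg m
    rw [iso_adjoint h1, ← Module.End.mul_apply, ← Units.val_mul, ← _root_.zpow_neg, ← _root_.zpow_add,
      neg_add_eq_sub]
  have hgram : ∀ i j, B (e' i) (e' j) = B (e i) (e j) := by
    rintro (m | m) (n | n)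
    · change B ((g ^ (-m)).1 v) ((g ^ (-n)).1 v) = B ((g ^ m).1 v) ((g ^ n).1 v)
      rw [hs, hshift, hshift, show -m - -n = n - m by ring]
    · change B ((g ^ (-m)).1 v) (-(g ^ (-n)).1 w) = B ((g ^ m).1 v) ((g ^ n).1 w)
      rw [map_neg, hshift, hshift, neg_eq_iff_add_eq_zero, add_comm]
      rw [show -n - -m = -(n - m) by ring]
      exact hvw _
    · change B (-(g ^ (-m)).1 w) ((g ^ (-n)).1 v) = B ((g ^ m).1 w) ((g ^ n).1 v)
      rw [map_neg, LinearMap.neg_apply, hs, hs ((g ^ m).1 w), hshift, hshift,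
        neg_eq_iff_add_eq_zero, add_comm]
      rw [show -m - -n = -(m - n) by ring]
      exact hvw _
    · change B (-(g ^ (-m)).1 w) (-(g ^ (-n)).1 w) = B ((g ^ m).1 w) ((g ^ n).1 w)
      rw [map_neg, map_neg, LinearMap.neg_apply, neg_neg, hs, hshift, hshift,
        show -m - -n = n - m by ring]
  have heU : ∀ i, e i ∈ U := fun i => hU ▸ Submodule.subset_span ⟨i, rfl⟩
  have he'U : ∀ i, e' i ∈ U := by
    rintro (n | n)
    · exact heU (Sum.inl (-n))
    · exact U.neg_mem (heU (Sum.inr (-n)))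
  let L : (ℤ ⊕ ℤ →₀ F) →ₗ[F] V := Finsupp.linearCombination F e
  let L' : (ℤ ⊕ ℤ →₀ F) →ₗ[F] V := Finsupp.linearCombination F e'
  have hLL : ∀ a b, B (L' a) (L' b) = B (L a) (L b) := by
    have h1 : (B.compl₁₂ L' L') = B.compl₁₂ L L := by
      ext i j
      simpa [L, L'] using hgram i j
    exact fun a b => LinearMap.congr_fun₂ h1 a b
  have hrange : ∀ x ∈ U, ∃ a, L a = x := fun x hx => by
    rw [hU, ← Finsupp.range_linearCombination] at hx
    exact hx
  have hrange' : ∀ x ∈ U, ∃ a, L' a = x := by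
    have h1 : U ≤ LinearMap.range L' := by
      rw [hU, Submodule.span_le, Finsupp.range_linearCombination]
      rintro _ ⟨n | n, rfl⟩
      · exact Submodule.subset_span ⟨Sum.inl (-n), by simp [e']⟩
      · rw [SetLike.mem_coe, ← neg_mem_iff]
        exact Submodule.subset_span ⟨Sum.inr (-n), by simp [e']⟩
    exact h1
  have hL'U : ∀ a, L' a ∈ U := fun a => by
    have h1 : LinearMap.range L' ≤ U := by
      rw [Finsupp.range_linearCombination, Submodule.span_le]
      rintro _ ⟨i, rfl⟩
      exact he'U i
    exact h1 ⟨a, rfl⟩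
  have hLU : ∀ a, L a ∈ U := fun a => by
    rw [hU, ← Finsupp.range_linearCombination]
    exact ⟨a, rfl⟩
  have hker : ∀ a, L a = 0 → L' a = 0 := fun a ha => by
    refine hUn _ (hL'U a) fun y hy => ?_
    obtain ⟨b, rfl⟩ := hrange' y hy
    rw [hLL, ha, map_zero, LinearMap.zero_apply]
  obtain ⟨s, hs1⟩ := LinearMap.exists_rightInverse_of_surjective (L.codRestrict U hLU) (by
    rw [LinearMap.range_eq_top]
    rintro ⟨x, hx⟩
    obtain ⟨a, rfl⟩ := hrange x hx
    exact ⟨a, rfl⟩)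
  have hs2 : ∀ x : U, L (s x) = x := fun x => congrArg Subtype.val (LinearMap.congr_fun hs1 x)
  let τ : U →ₗ[F] U := (L'.codRestrict U hL'U).comp s
  have hτ : ∀ a, τ ⟨L a, hLU a⟩ = ⟨L' a, hL'U a⟩ := fun a => by
    refine Subtype.ext ?_
    change L' (s _) = L' a
    rw [← sub_eq_zero, ← map_sub]
    refine hker _ ?_
    rw [map_sub, hs2, sub_self]
  have hτe : ∀ i, τ ⟨e i, heU i⟩ = ⟨e' i, he'U i⟩ := fun i => by
    have h1 := hτ (Finsupp.single i 1)
    simpa [L, L'] using h1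
  have hspan : ∀ (f f' : U →ₗ[F] U), (∀ i, f ⟨e i, heU i⟩ = f' ⟨e i, heU i⟩) → ∀ x, f x = f' x := by
    rintro f f' h ⟨x, hx⟩
    obtain ⟨a, rfl⟩ := hrange x hx
    have h1 : f.comp (L.codRestrict U hLU) = f'.comp (L.codRestrict U hLU) := by
      ext i
      have h2 := h i
      have h3 : L.codRestrict U hLU (Finsupp.single i 1) = ⟨e i, heU i⟩ := by
        refine Subtype.ext ?_
        simp [L]
      simp only [LinearMap.comp_apply, Finsupp.lsingle_apply]
      rw [h3, h2]
    exact LinearMap.congr_fun h1 a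
  refine ⟨τ, ?_, ?_, ?_⟩
  · refine hspan (τ.comp τ) LinearMap.id fun i => ?_
    rw [LinearMap.comp_apply, hτe, LinearMap.id_apply]
    rcases i with n | n
    · have h1 := hτe (Sum.inl (-n))
      simpa [e, e'] using h1
    · have h1 : (⟨e' (Sum.inr n), he'U _⟩ : U) = -⟨e (Sum.inr (-n)), heU _⟩ := rfl
      rw [h1, map_neg, hτe]
      refine Subtype.ext ?_
      simp [e, e']
  · rintro ⟨x, hx⟩ ⟨y, hy⟩
    obtain ⟨a, rfl⟩ := hrange x hx
    obtain ⟨b, rfl⟩ := hrange y hy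
    rw [hτ, hτ]
    exact hLL a b
  · refine hspan (τ.comp (resUnit g U hgU).1) ((resUnit g U hgU)⁻¹.1.comp τ) fun i => ?_
    change τ ((resUnit g U hgU).1 ⟨e i, heU i⟩) = (resUnit g U hgU)⁻¹.1 (τ ⟨e i, heU i⟩)
    rw [hτe]
    have hmul : ∀ (n : ℤ) (x : V), g.1 ((g ^ n).1 x) = (g ^ (n + 1)).1 x := fun n x => by
      rw [← Module.End.mul_apply, ← Units.val_mul, add_comm n, _root_.zpow_one_add]
    have hmul' : ∀ (n : ℤ) (x : V), g⁻¹.1 ((g ^ (-n)).1 x) = (g ^ (-(n + 1))).1 x := fun n x => by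
      rw [← Module.End.mul_apply, ← Units.val_mul, show -(n + 1) = -1 + -n by ring,
        _root_.zpow_add, _root_.zpow_neg_one]
    rcases i with n | n
    · have h1 : (resUnit g U hgU).1 ⟨e (Sum.inl n), heU _⟩ = ⟨e (Sum.inl (n + 1)), heU _⟩ :=
        Subtype.ext (hmul n v)
      rw [h1, hτe]
      exact Subtype.ext (hmul' n v).symm
    · have h1 : (resUnit g U hgU).1 ⟨e (Sum.inr n), heU _⟩ = ⟨e (Sum.inr (n + 1)), heU _⟩ :=
        Subtype.ext (hmul n w)
      rw [h1, hτe]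
      refine Subtype.ext ?_
      change -(g ^ (-(n + 1))).1 w = g⁻¹.1 (-(g ^ (-n)).1 w)
      rw [map_neg, hmul']

end Isometry

section Reversibility

open Polynomial

variable {F V : Type*} [Field F] [AddCommGroup V] [Module F V]

theorem aeval_adjoint {B : V →ₗ[F] V →ₗ[F] F} {f f' : Module.End F V}
    (h : ∀ x y, B (f x) y = B x (f' y)) (p : F[X]) :
    ∀ x y, B (aeval f p x) y = B x (aeval f' p y) := by
  induction p using Polynomial.induction_on' with
  | add p q hp hq =>
    intro x y
    simp only [map_add, LinearMap.add_apply, hp, hq]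
  | monomial n a =>
    have hn : ∀ n : ℕ, ∀ x y, B ((f ^ n) x) y = B x ((f' ^ n) y) := fun n => by
      induction n with
      | zero => intro x y; rfl
      | succ n ih =>
        intro x y
        rw [pow_succ, Module.End.mul_apply, ih, h, pow_succ', Module.End.mul_apply]
    intro x y
    simp only [aeval_monomial, Module.End.mul_apply, Module.algebraMap_end_apply, map_smul,
      LinearMap.smul_apply, hn]

theorem aeval_mem {f : Module.End F V} {U : Submodule F V} (h : ∀ x ∈ U, f x ∈ U) (p : F[X]) :
    ∀ x ∈ U, aeval f p x ∈ U := by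
  induction p using Polynomial.induction_on' with
  | add p q hp hq =>
    intro x hx
    rw [map_add]
    exact U.add_mem (hp x hx) (hq x hx)
  | monomial n a =>
    have hn : ∀ n : ℕ, ∀ x ∈ U, (f ^ n) x ∈ U := fun n => by
      induction n with
      | zero => intro x hx; exact hx
      | succ n ih =>
        intro x hx
        rw [pow_succ, Module.End.mul_apply]
        exact ih _ (h x hx)
    intro x hx
    simp only [aeval_monomial, Module.End.mul_apply, Module.algebraMap_end_apply]
    exact U.smul_mem a (hn n x hx)

theorem exists_mul_eq_pow {f : Module.End F V} {π : F[X]} (hπ : Irreducible π) (k : ℕ)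
    (h : aeval f π ^ (k + 1) = 0) (p : F[X]) (hp : aeval f p ≠ 0) :
    ∃ u : F[X], aeval f u * aeval f p = aeval f π ^ k := by
  have hp0 : p ≠ 0 := fun h0 => hp (by rw [h0, map_zero])
  obtain ⟨q, hq1, hq2⟩ := (FiniteMultiplicity.of_not_isUnit hπ.not_isUnit hp0).exists_eq_pow_mul_and_not_dvd
  set r := multiplicity π p
  have hr : r ≤ k := by
    by_contra hcon
    refine hp ?_
    rw [hq1, map_mul, map_pow, ← Nat.add_sub_of_le (Nat.succ_le_of_lt (not_le.1 hcon)), pow_add,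
      Nat.succ_eq_add_one, h, zero_mul, zero_mul]
  have hco : IsCoprime q (π ^ (k + 1)) :=
    IsCoprime.pow_right ((hπ.coprime_iff_not_dvd.2 hq2).symm)
  obtain ⟨u, w, huw⟩ := hco
  refine ⟨u * π ^ (k - r), ?_⟩
  rw [← map_mul]
  have h1 : u * π ^ (k - r) * p = π ^ k - w * π ^ k * π ^ (k + 1) := by
    have h2 : π ^ (k - r) * π ^ r = π ^ k := by rw [← pow_add, Nat.sub_add_cancel hr]
    rw [hq1]
    linear_combination u * q * h2 + π ^ k * huw
  rw [h1, map_sub, map_mul, map_pow _ _ (k + 1), h, mul_zero, sub_zero, map_pow]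

/-- The span of the orbits of two vectors. -/
def orbSpan (g : (Module.End F V)ˣ) (v w : V) : Submodule F V :=
  Submodule.span F (Set.range (Sum.elim (fun n : ℤ => (g ^ n).1 v) (fun n : ℤ => (g ^ n).1 w)))

theorem left_mem_orbSpan (g : (Module.End F V)ˣ) (v w : V) : v ∈ orbSpan g v w :=
  Submodule.subset_span ⟨Sum.inl 0, rfl⟩

theorem right_mem_orbSpan (g : (Module.End F V)ˣ) (v w : V) : w ∈ orbSpan g v w :=
  Submodule.subset_span ⟨Sum.inr 0, rfl⟩

theorem orbSpan_stable (g : (Module.End F V)ˣ) (v w : V) : UStable g (orbSpan g v w) := by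
  have h1 : ∀ m : ℤ, ∀ x ∈ orbSpan g v w, (g ^ m).1 x ∈ orbSpan g v w := by
    intro m x hx
    induction hx using Submodule.span_induction with
    | mem x hx =>
      rcases hx with ⟨n | n, rfl⟩
      · refine Submodule.subset_span ⟨Sum.inl (m + n), ?_⟩
        simp only [Sum.elim_inl, _root_.zpow_add]
        rfl
      · refine Submodule.subset_span ⟨Sum.inr (m + n), ?_⟩
        simp only [Sum.elim_inr, _root_.zpow_add]
        rfl
    | zero => rw [map_zero]; exact Submodule.zero_mem _
    | add x y _ _ hx hy => rw [map_add]; exact Submodule.add_mem _ hx hy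
    | smul a x _ hx => rw [map_smul]; exact Submodule.smul_mem _ _ hx
  exact ⟨by simpa using h1 1, by simpa using h1 (-1)⟩

theorem UStable.zpow_mem {g : (Module.End F V)ˣ} {T : Submodule F V} (hT : UStable g T) (n : ℤ) :
    ∀ x ∈ T, (g ^ n).1 x ∈ T := by
  induction n using Int.induction_on with
  | zero => intro x hx; exact hx
  | succ n ih =>
    intro x hx
    rw [_root_.zpow_add, zpow_one, Units.val_mul, Module.End.mul_apply]
    exact ih _ (hT.1 x hx)
  | pred n ih =>
    intro x hx
    rw [_root_.zpow_sub, zpow_one, Units.val_mul, Module.End.mul_apply]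
    exact ih _ (hT.2 x hx)

theorem orbSpan_le {g : (Module.End F V)ˣ} {v w : V} {T : Submodule F V} (hT : UStable g T)
    (hv : v ∈ T) (hw : w ∈ T) : orbSpan g v w ≤ T := by
  rw [orbSpan, Submodule.span_le]
  rintro _ ⟨n | n, rfl⟩
  · exact hT.zpow_mem n v hv
  · exact hT.zpow_mem n w hw

theorem exists_apply_self_ne_zero (h2 : (2 : F) ≠ 0) {B : V →ₗ[F] V →ₗ[F] F}
    (hs : ∀ x y, B x y = B y x) (hB : NonDegOn B ⊤) {N : Module.End F V}
    (hN : ∀ x y, B (N x) y = B x (N y)) (h0 : N ≠ 0) : ∃ v, B (N v) v ≠ 0 := by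
  by_contra! hcon
  refine h0 (LinearMap.ext fun x => hB _ trivial fun y _ => ?_)
  have h1 := hcon (x + y)
  simp only [map_add, LinearMap.add_apply, hcon, zero_add, add_zero] at h1
  rw [hN y x, hs y, ← two_mul] at h1
  exact (mul_eq_zero.1 h1).resolve_left h2

theorem nilpotent_or_injective [FiniteDimensional F V] {B : V →ₗ[F] V →ₗ[F] F}
    (hB : NonDegOn B ⊤) {g : (Module.End F V)ˣ}
    (hns : ∀ U, UStable g U → NonDegOn B U → U = ⊥ ∨ U = ⊤) (s : Module.End F V)
    (hsa : ∀ x y, B (s x) y = B x (s y)) (hc : Commute s g.1) :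
    IsNilpotent s ∨ Function.Injective s := by
  obtain ⟨n, hn⟩ := Filter.eventually_atTop.1 (LinearMap.eventually_isCompl_ker_pow_range_pow s)
  have h1 := hn (n + 1) (Nat.le_succ n)
  have hadj : ∀ x y, B ((s ^ (n + 1)) x) y = B x ((s ^ (n + 1)) y) := by
    have := aeval_adjoint hsa (X ^ (n + 1) : F[X])
    simpa only [map_pow, aeval_X] using this
  have hcg : ∀ x, (s ^ (n + 1)) (g.1 x) = g.1 ((s ^ (n + 1)) x) := fun x =>
    LinearMap.congr_fun (hc.pow_left (n + 1)) x
  have hcg' : ∀ x, (s ^ (n + 1)) (g⁻¹.1 x) = g⁻¹.1 ((s ^ (n + 1)) x) := fun x => by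
    rw [← unit_inv_apply g ((s ^ (n + 1)) (g⁻¹.1 x)), ← hcg, unit_apply_inv]
  have hst : UStable g (LinearMap.ker (s ^ (n + 1))) := by
    refine ⟨fun x hx => ?_, fun x hx => ?_⟩
    · rw [LinearMap.mem_ker] at hx ⊢
      rw [hcg, hx, map_zero]
    · rw [LinearMap.mem_ker] at hx ⊢
      rw [hcg', hx, map_zero]
  have hnd : NonDegOn B (LinearMap.ker (s ^ (n + 1))) := by
    refine fun x hx h => hB x trivial fun y _ => ?_
    obtain ⟨a, ha, _, ⟨b, rfl⟩, rfl⟩ := Submodule.mem_sup.1 (h1.sup_eq_top ▸ Submodule.mem_top :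
      y ∈ LinearMap.ker (s ^ (n + 1)) ⊔ LinearMap.range (s ^ (n + 1)))
    rw [map_add, h a ha, ← hadj, LinearMap.mem_ker.1 hx, map_zero, LinearMap.zero_apply, add_zero]
  rcases hns _ hst hnd with h | h
  · right
    have h3 : Function.Injective (s ^ (n + 1)) := LinearMap.ker_eq_bot.1 h
    rw [pow_succ] at h3
    exact Function.Injective.of_comp h3
  · left
    exact ⟨n + 1, LinearMap.ker_eq_top.1 h⟩

end Reversibility

section ReversibilityCases

open Polynomial

variable {F V : Type*} [Field F] [AddCommGroup V] [Module F V]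

theorem exists_pow_ne_zero [Nontrivial V] {s : Module.End F V} (h : IsNilpotent s) :
    ∃ k, s ^ k ≠ 0 ∧ s ^ (k + 1) = 0 := by
  have h0 : ¬ s ^ 0 = 0 := by
    rw [pow_zero]
    exact one_ne_zero
  have h1 := Nat.find_spec h
  have h2 : Nat.find h ≠ 0 := fun h2 => h0 (h2 ▸ h1)
  obtain ⟨k, hk⟩ := Nat.exists_eq_succ_of_ne_zero h2
  refine ⟨k, Nat.find_min h (by omega), ?_⟩
  rw [hk] at h1
  exact h1

theorem aeval_commute {f h : Module.End F V} (hc : Commute f h) (p : F[X]) :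
    Commute (aeval f p) h := by
  induction p using Polynomial.induction_on' with
  | add p q hp hq =>
    rw [map_add]
    exact hp.add_left hq
  | monomial n a =>
    rw [aeval_monomial]
    exact (Algebra.commute_algebraMap_left a h).mul_left (hc.pow_left n)

theorem exists_nondeg_orbit_of_injective [FiniteDimensional F V] [Nontrivial V] (h2 : (2 : F) ≠ 0)
    {B : V →ₗ[F] V →ₗ[F] F} (hs : ∀ x y, B x y = B y x) (hB : NonDegOn B ⊤)
    {g : (Module.End F V)ˣ} (hg : g ∈ isoGroup B)
    (hns : ∀ U, UStable g U → NonDegOn B U → U = ⊥ ∨ U = ⊤)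
    (hinj : Function.Injective ((g.1 - g⁻¹.1) * (g.1 - g⁻¹.1))) :
    ∃ v : V, v ≠ 0 ∧ NonDegOn B (orbSpan g v 0) := by
  set c : Module.End F V := g.1 + g⁻¹.1 with hc
  set Y : Module.End F V := g.1 - g⁻¹.1 with hY
  have hgi : g.1 * g⁻¹.1 = 1 := Units.mul_inv g
  have hig : g⁻¹.1 * g.1 = 1 := Units.inv_mul g
  have hadj : ∀ x y, B (g.1 x) y = B x (g⁻¹.1 y) := iso_adjoint hg
  have hadj' : ∀ x y, B (g⁻¹.1 x) y = B x (g.1 y) := fun x y => by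
    rw [hs, ← hadj, hs]
  have hca : ∀ x y, B (c x) y = B x (c y) := fun x y => by
    simp only [hc, LinearMap.add_apply, map_add, hadj, hadj', add_comm]
  have hYa : ∀ x y, B (Y x) y = -B x (Y y) := fun x y => by
    simp only [hY, LinearMap.sub_apply, map_sub, hadj, hadj', neg_sub]
  have hcg : Commute c g.1 := by
    change c * g.1 = g.1 * c
    rw [hc, add_mul, mul_add, hgi, hig]
  have hcY : Commute c Y := by
    change c * Y = Y * c
    rw [hc, hY]
    simp only [add_mul, mul_add, sub_mul, mul_sub, hgi, hig]
    abel
  have hpY : ∀ (p : F[X]) x, aeval c p (Y x) = Y (aeval c p x) := fun p x => by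
    have h3 : aeval c p * Y = Y * aeval c p :=
      aeval_commute hcY p
    exact LinearMap.congr_fun h3 x
  have hD : Y * Y = aeval c (X ^ 2 - C 4 : F[X]) := by
    rw [map_sub, map_pow, aeval_X, aeval_C, hc, hY, pow_two]
    simp only [add_mul, mul_add, sub_mul, mul_sub, hgi, hig, map_ofNat]
    rw [show (4 : Module.End F V) = 1 + 1 + 1 + 1 by norm_num]
    abel
  -- an irreducible factor of the minimal polynomial
  have hinteg : IsIntegral F c := Algebra.IsIntegral.isIntegral c
  obtain ⟨π, hπ, ν, hν⟩ := WfDvdMonoid.exists_irreducible_factor (minpoly.not_isUnit F c)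
    (minpoly.ne_zero hinteg)
  have hnil : IsNilpotent (aeval c π) := by
    refine (nilpotent_or_injective hB hns (aeval c π) (aeval_adjoint hca π) ?_).resolve_right ?_
    · exact aeval_commute hcg π
    · intro hi
      have h3 : aeval c ν = 0 := by
        refine LinearMap.ext fun x => hi ?_
        rw [← Module.End.mul_apply, ← map_mul, ← hν, minpoly.aeval, LinearMap.zero_apply]
        exact (map_zero _).symm
      obtain ⟨r, hr⟩ := minpoly.dvd F c h3
      have hν0 : ν ≠ 0 := fun h0 => minpoly.ne_zero hinteg (by rw [hν, h0, mul_zero])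
      refine hπ.not_isUnit (IsUnit.of_mul_eq_one r (mul_left_cancel₀ hν0 ?_))
      rw [mul_one]
      nth_rewrite 2 [hr]
      rw [hν]
      ring
  obtain ⟨k, hk0, hk1⟩ := exists_pow_ne_zero hnil
  have hNa : ∀ x y, B ((aeval c π ^ k) x) y = B x ((aeval c π ^ k) y) := by
    rw [← map_pow]
    exact aeval_adjoint hca _
  obtain ⟨v, hv⟩ := exists_apply_self_ne_zero h2 hs hB hNa hk0
  refine ⟨v, fun h0 => hv (by rw [h0, map_zero]), ?_⟩
  let T : Submodule F V :=
    { carrier := {x | ∃ s t : F[X], x = aeval c s v + aeval c t (Y v)}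
      add_mem' := by
        rintro _ _ ⟨s, t, rfl⟩ ⟨s', t', rfl⟩
        exact ⟨s + s', t + t', by simp only [map_add, LinearMap.add_apply]; abel⟩
      zero_mem' := ⟨0, 0, by simp⟩
      smul_mem' := by
        rintro a _ ⟨s, t, rfl⟩
        refine ⟨a • s, a • t, ?_⟩
        simp only [map_smul, LinearMap.smul_apply, smul_add] }
  have hTc : ∀ x ∈ T, c x ∈ T := by
    rintro _ ⟨s, t, rfl⟩
    refine ⟨X * s, X * t, ?_⟩
    simp only [map_mul, aeval_X, Module.End.mul_apply, map_add]
  have hTY : ∀ x ∈ T, Y x ∈ T := by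
    rintro _ ⟨s, t, rfl⟩
    refine ⟨t * (X ^ 2 - C 4), s, ?_⟩
    rw [map_mul, ← hD, Module.End.mul_apply, Module.End.mul_apply, map_add, hpY, hpY, add_comm]
    simp only [hpY]
  have hUT : orbSpan g v 0 ≤ T := by
    refine orbSpan_le ⟨fun x hx => ?_, fun x hx => ?_⟩ ⟨1, 0, by simp⟩ T.zero_mem
    · have h3 : g.1 x = (2 : F)⁻¹ • (c x + Y x) := by
        rw [hc, hY, LinearMap.add_apply, LinearMap.sub_apply, add_add_sub_cancel, ← two_smul F,
          smul_smul, inv_mul_cancel₀ h2, one_smul]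
      rw [h3]
      exact T.smul_mem _ (T.add_mem (hTc x hx) (hTY x hx))
    · have h3 : g⁻¹.1 x = (2 : F)⁻¹ • (c x - Y x) := by
        rw [hc, hY, LinearMap.add_apply, LinearMap.sub_apply, add_sub_sub_cancel, ← two_smul F,
          smul_smul, inv_mul_cancel₀ h2, one_smul]
      rw [h3]
      exact T.smul_mem _ (T.sub_mem (hTc x hx) (hTY x hx))
  have hUst := orbSpan_stable g v 0
  have hvU := left_mem_orbSpan g v 0
  have hcU : ∀ x ∈ orbSpan g v 0, c x ∈ orbSpan g v 0 := fun x hx =>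
    Submodule.add_mem _ (hUst.1 x hx) (hUst.2 x hx)
  have hYU : ∀ x ∈ orbSpan g v 0, Y x ∈ orbSpan g v 0 := fun x hx =>
    Submodule.sub_mem _ (hUst.1 x hx) (hUst.2 x hx)
  have hpU := aeval_mem hcU
  intro x hx hxU
  obtain ⟨s, t, hst⟩ := hUT hx
  by_cases hs0 : aeval c s = 0
  · by_cases ht0 : aeval c t = 0
    · rw [hst, hs0, ht0, LinearMap.zero_apply, LinearMap.zero_apply, add_zero]
    · have h3 : aeval c ((X ^ 2 - C 4) * t) ≠ 0 := by
        rw [map_mul, ← hD]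
        intro h3
        refine ht0 (LinearMap.ext fun z => hinj ?_)
        rw [LinearMap.zero_apply, map_zero, ← Module.End.mul_apply, h3, LinearMap.zero_apply]
      obtain ⟨u, hu⟩ := exists_mul_eq_pow hπ k hk1 _ h3
      refine absurd ?_ hv
      rw [← hu, map_mul, ← hD, Module.End.mul_apply, Module.End.mul_apply, Module.End.mul_apply,
        ← hpY t, aeval_adjoint hca, hYa]
      rw [hst, hs0, LinearMap.zero_apply, zero_add] at hxU
      rw [hxU _ (hYU _ (hpU u v hvU)), neg_zero]
  · obtain ⟨u, hu⟩ := exists_mul_eq_pow hπ k hk1 _ hs0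
    refine absurd ?_ hv
    have h3 : B (aeval c u x) v = 0 := by
      rw [aeval_adjoint hca]
      exact hxU _ (hpU u v hvU)
    have h4 : B (aeval c (u * t) (Y v)) v = 0 := by
      have h5 : B (aeval c (u * t) (Y v)) v = -B (aeval c (u * t) (Y v)) v := by
        nth_rewrite 1 [aeval_adjoint hca]
        rw [hYa, ← hpY, hs]
      have h6 : 2 * B (aeval c (u * t) (Y v)) v = 0 := by linear_combination h5
      exact (mul_eq_zero.1 h6).resolve_left h2
    rw [← hu, Module.End.mul_apply]
    rw [hst, map_add, map_add, LinearMap.add_apply] at h3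
    rw [map_mul, Module.End.mul_apply] at h4
    rw [h4, add_zero] at h3
    exact h3

end ReversibilityCases

section ReversibilityUnipotent

open Polynomial

variable {F V : Type*} [Field F] [AddCommGroup V] [Module F V]

theorem exists_isNilpotent_sub [FiniteDimensional F V] [Nontrivial V]
    {B : V →ₗ[F] V →ₗ[F] F} (hs : ∀ x y, B x y = B y x) (hB : NonDegOn B ⊤)
    {g : (Module.End F V)ˣ} (hg : g ∈ isoGroup B)
    (hns : ∀ U, UStable g U → NonDegOn B U → U = ⊥ ∨ U = ⊤)
    (hnil : IsNilpotent ((g.1 - g⁻¹.1) * (g.1 - g⁻¹.1))) :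
    ∃ ε : F, ε * ε = 1 ∧ IsNilpotent (aeval g.1 (X - C ε : F[X])) := by
  have hgi : g.1 * g⁻¹.1 = 1 := Units.mul_inv g
  have hig : g⁻¹.1 * g.1 = 1 := Units.inv_mul g
  have hadj : ∀ x y, B (g.1 x) y = B x (g⁻¹.1 y) := iso_adjoint hg
  have hadj' : ∀ x y, B (g⁻¹.1 x) y = B x (g.1 y) := fun x y => by
    rw [hs, ← hadj, hs]
  let s : F → Module.End F V := fun ε => g.1 + g⁻¹.1 - (2 * ε) • 1
  have hsx : ∀ ε x, s ε x = g.1 x + g⁻¹.1 x - (2 * ε) • x := fun ε x => rfl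
  have hsa : ∀ ε x y, B (s ε x) y = B x (s ε y) := fun ε x y => by
    simp only [hsx, LinearMap.add_apply, LinearMap.sub_apply, LinearMap.smul_apply, map_smul,
      map_sub, map_add, hadj, hadj', add_comm]
  have hsc : ∀ ε, Commute (s ε) g.1 := fun ε => by
    change s ε * g.1 = g.1 * s ε
    simp only [s, sub_mul, mul_sub, add_mul, mul_add, hgi, hig, smul_mul_assoc, mul_smul_comm,
      one_mul, mul_one]
  have key : ∀ ε : F, ε * ε = 1 → IsNilpotent (s ε) → IsNilpotent (aeval g.1 (X - C ε : F[X])) := by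
    intro ε hε h
    have h1 : aeval g.1 ((X - C ε) ^ 2 : F[X]) = s ε * g.1 := by
      rw [map_pow, map_sub, aeval_X, aeval_C, Algebra.algebraMap_eq_smul_one, pow_two]
      have h0 : ε • ε • (1 : Module.End F V) = 1 := by rw [smul_smul, hε, one_smul]
      simp only [s, sub_mul, mul_sub, add_mul, hig, smul_mul_assoc, mul_smul_comm, smul_sub, h0,
        one_mul, mul_one, two_mul, add_smul]
      abel
    have h2 := (hsc ε).isNilpotent_mul_right h
    rw [← h1, map_pow] at h2
    exact (IsNilpotent.pow_iff_pos two_ne_zero).1 h2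
  have hprod : (g.1 - g⁻¹.1) * (g.1 - g⁻¹.1) = s 1 * s (-1) := by
    simp only [s, sub_mul, mul_sub, add_mul, mul_add, hgi, hig, smul_mul_assoc, mul_smul_comm,
      one_mul, mul_one, smul_smul, mul_neg, neg_smul, smul_add, smul_sub]
    rw [show (2 : F) * 2 = 1 + 1 + 1 + 1 by norm_num]
    simp only [add_smul, one_smul]
    abel
  rcases nilpotent_or_injective hB hns (s 1) (hsa 1) (hsc 1) with h | h1
  · exact ⟨1, one_mul 1, key 1 (one_mul 1) h⟩
  rcases nilpotent_or_injective hB hns (s (-1)) (hsa (-1)) (hsc (-1)) with h | h2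
  · exact ⟨-1, by ring, key (-1) (by ring) h⟩
  exfalso
  obtain ⟨k, hk0, hk1⟩ := exists_pow_ne_zero hnil
  refine hk0 (LinearMap.ext fun x => h2 (h1 ?_))
  rw [← Module.End.mul_apply, ← Module.End.mul_apply, ← hprod, ← Module.End.mul_apply,
    ← pow_succ', hk1, LinearMap.zero_apply, map_zero]

theorem exists_nondeg_orbits_of_nilpotent [FiniteDimensional F V] [Nontrivial V] (h2 : (2 : F) ≠ 0)
    {B : V →ₗ[F] V →ₗ[F] F} (hs : ∀ x y, B x y = B y x) (hB : NonDegOn B ⊤)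
    {g : (Module.End F V)ˣ} (hg : g ∈ isoGroup B) (ε : F) (hε : ε * ε = 1)
    (hnil : IsNilpotent (aeval g.1 (X - C ε : F[X]))) :
    ∃ v w : V, v ≠ 0 ∧ (∀ n : ℤ, B v ((g ^ n).1 w) + B v ((g ^ (-n)).1 w) = 0) ∧
      NonDegOn B (orbSpan g v w) := by
  have hgi : g.1 * g⁻¹.1 = 1 := Units.mul_inv g
  have hig : g⁻¹.1 * g.1 = 1 := Units.inv_mul g
  have hadj : ∀ x y, B (g.1 x) y = B x (g⁻¹.1 y) := iso_adjoint hg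
  set π : F[X] := X - C ε with hπdef
  have hπ : Irreducible π := irreducible_X_sub_C ε
  obtain ⟨k, hk0, hk1⟩ := exists_pow_ne_zero hnil
  set N : Module.End F V := aeval g.1 π ^ k with hN
  have hYN : aeval g.1 π * N = 0 := by rw [hN, ← pow_succ', hk1]
  -- evaluation of polynomials on the kernel of `π`
  have heval : ∀ (p : F[X]) (Z : Module.End F V), aeval g.1 π * Z = 0 →
      aeval g.1 p * Z = p.eval ε • Z := by
    intro p Z hZ
    obtain ⟨r, hr⟩ := X_sub_C_dvd_sub_C_eval (a := ε) (p := p)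
    have h3 : p = C (p.eval ε) + r * π := by rw [hπdef]; linear_combination hr
    nth_rewrite 1 [h3]
    rw [map_add, map_mul, add_mul, mul_assoc, hZ, mul_zero, add_zero, aeval_C,
      Algebra.algebraMap_eq_smul_one, smul_mul_assoc, one_mul]
  have hinvpoly : ∃ q : F[X], aeval g.1 q = g⁻¹.1 := by
    have h3 : IsCoprime (X : F[X]) (π ^ (k + 1)) := by
      refine IsCoprime.pow_right ⟨C ε, -C ε, ?_⟩
      rw [hπdef]
      have h4 : (C ε * C ε : F[X]) = 1 := by rw [← C_mul, hε, C_1]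
      linear_combination h4
    obtain ⟨q, r, hqr⟩ := h3
    refine ⟨q, ?_⟩
    have h4 := congrArg (aeval g.1) hqr
    rw [map_add, map_mul, map_mul, aeval_X, map_pow, hk1, mul_zero, add_zero, map_one] at h4
    calc aeval g.1 q = aeval g.1 q * (g.1 * g⁻¹.1) := by rw [hgi, mul_one]
      _ = g⁻¹.1 := by rw [← mul_assoc, h4, one_mul]
  obtain ⟨q, hq⟩ := hinvpoly
  have hzpoly : ∀ n : ℤ, ∃ p : F[X], aeval g.1 p = (g ^ n).1 := by
    intro n
    induction n using Int.induction_on with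
    | zero => exact ⟨1, by simp⟩
    | succ n ih =>
      obtain ⟨p, hp⟩ := ih
      exact ⟨p * X, by rw [map_mul, hp, aeval_X, _root_.zpow_add_one, Units.val_mul]⟩
    | pred n ih =>
      obtain ⟨p, hp⟩ := ih
      exact ⟨p * q, by rw [map_mul, hp, hq, _root_.zpow_sub_one, Units.val_mul]⟩
  have hNadj : ∀ x y, B (N x) y = (-1) ^ k * B x (N y) := by
    have h3 : aeval g⁻¹.1 π = (-ε) • g⁻¹.1 * aeval g.1 π := by
      rw [hπdef, map_sub, map_sub, aeval_X, aeval_X, aeval_C, aeval_C, Algebra.algebraMap_eq_smul_one,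
        smul_mul_assoc, mul_sub, hig, mul_smul_comm, mul_one, smul_sub, smul_smul, neg_mul, hε,
        neg_smul, neg_smul, one_smul]
      abel
    have h4 : Commute ((-ε) • g⁻¹.1) (aeval g.1 π) := by
      rw [← hq, ← map_smul]
      exact Commute.map (Commute.all _ _) (aeval g.1)
    have h5 : (-ε) • g⁻¹.1 * N = (-1 : F) • N := by
      rw [← hq, smul_mul_assoc, heval q N hYN]
      have h6 : q.eval ε • N = ε • N := by
        have h7 : ε • (q.eval ε • N) = N := by
          have := heval (X * q) N hYN
          rw [map_mul, hq, aeval_X, hgi, one_mul, eval_mul, eval_X] at this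
          rw [smul_smul, ← this]
        calc q.eval ε • N = (ε * ε) • (q.eval ε • N) := by rw [hε, one_smul]
          _ = ε • N := by rw [← smul_smul, h7]
      rw [h6, smul_smul, neg_mul, hε]
    have h6 : ∀ j : ℕ, ((-ε) • g⁻¹.1) ^ j * N = ((-1 : F) ^ j) • N := fun j => by
      induction j with
      | zero => simp
      | succ j ih => rw [pow_succ', mul_assoc, ih, mul_smul_comm, h5, smul_smul, pow_succ]
    have h7 : aeval g⁻¹.1 (π ^ k) = ((-1 : F) ^ k) • N := by
      rw [map_pow, h3, h4.mul_pow, ← hN, h6]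
    intro x y
    rw [hN, ← map_pow, aeval_adjoint hadj, h7, LinearMap.smul_apply, map_smul, smul_eq_mul, map_pow]
  -- elements of the span of orbits
  have hmem : ∀ v w x : V, x ∈ orbSpan g v w →
      ∃ a b : F[X], x = aeval g.1 a v + aeval g.1 b w := by
    intro v w x hx
    let T : Submodule F V :=
      { carrier := {x | ∃ s t : F[X], x = aeval g.1 s v + aeval g.1 t w}
        add_mem' := by
          rintro _ _ ⟨s, t, rfl⟩ ⟨s', t', rfl⟩
          exact ⟨s + s', t + t', by simp only [map_add, LinearMap.add_apply]; abel⟩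
        zero_mem' := ⟨0, 0, by simp⟩
        smul_mem' := by
          rintro a _ ⟨s, t, rfl⟩
          refine ⟨a • s, a • t, ?_⟩
          simp only [map_smul, LinearMap.smul_apply, smul_add] }
    have hT : UStable g T := by
      refine ⟨?_, ?_⟩
      · rintro _ ⟨s, t, rfl⟩
        exact ⟨X * s, X * t, by simp only [map_mul, aeval_X, Module.End.mul_apply, map_add]⟩
      · rintro _ ⟨s, t, rfl⟩
        exact ⟨q * s, q * t, by simp only [map_mul, hq, Module.End.mul_apply, map_add]⟩
    exact orbSpan_le hT ⟨1, 0, by simp⟩ ⟨0, 1, by simp⟩ hx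
  have hE : ∀ v w x : V, (∀ y ∈ orbSpan g v w, B x y = 0) → ∀ (e : F[X]), ∀ z ∈ orbSpan g v w,
      B (aeval g.1 e x) z = 0 := by
    intro v w x hx e z hz
    rw [aeval_adjoint hadj]
    exact hx _ (aeval_mem (orbSpan_stable g v w).2 e z hz)
  rcases Nat.even_or_odd k with hk | hk
  · have hNs : ∀ x y, B (N x) y = B x (N y) := fun x y => by rw [hNadj, hk.neg_one_pow, one_mul]
    obtain ⟨v, hv⟩ := exists_apply_self_ne_zero h2 hs hB hNs hk0
    refine ⟨v, 0, fun h0 => hv (by rw [h0, map_zero]), by simp, fun x hx hxU => ?_⟩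
    obtain ⟨a, b, hab⟩ := hmem v 0 x hx
    rw [map_zero, add_zero] at hab
    by_cases ha : aeval g.1 a = 0
    · rw [hab, ha, LinearMap.zero_apply]
    obtain ⟨u, hu⟩ := exists_mul_eq_pow hπ k hk1 a ha
    refine absurd (hE v 0 x hxU u v (left_mem_orbSpan g v 0)) ?_
    rwa [hab, ← Module.End.mul_apply, hu]
  · have hNs : ∀ x y, B (N x) y = -B x (N y) := fun x y => by
      rw [hNadj, hk.neg_one_pow, neg_one_mul]
    have hself : ∀ a : F, a = -a → a = 0 := fun a ha => by
      have h6 : 2 * a = 0 := by linear_combination ha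
      exact (mul_eq_zero.1 h6).resolve_left h2
    have hN0 : ∀ x, B (N x) x = 0 := fun x => hself _ (by nth_rewrite 1 [hNs]; rw [hs])
    obtain ⟨v, hv⟩ : ∃ v, N v ≠ 0 := by
      by_contra! h
      exact hk0 (LinearMap.ext h)
    let S : Submodule F V := Submodule.span F (Set.range fun n : ℤ => (g ^ n).1 v + (g ^ (-n)).1 v)
    have hS : ∀ x ∈ S, ∃ p : F[X], x = aeval g.1 p v ∧
        ∀ y z, B (aeval g.1 p y) z = B y (aeval g.1 p z) := by
      intro x hx
      induction hx using Submodule.span_induction with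
      | mem x hx =>
        obtain ⟨n, rfl⟩ := hx
        obtain ⟨p, hp⟩ := hzpoly n
        obtain ⟨p', hp'⟩ := hzpoly (-n)
        refine ⟨p + p', ?_, fun y z => ?_⟩
        · rw [map_add, hp, hp', LinearMap.add_apply]
        · have h3 := iso_adjoint ((isoGroup B).zpow_mem hg n)
          have h4 := iso_adjoint ((isoGroup B).zpow_mem hg (-n))
          rw [map_add, hp, hp', LinearMap.add_apply, LinearMap.add_apply, map_add, map_add,
            LinearMap.add_apply, h3, h4, ← _root_.zpow_neg, ← _root_.zpow_neg, neg_neg, add_comm]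
      | zero => exact ⟨0, by simp, by simp⟩
      | add x y _ _ hx hy =>
        obtain ⟨p, rfl, hp⟩ := hx
        obtain ⟨p', rfl, hp'⟩ := hy
        refine ⟨p + p', by rw [map_add, LinearMap.add_apply], fun y z => ?_⟩
        rw [map_add, LinearMap.add_apply, LinearMap.add_apply, map_add, map_add,
          LinearMap.add_apply, hp, hp']
      | smul a x _ hx =>
        obtain ⟨p, rfl, hp⟩ := hx
        refine ⟨a • p, by rw [map_smul, LinearMap.smul_apply], fun y z => ?_⟩
        rw [map_smul, LinearMap.smul_apply, LinearMap.smul_apply, map_smul, map_smul,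
          LinearMap.smul_apply, hp]
    have hvS : N v ∉ S := by
      intro h
      obtain ⟨p, hp, hpa⟩ := hS _ h
      by_cases h3 : aeval g.1 (π ^ k - p) = 0
      · rw [map_sub, map_pow, sub_eq_zero, ← hN] at h3
        refine hv (hB _ trivial fun y _ => hself _ ?_)
        nth_rewrite 1 [hNs]
        nth_rewrite 2 [h3]
        rw [hpa, ← h3]
      · obtain ⟨u, hu⟩ := exists_mul_eq_pow hπ k hk1 _ h3
        refine hv ?_
        rw [hN, ← hu, Module.End.mul_apply, map_sub, map_pow, ← hN, LinearMap.sub_apply, ← hp,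
          sub_self, map_zero]
    obtain ⟨f, hf, hfS⟩ := Submodule.exists_le_ker_of_notMem hvS
    obtain ⟨w, hw⟩ : ∃ w, B w = f := by
      have hinj : Function.Injective B := by
        rw [← LinearMap.ker_eq_bot, LinearMap.ker_eq_bot']
        exact fun x hx => hB x trivial fun y _ => by rw [hx, LinearMap.zero_apply]
      exact (LinearEquiv.ofInjectiveOfFinrankEq B hinj Subspace.dual_finrank_eq.symm).surjective f
    have hwv : B (N w) v ≠ 0 := by
      rw [hNs, hw]
      exact neg_ne_zero.2 hf
    have hvw : B (N v) w ≠ 0 := by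
      rw [hs, hw]
      exact hf
    refine ⟨v, w, fun h0 => hv (by rw [h0, map_zero]), fun n => ?_, fun x hx hxU => ?_⟩
    · have h3 := iso_adjoint ((isoGroup B).zpow_mem hg n)
      have h4 := iso_adjoint ((isoGroup B).zpow_mem hg (-n))
      have h5 : B w ((g ^ n).1 v + (g ^ (-n)).1 v) = 0 := by
        rw [hw]
        exact hfS (Submodule.subset_span ⟨n, rfl⟩)
      rw [hs v, hs v, h3, h4, ← _root_.zpow_neg, ← _root_.zpow_neg, neg_neg, add_comm, ← map_add]
      exact h5
    · have hvU := left_mem_orbSpan g v w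
      have hwU := right_mem_orbSpan g v w
      have hE' := hE v w x hxU
      obtain ⟨a, b, hab⟩ := hmem v w x hx
      by_cases ha : aeval g.1 a = 0
      · by_cases hb : aeval g.1 b = 0
        · rw [hab, ha, hb, LinearMap.zero_apply, LinearMap.zero_apply, add_zero]
        obtain ⟨u, hu⟩ := exists_mul_eq_pow hπ k hk1 b hb
        refine absurd (hE' u v hvU) ?_
        rwa [hab, ha, LinearMap.zero_apply, zero_add, ← Module.End.mul_apply, hu]
      obtain ⟨u, hu⟩ := exists_mul_eq_pow hπ k hk1 a ha
      by_cases hb : aeval g.1 (π * (u * b)) = 0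
      · have h3 : ∃ β : F, aeval g.1 (u * b) = β • N := by
          by_cases h4 : aeval g.1 (u * b) = 0
          · exact ⟨0, by rw [h4, zero_smul]⟩
          obtain ⟨r, hr⟩ := exists_mul_eq_pow hπ k hk1 _ h4
          rw [map_mul] at hb
          rw [heval r _ hb, ← hN] at hr
          have h5 : r.eval ε ≠ 0 := fun h5 => hk0 (by rw [← hr, h5, zero_smul])
          exact ⟨(r.eval ε)⁻¹, by rw [← hr, smul_smul, inv_mul_cancel₀ h5, one_smul]⟩
        obtain ⟨β, hβ⟩ := h3
        refine absurd (hE' u w hwU) ?_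
        rw [map_mul] at hβ
        rw [hab, map_add, ← Module.End.mul_apply, ← Module.End.mul_apply, hu, hβ, map_add,
          LinearMap.add_apply, LinearMap.smul_apply, map_smul, LinearMap.smul_apply, hN0, smul_zero,
          add_zero]
        exact hvw
      · obtain ⟨r, hr⟩ := exists_mul_eq_pow hπ k hk1 _ hb
        refine absurd (hE' (r * (π * u)) v hvU) ?_
        have h3 : aeval g.1 (r * (π * u)) * aeval g.1 a = 0 := by
          rw [map_mul, map_mul, mul_assoc, mul_assoc, hu, ← hN, hYN, mul_zero]
        have h4 : aeval g.1 (r * (π * u)) * aeval g.1 b = N := by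
          rw [← map_mul, show r * (π * u) * b = r * (π * (u * b)) by ring, map_mul, hr]
        rw [hab, map_add, ← Module.End.mul_apply, ← Module.End.mul_apply, h3, h4,
          LinearMap.zero_apply, zero_add]
        exact hwv

end ReversibilityUnipotent

section Reversible

theorem resUnit_mem_isoGroup {F V : Type*} [Field F] [AddCommGroup V] [Module F V]
    {B : V →ₗ[F] V →ₗ[F] F} {g : (Module.End F V)ˣ} (hg : g ∈ isoGroup B) (U : Submodule F V)
    (h : UStable g U) : resUnit g U h ∈ isoGroup (resForm B U) := fun x y => hg x y

theorem perp_lt_top {F V : Type*} [Field F] [AddCommGroup V] [Module F V] [FiniteDimensional F V]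
    {B : V →ₗ[F] V →ₗ[F] F} (hs : ∀ x y, B x y = B y x)
    {U : Submodule F V} (h : NonDegOn B U) (hU : U ≠ ⊥) : perp B U < ⊤ := by
  rw [lt_top_iff_ne_top]
  intro h1
  have h2 := (isCompl_perp hs h).disjoint
  rw [h1, disjoint_top] at h2
  exact hU h2

theorem rev_of_mem_isoGroup_aux {F : Type*} [Field F] (h2 : (2 : F) ≠ 0) (n : ℕ) :
    ∀ {V : Type*} [AddCommGroup V] [Module F V] [FiniteDimensional F V],
      Module.finrank F V = n → ∀ {B : V →ₗ[F] V →ₗ[F] F}, (∀ x y, B x y = B y x) →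
      NonDegOn B ⊤ → ∀ {g : (Module.End F V)ˣ}, g ∈ isoGroup B → Rev B g := by
  induction n using Nat.strong_induction_on with
  | _ n ih =>
  intro V _ _ _ hn B hs hB g hg
  rcases subsingleton_or_nontrivial V with hV | hV
  · exact ⟨LinearMap.id, fun x => rfl, fun x y => rfl, fun x => Subsingleton.elim _ _⟩
  have step : ∀ U : Submodule F V, U ≠ ⊤ → NonDegOn B U → ∀ hst : UStable g U,
      Rev (resForm B U) (resUnit g U hst) := fun U hU hUn hst =>
    ih (Module.finrank F U) (by rw [← hn]; exact Submodule.finrank_lt hU) rfl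
      (B := resForm B U) (fun x y => hs x y)
      hUn.resForm_top (resUnit_mem_isoGroup hg U hst)
  have glue : ∀ U : Submodule F V, U ≠ ⊥ → NonDegOn B U → ∀ hst : UStable g U,
      Rev (resForm B U) (resUnit g U hst) → Rev B g := fun U hU hUn hst hrev =>
    Rev.glue hs hg hUn hst hrev (step _ (perp_lt_top hs hUn hU).ne (nonDegOn_perp hs hB hUn) _)
  by_cases hns : ∀ U, UStable g U → NonDegOn B U → U = ⊥ ∨ U = ⊤
  · have key : ∃ v w : V, v ≠ 0 ∧ (∀ n : ℤ, B v ((g ^ n).1 w) + B v ((g ^ (-n)).1 w) = 0) ∧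
        NonDegOn B (orbSpan g v w) := by
      have hadj : ∀ x y, B (g.1 x) y = B x (g⁻¹.1 y) := iso_adjoint hg
      have hadj' : ∀ x y, B (g⁻¹.1 x) y = B x (g.1 y) := fun x y => by rw [hs, ← hadj, hs]
      have hsa : ∀ x y, B (((g.1 - g⁻¹.1) * (g.1 - g⁻¹.1)) x) y =
          B x (((g.1 - g⁻¹.1) * (g.1 - g⁻¹.1)) y) := by
        intro x y
        simp only [Module.End.mul_apply, LinearMap.sub_apply, map_sub, hadj, hadj']
        ring
      have hcomm : Commute (g.1 - g⁻¹.1) g.1 := by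
        change (g.1 - g⁻¹.1) * g.1 = g.1 * (g.1 - g⁻¹.1)
        rw [sub_mul, mul_sub, Units.mul_inv g, Units.inv_mul g]
      rcases nilpotent_or_injective hB hns _ hsa (hcomm.mul_left hcomm) with h | h
      · obtain ⟨ε, hε, hnil⟩ := exists_isNilpotent_sub hs hB hg hns h
        exact exists_nondeg_orbits_of_nilpotent h2 hs hB hg ε hε hnil
      · obtain ⟨v, hv, hn⟩ := exists_nondeg_orbit_of_injective h2 hs hB hg hns h
        exact ⟨v, 0, hv, by simp, hn⟩
    obtain ⟨v, w, hv, hvw, hU⟩ := key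
    refine glue (orbSpan g v w) ?_ hU (orbSpan_stable g v w)
      (rev_of_two_orbits hs hg v w hvw _ rfl hU _)
    intro h
    exact hv ((Submodule.eq_bot_iff _).1 h v (left_mem_orbSpan g v w))
  · push Not at hns
    obtain ⟨U, hst, hUn, hU0, hU1⟩ := hns
    exact glue U hU0 hUn hst (step U hU1 hUn hst)

/-- Every isometry is inverted by an isometric involution. -/
theorem rev_of_mem_isoGroup {F V : Type*} [Field F] [AddCommGroup V] [Module F V]
    [FiniteDimensional F V] (h2 : (2 : F) ≠ 0) {B : V →ₗ[F] V →ₗ[F] F}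
    (hs : ∀ x y, B x y = B y x) (hB : NonDegOn B ⊤) {g : (Module.End F V)ˣ}
    (hg : g ∈ isoGroup B) :
    ∃ τ ∈ isoGroup B, τ * τ = 1 ∧ τ * g * τ = g⁻¹ := by
  obtain ⟨τ, h1, h3, h4⟩ := rev_of_mem_isoGroup_aux h2 _ rfl hs hB hg
  have hττ : τ * τ = 1 := LinearMap.ext h1
  refine ⟨⟨τ, τ, hττ, hττ⟩, h3, Units.ext hττ, Units.ext (LinearMap.ext fun x => ?_)⟩
  change τ (g.1 (τ x)) = g⁻¹.1 x
  rw [h4, h1]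

end Reversible

section TwoGroups

variable {S : Type*} [Group S] [Finite S]

theorem mem_zpowers_zpow_of_odd (hS : IsPGroup 2 S) (b : S) {i : ℤ} (hi : Odd i) :
    b ∈ Subgroup.zpowers (b ^ i) := by
  obtain ⟨k, hk⟩ := hS b
  have h1 : IsCoprime i ((2 : ℤ) ^ k) := IsCoprime.pow_right (Int.isCoprime_two_right.2 hi)
  obtain ⟨u, v, huv⟩ := h1
  refine Subgroup.mem_zpowers_iff.2 ⟨u, ?_⟩
  have h2 : b ^ ((2 : ℤ) ^ k) = 1 := by
    rw [← hk, ← zpow_natCast]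
    push_cast
    rfl
  calc (b ^ i) ^ u = b ^ (u * i) := by rw [mul_comm, _root_.zpow_mul]
    _ = b ^ (u * i + v * 2 ^ k) := by
      rw [_root_.zpow_add, mul_comm v, _root_.zpow_mul b (2 ^ k), h2, _root_.one_zpow, mul_one]
    _ = b := by rw [huv, zpow_one]

theorem eq_one_of_zpow_odd (hS : IsPGroup 2 S) (b : S) {i : ℤ} (hi : Odd i) (h : b ^ i = 1) :
    b = 1 := by
  have h1 := mem_zpowers_zpow_of_odd hS b hi
  rwa [h, Subgroup.zpowers_one_eq_bot, Subgroup.mem_bot] at h1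

theorem involution_unique (b c d : S) (hc : c ∈ Subgroup.zpowers b) (hd : d ∈ Subgroup.zpowers b)
    (hc2 : c * c = 1) (hd2 : d * d = 1) (hc1 : c ≠ 1) (hd1 : d ≠ 1) : c = d := by
  by_contra hne
  have : Fintype (Subgroup.zpowers b) := Fintype.ofFinite _
  have h1 := IsCyclic.card_pow_eq_one_le (α := Subgroup.zpowers b) (n := 2) two_pos
  have h2 : ({1, ⟨c, hc⟩, ⟨d, hd⟩} : Finset (Subgroup.zpowers b)) ⊆
      Finset.univ.filter fun a : Subgroup.zpowers b => a ^ 2 = 1 := by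
    intro x hx
    simp only [Finset.mem_insert, Finset.mem_singleton] at hx
    rw [Finset.mem_filter]
    refine ⟨Finset.mem_univ _, ?_⟩
    rcases hx with rfl | rfl | rfl
    · exact one_pow 2
    · exact Subtype.ext (by rw [pow_two]; exact hc2)
    · exact Subtype.ext (by rw [pow_two]; exact hd2)
  have h3 := (Finset.card_le_card h2).trans h1
  rw [Finset.card_eq_three.2 ⟨1, ⟨c, hc⟩, ⟨d, hd⟩, fun h => hc1 (congrArg Subtype.val h).symm,
    fun h => hd1 (congrArg Subtype.val h).symm, fun h => hne (congrArg Subtype.val h), rfl⟩] at h3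
  omega

theorem exists_mem_central_quotient (hS : IsPGroup 2 S) (M N : Subgroup S) [M.Normal] [N.Normal]
    (hNM : ¬ N ≤ M) : ∃ z ∈ N, z ∉ M ∧ z * z ∈ M ∧ ∀ s, s * z * s⁻¹ * z⁻¹ ∈ M := by
  have : Fact (Nat.Prime 2) := ⟨Nat.prime_two⟩
  let π := QuotientGroup.mk' M
  have hπ : Function.Surjective π := QuotientGroup.mk'_surjective M
  have hQ : IsPGroup 2 (S ⧸ M) := hS.to_quotient M
  let N' : Subgroup (S ⧸ M) := N.map π
  have hN' : N'.Normal := Subgroup.Normal.map inferInstance π hπ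
  have hN'p : IsPGroup 2 N' := hQ.to_subgroup N'
  have hN'0 : Nontrivial N' := by
    obtain ⟨x, hxN, hxM⟩ := Set.not_subset.1 hNM
    refine ⟨⟨⟨π x, Subgroup.mem_map_of_mem π hxN⟩, 1, fun h => hxM ?_⟩⟩
    exact (QuotientGroup.eq_one_iff x).1 (congrArg Subtype.val h)
  have hdvd : 2 ∣ Nat.card N' :=
    hN'p.card_eq_or_dvd.resolve_left fun h => by
      rw [Nat.card_eq_one_iff_unique] at h
      exact not_subsingleton N' h.1
  have hC : IsPGroup 2 (ConjAct (S ⧸ M)) := hQ.of_equiv ConjAct.toConjAct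
  obtain ⟨w, hw, hw1⟩ := hC.exists_fixed_point_of_prime_dvd_card_of_fixed_point N' hdvd
    (a := (1 : N')) (fun g => smul_one g)
  let K : Subgroup (S ⧸ M) := N' ⊓ Subgroup.center (S ⧸ M)
  have hwK : (w : S ⧸ M) ∈ K := by
    refine ⟨w.2, Subgroup.mem_center_iff.2 fun g => ?_⟩
    have h1 := congrArg Subtype.val (hw (ConjAct.toConjAct g))
    rw [ConjAct.Subgroup.val_conj_smul, ConjAct.toConjAct_smul] at h1
    rw [← mul_inv_eq_iff_eq_mul]
    exact h1
  have hKp : IsPGroup 2 K := hQ.to_subgroup K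
  have hKd : 2 ∣ Nat.card K :=
    hKp.card_eq_or_dvd.resolve_left fun h => by
      rw [Nat.card_eq_one_iff_unique] at h
      refine hw1 (Subtype.ext ?_)
      have := h.1
      have h5 : ((1 : K) : S ⧸ M) = (⟨w, hwK⟩ : K) :=
        congrArg Subtype.val (Subsingleton.elim (1 : K) ⟨w, hwK⟩)
      exact h5
  obtain ⟨t, ht⟩ := exists_prime_orderOf_dvd_card' 2 hKd
  obtain ⟨z, hzN, hz⟩ := t.2.1
  have ht1 : (t : S ⧸ M) ≠ 1 := fun h => by
    have : t = 1 := Subtype.ext h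
    rw [this, orderOf_one] at ht
    omega
  have ht2 : (t : S ⧸ M) * t = 1 := by
    have h1 := pow_orderOf_eq_one t
    rw [ht, pow_two] at h1
    exact congrArg Subtype.val h1
  have hmem : ∀ x, π x = 1 ↔ x ∈ M := fun x => QuotientGroup.eq_one_iff x
  refine ⟨z, hzN, fun h => ht1 ?_, ?_, fun s => ?_⟩
  · rw [← hz]
    exact (hmem z).2 h
  · rw [← hmem, map_mul, hz, ht2]
  · rw [← hmem, map_mul, map_mul, map_mul, map_inv, map_inv, hz,
      Subgroup.mem_center_iff.1 t.2.2 (π s), mul_inv_cancel_right, mul_inv_cancel]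

/-- A cyclic subgroup of index at most two in a `2`-group with few involutions. -/
theorem exists_cyclic_of_no_involution (hS : IsPGroup 2 S) (P : Subgroup S) [P.Normal] (e : S)
    (he : e ∈ P) (hec : ∀ s, s * e = e * s) (he2 : e * e = 1)
    (hno : ∀ z ∈ P, z * z = 1 → z ≠ 1 → z ≠ e →
      (∀ s, s * z * s⁻¹ = z ∨ s * z * s⁻¹ = z * e) → False) :
    ∃ b ∈ P, (Subgroup.zpowers b).Normal ∧ ∀ p ∈ P, ∀ p' ∈ P, p ∉ Subgroup.zpowers b →
      p' ∉ Subgroup.zpowers b → p * p' ∈ Subgroup.zpowers b := by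
  obtain ⟨b, ⟨hbP, hbN⟩, hmax⟩ := Set.exists_max_image {b : S | b ∈ P ∧ (Subgroup.zpowers b).Normal}
    (fun b => Nat.card (Subgroup.zpowers b)) (Set.toFinite _)
    ⟨1, P.one_mem, by rw [Subgroup.zpowers_one_eq_bot]; infer_instance⟩
  set M := Subgroup.zpowers b with hM
  have hbM : b ∈ M := Subgroup.mem_zpowers b
  have hMP : M ≤ P := (Subgroup.zpowers_le).2 hbP
  have hMc : ∀ x ∈ M, ∀ y ∈ M, x * y = y * x := by
    rintro _ ⟨i, rfl⟩ _ ⟨j, rfl⟩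
    exact zpow_mul_comm b i j
  have hMN : ∀ s, ∀ x ∈ M, s * x * s⁻¹ ∈ M := fun s x hx => hbN.conj_mem x hx s
  have hmax' : ∀ z ∈ P, (Subgroup.zpowers z).Normal → M ≤ Subgroup.zpowers z → z ∈ M := by
    intro z hz hzN hle
    rw [Subgroup.eq_of_le_of_card_ge hle (hmax z ⟨hz, hzN⟩)]
    exact Subgroup.mem_zpowers z
  have hinv : ∀ c ∈ M, c * c = 1 → c = 1 ∨ c = e := by
    intro c hc hc2
    by_contra! hcon
    refine hno c (hMP hc) hc2 hcon.1 hcon.2 fun s => Or.inl ?_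
    refine involution_unique b _ _ (hMN s c hc) hc ?_ hc2 (fun h => hcon.1 ?_) hcon.1
    · rw [show (s * c * s⁻¹) * (s * c * s⁻¹) = s * (c * c) * s⁻¹ by group, hc2, mul_one,
        mul_inv_cancel]
    · rwa [mul_inv_eq_one, mul_eq_left] at h
  have heM : e ∈ M := by
    by_cases hb1 : b = 1
    · refine hmax' e he ⟨fun n hn g => ?_⟩ ?_
      · obtain ⟨i, rfl⟩ := hn
        have h1 : Commute g e := hec g
        rw [(h1.zpow_right i).eq, mul_inv_cancel_right]
        exact ⟨i, rfl⟩
      · rw [hM, hb1, Subgroup.zpowers_one_eq_bot]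
        exact bot_le
    · have : Fact (Nat.Prime 2) := ⟨Nat.prime_two⟩
      obtain ⟨t, ht⟩ := hS.dvd_orderOf hb1
      have h1 : b ^ t * b ^ t = 1 := by rw [← pow_add, ← two_mul, ← ht, pow_orderOf_eq_one]
      rcases hinv (b ^ t) (M.pow_mem hbM t) h1 with h | h
      · have h2 := orderOf_dvd_of_pow_eq_one h
        have h3 := orderOf_pos b
        have h4 := Nat.le_of_dvd (by omega) h2
        omega
      · rw [← h]
        exact M.pow_mem hbM t
  have hcent : ∀ p ∈ P, p * b = b * p → p ∈ M := by
    have hCN : (Subgroup.centralizer (M : Set S)).Normal := inferInstance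
    have hle : P ⊓ Subgroup.centralizer (M : Set S) ≤ M := by
      by_contra hcon
      obtain ⟨z, ⟨hzP, hzC⟩, hzM, ⟨i, hi⟩, hzs⟩ := exists_mem_central_quotient hS M _ hcon
      have hzc : ∀ x ∈ M, x * z = z * x := fun x hx => Subgroup.mem_centralizer_iff.1 hzC x hx
      change b ^ i = z * z at hi
      rcases Int.even_or_odd i with ⟨j, hj⟩ | hodd
      · set c := b ^ (-j) with hc
        have hcM : c ∈ M := M.zpow_mem hbM _
        have hz2 : (z * c) * (z * c) = 1 := by
          rw [mul_assoc, ← mul_assoc c, hzc c hcM, mul_assoc z c, ← mul_assoc, ← hi, hc, hj,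
            ← _root_.zpow_add, ← _root_.zpow_add]
          rw [show j + j + (-j + -j) = 0 by ring, zpow_zero]
        have hzcM : z * c ∉ M := fun h => hzM ((Subgroup.mul_mem_cancel_right M hcM).1 h)
        have hzc' : ∀ x ∈ M, x * (z * c) = z * c * x := fun x hx => by
          rw [← mul_assoc, hzc x hx, mul_assoc, mul_assoc, hMc x hx c hcM]
        refine hno (z * c) (P.mul_mem hzP (hMP hcM)) hz2 (fun h => hzcM (h ▸ M.one_mem))
          (fun h => hzcM (h ▸ heM)) fun s => ?_
        set f := s * (z * c) * s⁻¹ * (z * c)⁻¹ with hf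
        have hfM : f ∈ M := by
          have h1 : f = (s * z * s⁻¹ * z⁻¹) * (z * (s * c * s⁻¹ * c⁻¹) * z⁻¹) := by
            rw [hf]; group
          rw [h1]
          exact M.mul_mem (hzs s) (hMN z _ (M.mul_mem (hMN s c hcM) (M.inv_mem hcM)))
        have hfz : s * (z * c) * s⁻¹ = f * (z * c) := by rw [hf, inv_mul_cancel_right]
        have hff : f * f = 1 := by
          have h1 : (s * (z * c) * s⁻¹) * (s * (z * c) * s⁻¹) = 1 := by
            rw [show (s * (z * c) * s⁻¹) * (s * (z * c) * s⁻¹) = s * ((z * c) * (z * c)) * s⁻¹ by group, hz2, mul_one,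
              mul_inv_cancel]
          rw [hfz, mul_assoc, ← mul_assoc (z * c), ← hzc' f hfM, mul_assoc f (z * c), hz2, mul_one]
            at h1
          exact h1
        rw [hfz]
        rcases hinv f hfM hff with h | h
        · left; rw [h, one_mul]
        · right; rw [h, ← hec]
      · have hle : M ≤ Subgroup.zpowers z := by
          rw [hM, Subgroup.zpowers_le]
          have h1 := mem_zpowers_zpow_of_odd hS b hodd
          rw [hi] at h1
          exact (Subgroup.zpowers_le.2 (Subgroup.mul_mem _ (Subgroup.mem_zpowers z)
            (Subgroup.mem_zpowers z))) h1
        refine hzM (hmax' z hzP ⟨fun n hn g => ?_⟩ hle)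
        obtain ⟨j, rfl⟩ := hn
        change g * z ^ j * g⁻¹ ∈ _
        rw [← conj_zpow]
        refine Subgroup.zpow_mem _ ?_ j
        rw [← inv_mul_cancel_right (g * z * g⁻¹) z]
        exact Subgroup.mul_mem _ (hle (hzs g)) (Subgroup.mem_zpowers z)
    intro p hp hpb
    refine hle ⟨hp, Subgroup.mem_centralizer_iff.2 ?_⟩
    rintro _ ⟨i, rfl⟩
    have h1 : Commute b p := hpb.symm
    exact (h1.zpow_left i).eq
  refine ⟨b, hbP, hbN, ?_⟩
  by_cases hb2 : b * b = 1
  · have h1 : ∀ p ∈ P, p ∈ M := fun p hp => by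
      refine hcent p hp ?_
      rcases hinv b hbM hb2 with h | h
      · rw [h, one_mul, mul_one]
      · rw [h, hec]
    exact fun p hp p' hp' hn => absurd (h1 p hp) hn
  -- an element of order four
  obtain ⟨d, hdM, hdd⟩ : ∃ d ∈ M, d * d = e ∧ e ≠ 1 := by
    have : Fact (Nat.Prime 2) := ⟨Nat.prime_two⟩
    obtain ⟨k, hk⟩ := IsPGroup.iff_orderOf.1 hS b
    have hk2 : 2 ≤ k := by
      by_contra hcon
      refine hb2 ?_
      have h1 : orderOf b ∣ 2 := by
        rw [hk]
        exact pow_dvd_pow 2 (by omega : k ≤ 1)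
      rw [← pow_two]
      exact orderOf_dvd_iff_pow_eq_one.1 h1
    obtain ⟨l, rfl⟩ := Nat.exists_eq_add_of_le hk2
    have h2 : b ^ (2 ^ l) * b ^ (2 ^ l) = b ^ (2 ^ (l + 1)) := by rw [← pow_add, pow_succ, mul_two]
    have h3 : b ^ (2 ^ (l + 1)) * b ^ (2 ^ (l + 1)) = 1 := by
      rw [← pow_add, ← mul_two, ← pow_succ, show l + 1 + 1 = 2 + l by ring, ← hk,
        pow_orderOf_eq_one]
    have h4 : b ^ (2 ^ (l + 1)) ≠ 1 := fun h => by
      have h5 := orderOf_dvd_of_pow_eq_one h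
      rw [hk, Nat.pow_dvd_pow_iff_le_right (by norm_num)] at h5
      omega
    have h5 := (hinv _ (M.pow_mem hbM _) h3).resolve_left h4
    exact ⟨b ^ (2 ^ l), M.pow_mem hbM _, by rw [h2, h5], by rwa [h5] at h4⟩
  obtain ⟨hdd, he1⟩ := hdd
  have hd4 : orderOf d = 2 ^ (1 + 1) := by
    have : Fact (Nat.Prime 2) := ⟨Nat.prime_two⟩
    refine orderOf_eq_prime_pow ?_ ?_
    · rw [pow_one, pow_two, hdd]
      exact he1
    · rw [show 2 ^ (1 + 1) = 2 + 2 by norm_num, pow_add, pow_two, hdd, he2]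
  have hdk : ∀ s, ∃ k : ℤ, s * b * s⁻¹ = b ^ k ∧ s * d * s⁻¹ = d ^ k := by
    intro s
    obtain ⟨k, hk⟩ := hMN s b hbM
    obtain ⟨i, rfl⟩ := hdM
    change b ^ k = _ at hk
    refine ⟨k, hk.symm, ?_⟩
    change s * b ^ i * s⁻¹ = (b ^ i) ^ k
    rw [← conj_zpow, ← hk, ← _root_.zpow_mul, mul_comm, _root_.zpow_mul]
  have hezpow : ∀ n : ℤ, Odd n → e ^ n = e := by
    rintro n ⟨t, rfl⟩
    rw [_root_.zpow_add, _root_.zpow_mul, zpow_two, he2, _root_.one_zpow, one_mul, zpow_one]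
  have hezpow' : ∀ n : ℤ, Even n → e ^ n = 1 := by
    rintro n ⟨t, rfl⟩
    rw [← two_mul, _root_.zpow_mul, zpow_two, he2, _root_.one_zpow]
  have hP1 : ∀ p ∈ P, p * d = d * p → p ∈ M := by
    have hdN : (Subgroup.zpowers d).Normal := ⟨fun n hn g => by
      obtain ⟨i, rfl⟩ := hn
      obtain ⟨k, -, hk⟩ := hdk g
      change g * d ^ i * g⁻¹ ∈ _
      rw [← conj_zpow, hk, ← _root_.zpow_mul]
      exact ⟨k * i, rfl⟩⟩
    have hCN : (Subgroup.centralizer (Subgroup.zpowers d : Set S)).Normal := inferInstance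
    have hle : P ⊓ Subgroup.centralizer (Subgroup.zpowers d : Set S) ≤ M := by
      by_contra hcon
      obtain ⟨h, ⟨hhP, hhC⟩, hhM, ⟨j, hj⟩, hhs⟩ := exists_mem_central_quotient hS M _ hcon
      change b ^ j = h * h at hj
      have hhd : d * h = h * d := Subgroup.mem_centralizer_iff.1 hhC d (Subgroup.mem_zpowers d)
      obtain ⟨k, hk, hkd⟩ := hdk h
      have hk4 : (4 : ℤ) ∣ k - 1 := by
        have h1 : d ^ (k - 1) = 1 := by
          rw [_root_.zpow_sub_one, ← hkd, ← hhd, mul_inv_cancel_right, mul_inv_cancel]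
        have h2 := orderOf_dvd_iff_zpow_eq_one.2 h1
        rw [hd4] at h2
        exact_mod_cast h2
      obtain ⟨l, hl⟩ := hk4
      set x := b ^ (4 * l) with hx
      have hkx : h * b * h⁻¹ = b * x := by
        rw [hk, show k = 1 + 4 * l by linear_combination hl, _root_.zpow_add, zpow_one]
      have hx2 : x * x = 1 := by
        refine eq_one_of_zpow_odd hS (x * x) (i := 1 + 2 * l) ⟨l, by ring⟩ ?_
        have h1 : b ^ (k * k) = b := by
          have h2 : h * (h * b * h⁻¹) * h⁻¹ = b := by
            rw [show h * (h * b * h⁻¹) * h⁻¹ = (h * h) * b * (h * h)⁻¹ by group, ← hj,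
              hMc _ (M.zpow_mem hbM j) b hbM, mul_inv_cancel_right]
          rw [hk, ← conj_zpow, hk, ← _root_.zpow_mul] at h2
          exact h2
        have h3 : b ^ (k * k - 1) = 1 := by rw [_root_.zpow_sub_one, h1, mul_inv_cancel]
        rw [hx, ← _root_.zpow_add, ← _root_.zpow_mul, ← h3]
        congr 1
        have : k = 1 + 4 * l := by linear_combination hl
        rw [this]
        ring
      have hxe : x = e := by
        refine (hinv x (M.zpow_mem hbM _) hx2).resolve_left fun h1 => hhM (hcent h hhP ?_)
        rw [h1, mul_one, mul_inv_eq_iff_eq_mul] at hkx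
        exact hkx
      rw [hxe] at hkx
      have hconj : ∀ n : ℤ, h * b ^ n * h⁻¹ = b ^ n * e ^ n := fun n => by
        rw [← conj_zpow, hkx]
        have h1 : Commute b e := hec b
        exact h1.mul_zpow n
      have hjeven : Even j := by
        rw [← Int.not_odd_iff_even]
        intro hodd
        have h1 := hconj j
        rw [hezpow j hodd, hj, mul_assoc, mul_assoc, mul_inv_cancel, mul_one] at h1
        exact he1 (left_eq_mul.1 h1)
      obtain ⟨i, rfl⟩ := hjeven
      obtain ⟨μ, hμM, hμ⟩ : ∃ μ ∈ M, (μ * h) * (μ * h) = 1 := by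
        have h1 : (b ^ (-i) * h) * (b ^ (-i) * h) = e ^ (-i) := by
          rw [show (b ^ (-i) * h) * (b ^ (-i) * h) = b ^ (-i) * (h * b ^ (-i) * h⁻¹) * (h * h) by
            group, hconj, ← hj, mul_assoc, mul_assoc, hMc (e ^ (-i)) (M.zpow_mem heM _) _
            (M.zpow_mem hbM _), ← mul_assoc, ← mul_assoc, ← _root_.zpow_add, ← _root_.zpow_add,
            show -i + -i + (i + i) = 0 by ring, zpow_zero, one_mul]
        rcases Int.even_or_odd (-i) with hev | hod
        · exact ⟨b ^ (-i), M.zpow_mem hbM _, by rw [h1, hezpow' _ hev]⟩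
        · refine ⟨d * b ^ (-i), M.mul_mem hdM (M.zpow_mem hbM _), ?_⟩
          have h2 : (b ^ (-i) * h) * d = d * (b ^ (-i) * h) := by
            rw [mul_assoc, ← hhd, ← mul_assoc, ← mul_assoc, hMc _ (M.zpow_mem hbM _) d hdM]
          rw [mul_assoc d, mul_assoc d, ← mul_assoc _ d, h2, mul_assoc d (b ^ (-i) * h), h1,
            ← mul_assoc, hdd, hezpow _ hod, he2]
      have hzM : μ * h ∉ M := fun h1 => hhM ((Subgroup.mul_mem_cancel_left M hμM).1 h1)
      refine hno (μ * h) (P.mul_mem (hMP hμM) hhP) hμ (fun h1 => hzM (h1 ▸ M.one_mem))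
        (fun h1 => hzM (h1 ▸ heM)) fun s => ?_
      set f := s * (μ * h) * s⁻¹ * (μ * h)⁻¹ with hf
      have hfM : f ∈ M := by
        have h1 : f = (s * μ * s⁻¹) * (s * h * s⁻¹ * h⁻¹) * μ⁻¹ := by
          rw [hf]; group
        rw [h1]
        exact M.mul_mem (M.mul_mem (hMN s μ hμM) (hhs s)) (M.inv_mem hμM)
      have hfz : s * (μ * h) * s⁻¹ = f * (μ * h) := by rw [hf, inv_mul_cancel_right]
      obtain ⟨r, hr⟩ := hfM
      change b ^ r = f at hr
      have hff : f * f * e ^ r = 1 := by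
        have h1 : (s * (μ * h) * s⁻¹) * (s * (μ * h) * s⁻¹) = 1 := by
          rw [show (s * (μ * h) * s⁻¹) * (s * (μ * h) * s⁻¹) = s * ((μ * h) * (μ * h)) * s⁻¹ by group, hμ, mul_one,
              mul_inv_cancel]
        have h2 : (μ * h) * f * (μ * h)⁻¹ = f * e ^ r := by
          have h3 := hconj r
          rw [hr] at h3
          rw [show (μ * h) * f * (μ * h)⁻¹ = μ * (h * f * h⁻¹) * μ⁻¹ by group, h3,
            hMc μ hμM _ (M.mul_mem (hr ▸ M.zpow_mem hbM r) (M.zpow_mem heM r)),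
            mul_inv_cancel_right]
        rw [hfz, show f * (μ * h) * (f * (μ * h)) =
          f * ((μ * h) * f * (μ * h)⁻¹) * ((μ * h) * (μ * h)) by group, h2, hμ, mul_one,
          ← mul_assoc] at h1
        exact h1
      rw [hfz]
      rcases Int.even_or_odd r with hev | hod
      · rw [hezpow' r hev, mul_one] at hff
        rcases hinv f (hr ▸ M.zpow_mem hbM r) hff with h1 | h1
        · left; rw [h1, one_mul]
        · right; rw [h1, ← hec]
      · exfalso
        rw [hezpow r hod] at hff
        have h1 : f * f = e := by rw [← mul_left_inj e, hff, he2]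
        have h2 : (b ^ (4 : ℤ)) ^ r = 1 := by
          rw [← _root_.zpow_mul, mul_comm, _root_.zpow_mul, hr, show (4 : ℤ) = 2 + 2 by norm_num,
            _root_.zpow_add, zpow_two, h1, he2]
        have h3 := eq_one_of_zpow_odd hS _ hod h2
        rw [_root_.zpow_mul, h3, _root_.one_zpow] at hx
        exact he1 (hxe.symm.trans hx)
    intro p hp hpd
    refine hle ⟨hp, Subgroup.mem_centralizer_iff.2 ?_⟩
    rintro _ ⟨i, rfl⟩
    have h1 : Commute d p := hpd.symm
    exact (h1.zpow_left i).eq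
  have hpm : ∀ p ∈ P, p ∉ M → p * d * p⁻¹ = d⁻¹ := by
    intro p hp hpM
    obtain ⟨k, -, hk⟩ := hdk p
    have hmod : d ^ k = d ^ (k % 4) := by
      rw [← zpow_mod_orderOf, hd4]
      norm_num
    have hcases : k % 4 = 0 ∨ k % 4 = 1 ∨ k % 4 = 2 ∨ k % 4 = 3 := by omega
    rw [hk, hmod]
    rcases hcases with h | h | h | h <;> rw [h] <;> rw [hmod, h] at hk
    · exfalso
      rw [zpow_zero, mul_inv_eq_one, mul_eq_left] at hk
      rw [hk, mul_one] at hdd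
      exact he1 hdd.symm
    · exfalso
      rw [zpow_one, mul_inv_eq_iff_eq_mul] at hk
      exact hpM (hP1 p hp hk)
    · exfalso
      rw [zpow_two, hdd, mul_inv_eq_iff_eq_mul, ← hec, mul_right_inj] at hk
      rw [hk, he2] at hdd
      exact he1 hdd.symm
    · rw [eq_inv_iff_mul_eq_one, ← _root_.zpow_add_one, show (3 : ℤ) + 1 = 2 + 2 by norm_num,
        _root_.zpow_add, zpow_two, hdd, he2]
  intro p hp p' hp' hpM hpM'
  refine hP1 _ (P.mul_mem hp hp') ?_
  have h1 := hpm p hp hpM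
  have h2 := hpm p' hp' hpM'
  rw [← mul_inv_eq_iff_eq_mul, show p * p' * d * (p * p')⁻¹ = p * (p' * d * p'⁻¹) * p⁻¹ by group,
    h2, ← conj_inv, h1, inv_inv]

end TwoGroups

theorem index_le_two_of_cover {G : Type} [Group G] (N : Subgroup G) (a : G)
    (h : ∀ t, t ∈ N ∨ a⁻¹ * t ∈ N) : N.index ≤ 2 := by
  let f : Bool → G ⧸ N := fun i => if i then (a : G ⧸ N) else ((1 : G) : G ⧸ N)
  have hf : Function.Surjective f := by
    intro x
    obtain ⟨t, rfl⟩ := QuotientGroup.mk_surjective x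
    rcases h t with h | h
    · refine ⟨false, ?_⟩
      simp only [f]
      exact QuotientGroup.eq.2 (by simpa using h)
    · refine ⟨true, ?_⟩
      simp only [f]
      exact QuotientGroup.eq.2 (by simpa using h)
  have := Nat.card_le_card_of_surjective f hf
  simpa [Subgroup.index] using this

/-- The product of two subgroups, the first of which normalizes the second. -/
theorem exists_prod_subgroup {G : Type} [Group G] (P K : Subgroup G)
    (h : ∀ p ∈ P, ∀ k ∈ K, p * k * p⁻¹ ∈ K) :
    ∃ T : Subgroup G, ∀ t, t ∈ T ↔ ∃ p ∈ P, ∃ k ∈ K, t = p * k := by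
  refine ⟨{ carrier := {t | ∃ p ∈ P, ∃ k ∈ K, t = p * k}
            one_mem' := ⟨1, P.one_mem, 1, K.one_mem, (mul_one 1).symm⟩
            mul_mem' := ?_
            inv_mem' := ?_ }, fun t => Iff.rfl⟩
  · rintro _ _ ⟨p, hp, k, hk, rfl⟩ ⟨p', hp', k', hk', rfl⟩
    refine ⟨p * p', P.mul_mem hp hp', p'⁻¹ * k * p' * k', K.mul_mem ?_ hk', by group⟩
    simpa using h _ (P.inv_mem hp') k hk
  · rintro _ ⟨p, hp, k, hk, rfl⟩
    refine ⟨p⁻¹, P.inv_mem hp, p * k⁻¹ * p⁻¹, h p hp _ (K.inv_mem hk), by group⟩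

/-- Elements fixing or inverting a given element under conjugation. -/
def fixOrInvert {G : Type} [Group G] (y : G) : Subgroup G where
  carrier := {g | g * y * g⁻¹ = y ∨ g * y * g⁻¹ = y⁻¹}
  one_mem' := by simp
  mul_mem' := by
    intro a b ha hb
    have h1 : ∀ z, a * b * z * (a * b)⁻¹ = a * (b * z * b⁻¹) * a⁻¹ := fun z => by group
    have h2 : a * y⁻¹ * a⁻¹ = (a * y * a⁻¹)⁻¹ := by group
    simp only [Set.mem_ofPred_eq] at *
    rw [h1]
    rcases hb with hb | hb <;> rw [hb]
    · exact ha
    · rw [h2]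
      rcases ha with ha | ha <;> rw [ha]
      · exact Or.inr rfl
      · exact Or.inl (_root_.inv_inv y)
  inv_mem' := by
    intro a ha
    simp only [Set.mem_ofPred_eq] at *
    rcases ha with ha | ha
    · left
      nth_rw 1 [← ha]
      group
    · right
      have h2 : y = (a * y * a⁻¹)⁻¹ := by rw [ha, _root_.inv_inv]
      nth_rw 1 [h2]
      group

theorem sylow_conj_mem {G : Type} [Group G] [Finite G] (P E D : Subgroup G) (hP : IsPGroup 2 P)
    (hmax : ∀ Q : Subgroup G, IsPGroup 2 Q → Q ≤ D → P ≤ Q → Q = P) (hPE : P ≤ E) (hED : E ≤ D)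
    (τ : G) (hτ : τ ∈ E) (hτ2 : τ * τ = 1) : ∃ x ∈ E, x * τ * x⁻¹ ∈ P := by
  have : Fact (Nat.Prime 2) := ⟨Nat.prime_two⟩
  have hz : IsPGroup 2 (Subgroup.zpowers (⟨τ, hτ⟩ : E)) := by
    rintro ⟨_, i, rfl⟩
    refine ⟨1, Subtype.ext (Subtype.ext ?_)⟩
    change ((τ ^ i) ^ (2 ^ 1)) = 1
    rw [pow_one, pow_two, ← (Commute.refl τ).mul_zpow, hτ2, _root_.one_zpow]
  obtain ⟨Q1, h1⟩ := hz.exists_le_sylow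
  have hPs : IsPGroup 2 (P.subgroupOf E) := hP.of_equiv (Subgroup.subgroupOfEquivOfLe hPE).symm
  obtain ⟨Q2, h2⟩ := hPs.exists_le_sylow
  have h3 : (Q2 : Subgroup E).map E.subtype = P := by
    refine hmax _ (Q2.2.map _) ?_ ?_
    · rintro _ ⟨x, -, rfl⟩
      exact hED x.2
    · intro p hp
      exact ⟨⟨p, hPE hp⟩, h2 (by exact hp), rfl⟩
  obtain ⟨x, hx⟩ := MulAction.exists_smul_eq E Q1 Q2
  refine ⟨x, x.2, ?_⟩
  rw [← h3]
  refine ⟨x * ⟨τ, hτ⟩ * x⁻¹, ?_, rfl⟩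
  rw [← hx]
  exact Subgroup.smul_mem_pointwise_smul _ (MulAut.conj x) _ (h1 (Subgroup.mem_zpowers _))

theorem conj_inverts {G : Type} [Group G] (g x τ : G)
    (hx : ∃ k : ℤ, x⁻¹ * g * x = g ^ k) (h : τ * g * τ⁻¹ = g⁻¹) :
    (x * τ * x⁻¹) * g * (x * τ * x⁻¹)⁻¹ = g⁻¹ := by
  obtain ⟨k, hk⟩ := hx
  have h1 : τ * g ^ k * τ⁻¹ = (g ^ k)⁻¹ := by rw [← conj_zpow, h, _root_.inv_zpow]
  calc (x * τ * x⁻¹) * g * (x * τ * x⁻¹)⁻¹ = x * (τ * (x⁻¹ * g * x) * τ⁻¹) * x⁻¹ := by group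
    _ = g⁻¹ := by rw [hk, h1, ← hk]; group

theorem inverts_zpow {G : Type} [Group G] {g τ : G} (h : τ * g * τ⁻¹ = g⁻¹) {x : G}
    (hx : x ∈ Subgroup.zpowers g) : τ * x * τ⁻¹ = x⁻¹ := by
  obtain ⟨k, rfl⟩ := hx
  change τ * g ^ k * τ⁻¹ = (g ^ k)⁻¹
  rw [← conj_zpow, h, _root_.inv_zpow]

theorem mem_zpowers_mul_of_coprime {G : Type} [Group G] {y b : G} (hyb : Commute y b) {m n : ℕ}
    (hm : y ^ m = 1) (hn : b ^ n = 1) (hmn : Nat.Coprime m n) :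
    y ∈ Subgroup.zpowers (y * b) ∧ b ∈ Subgroup.zpowers (y * b) := by
  have key : ∀ {u v : G}, Commute u v → ∀ {m n : ℕ}, u ^ m = 1 → v ^ n = 1 → Nat.Coprime m n →
      u ∈ Subgroup.zpowers (u * v) := by
    intro u v huv m n hm hn hmn
    obtain ⟨k, hk1, hk2⟩ := Nat.chineseRemainder hmn 1 0
    have h1 : u ^ k = u := by
      rw [pow_eq_pow_iff_modEq.2 (hk1.of_dvd (orderOf_dvd_of_pow_eq_one hm)), pow_one]
    have h2 : v ^ k = 1 := by
      rw [pow_eq_pow_iff_modEq.2 (hk2.of_dvd (orderOf_dvd_of_pow_eq_one hn)), pow_zero]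
    refine ⟨k, ?_⟩
    change (u * v) ^ (k : ℤ) = u
    rw [zpow_natCast, huv.mul_pow, h1, h2, mul_one]
  refine ⟨key hyb hm hn hmn, ?_⟩
  rw [hyb.eq]
  exact key hyb.symm hn hm hmn.symm

theorem TotOrth.subgroupOf {G : Type} [Group G] {N T : Subgroup G} (h : TotOrth N) (hN : N ≤ T) :
    TotOrth (N.subgroupOf T) :=
  h.of_surjective (Subgroup.subgroupOfEquivOfLe hN).symm.toMonoidHom
    (Subgroup.subgroupOfEquivOfLe hN).symm.surjective

section

variable {G : Type} [Group G] [Finite G] (e : G)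

theorem noSymplectic_of_central_involution
    (hinvol : ∀ z : G, z * z = 1 → z ≠ 1 → z ≠ e → TotOrth (Subgroup.centralizer {z}))
    (hec : ∀ s, s * e = e * s) (he2 : e * e = 1)
    (z y : G) (hz2 : z * z = 1) (hz1 : z ≠ 1) (hze : z ≠ e) (hzy : z * y = y * z)
    (P : Subgroup G) (hP : ∀ s ∈ P, s * z * s⁻¹ = z ∨ s * z * s⁻¹ = z * e) :
    ∃ T : Subgroup G, NoSymplectic T ∧ y ∈ T ∧ P ≤ T := by
  have hee : e⁻¹ = e := inv_eq_of_mul_eq_one_left he2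
  have hconj : ∀ s, s * e * s⁻¹ = e := fun s => by rw [hec, mul_inv_cancel_right]
  let T : Subgroup G :=
    { carrier := {t | t * z * t⁻¹ = z ∨ t * z * t⁻¹ = z * e}
      one_mem' := by simp
      mul_mem' := by
        intro a b ha hb
        simp only [Set.mem_ofPred_eq] at *
        have h1 : a * b * z * (a * b)⁻¹ = a * (b * z * b⁻¹) * a⁻¹ := by group
        have h2 : a * (z * e) * a⁻¹ = (a * z * a⁻¹) * e := by
          rw [hec z, ← mul_assoc, hec a, hec (a * z * a⁻¹)]; group
        rw [h1]
        rcases hb with hb | hb <;> rw [hb]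
        · exact ha
        · rw [h2]
          rcases ha with ha | ha <;> rw [ha]
          · exact Or.inr rfl
          · left; rw [mul_assoc, he2, mul_one]
      inv_mem' := by
        intro a ha
        simp only [Set.mem_ofPred_eq] at *
        rcases ha with ha | ha
        · left
          nth_rw 1 [← ha]
          group
        · right
          have h2 : z = a * z * a⁻¹ * e := by rw [ha, mul_assoc, he2, mul_one]
          nth_rw 1 [h2]
          rw [hec (a * z * a⁻¹), ← mul_assoc, hec a⁻¹, hec z]
          group }
  have hT : ∀ t, t ∈ T ↔ (t * z * t⁻¹ = z ∨ t * z * t⁻¹ = z * e) := fun t => Iff.rfl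
  have hCT : Subgroup.centralizer {z} ≤ T := by
    intro t ht
    rw [Subgroup.mem_centralizer_singleton_iff] at ht
    exact (hT t).2 (Or.inl (by rw [ht, mul_inv_cancel_right]))
  refine ⟨T, ?_, ?_, fun s hs => hP s hs⟩
  · have hN := (hinvol z hz2 hz1 hze).subgroupOf hCT
    by_cases hex : ∃ a : T, (a : G) * z * (a : G)⁻¹ = z * e
    · obtain ⟨a, ha⟩ := hex
      refine NoSymplectic.of_index_le_two _ (index_le_two_of_cover _ a fun t => ?_) hN
      have hmem : ∀ t : T, t ∈ (Subgroup.centralizer {z}).subgroupOf T ↔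
          (t : G) * z * (t : G)⁻¹ = z := fun t => by
        rw [Subgroup.mem_subgroupOf, Subgroup.mem_centralizer_singleton_iff, mul_inv_eq_iff_eq_mul]
      rcases t.2 with h | h
      · exact Or.inl ((hmem t).2 h)
      · right
        rw [hmem]
        change ((a : G)⁻¹ * t) * z * ((a : G)⁻¹ * t)⁻¹ = z
        have h1 : ((a : G)⁻¹ * t) * z * ((a : G)⁻¹ * t)⁻¹ = (a : G)⁻¹ * ((t : G) * z * (t : G)⁻¹) * a := by
          group
        rw [h1, h, ← ha]
        group
    · refine NoSymplectic.of_index_le_two _ (index_le_two_of_cover _ 1 fun t => Or.inl ?_) hN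
      rw [Subgroup.mem_subgroupOf, Subgroup.mem_centralizer_singleton_iff, ← mul_inv_eq_iff_eq_mul]
      exact t.2.resolve_right fun h => hex ⟨t, h⟩
  · rw [hT]
    left
    rw [← hzy, mul_inv_cancel_right]

/-- A reality and centralizer criterion for total orthogonality. -/
theorem TotOrth.of_central_involution (hec : ∀ s, s * e = e * s) (he2 : e * e = 1)
    (hrev : ∀ g : G, ∃ τ, τ * τ = 1 ∧ τ * g * τ = g⁻¹)
    (hinvol : ∀ z : G, z * z = 1 → z ≠ 1 → z ≠ e → TotOrth (Subgroup.centralizer {z})) :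
    TotOrth G := by
  have h2p : Fact (Nat.Prime 2) := ⟨Nat.prime_two⟩
  have hsq : ∀ {τ : G}, τ * τ = 1 → τ⁻¹ = τ := fun h => inv_eq_of_mul_eq_one_left h
  refine NoSymplectic.totOrth ?_ fun g => ?_
  swap
  · obtain ⟨τ, h1, h2⟩ := hrev g
    exact isConj_iff.2 ⟨τ, by rw [hsq h1, h2]⟩
  obtain ⟨α, m, hm, hcard⟩ := Nat.exists_eq_two_pow_mul_odd (n := Nat.card G) Nat.card_pos.ne'
  refine NoSymplectic.of_local m hm ⟨α, hcard⟩ fun y hy Q hQ hQy => ?_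
  let D := fixOrInvert y
  have hD : ∀ g, g ∈ D ↔ (g * y * g⁻¹ = y ∨ g * y * g⁻¹ = y⁻¹) := fun g => Iff.rfl
  obtain ⟨P, ⟨hP, hPD, hQP⟩, hPmax⟩ := Set.exists_max_image
    {P : Subgroup G | IsPGroup 2 P ∧ P ≤ D ∧ Q ≤ P} (fun P => Nat.card P) (Set.toFinite _)
    ⟨Q, hQ, fun g hg => hQy g hg, le_rfl⟩
  have hmax : ∀ R : Subgroup G, IsPGroup 2 R → R ≤ D → P ≤ R → R = P := fun R hR hRD hPR =>
    (Subgroup.eq_of_le_of_card_ge hPR (hPmax R ⟨hR, hRD, hQP.trans hPR⟩)).symm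
  suffices ∃ T : Subgroup G, NoSymplectic T ∧ y ∈ T ∧ P ≤ T by
    obtain ⟨T, h1, h2, h3⟩ := this
    exact ⟨T, h1, h2, hQP.trans h3⟩
  have heP : e ∈ P := by
    have hn : (Subgroup.zpowers e).Normal := ⟨by
      rintro _ ⟨i, rfl⟩ g
      have h1 : Commute g e := hec g
      change g * e ^ i * g⁻¹ ∈ _
      rw [(h1.zpow_right i).eq, mul_inv_cancel_right]
      exact ⟨i, rfl⟩⟩
    have hz : IsPGroup 2 (Subgroup.zpowers e) := by
      rintro ⟨_, i, rfl⟩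
      refine ⟨1, Subtype.ext ?_⟩
      change ((e ^ i) ^ (2 ^ 1)) = 1
      rw [pow_one, pow_two, ← (Commute.refl e).mul_zpow, he2, _root_.one_zpow]
    have h1 := hmax (P ⊔ Subgroup.zpowers e) (hP.to_sup_of_normal_right hz)
      (sup_le hPD (Subgroup.zpowers_le.2 ((hD e).2 (Or.inl (by
        rw [← hec y, mul_inv_cancel_right]))))) le_sup_left
    rw [← h1]
    exact Subgroup.mem_sup_right (Subgroup.mem_zpowers e)
  by_cases hcase : ∃ z : G, z * z = 1 ∧ z ≠ 1 ∧ z ≠ e ∧ z * y = y * z ∧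
      ∀ s ∈ P, s * z * s⁻¹ = z ∨ s * z * s⁻¹ = z * e
  · obtain ⟨z, hz2, hz1, hze, hzy, hzP⟩ := hcase
    exact noSymplectic_of_central_involution e hinvol hec he2 z y hz2 hz1 hze hzy P hzP
  let P0 : Subgroup P := (Subgroup.centralizer {y}).subgroupOf P
  have hP0 : ∀ x : P, x ∈ P0 ↔ (x : G) * y = y * x := fun x => by
    rw [Subgroup.mem_subgroupOf, Subgroup.mem_centralizer_singleton_iff]
  have hP0n : P0.Normal := ⟨fun x hx s => by
    rw [hP0] at hx ⊢
    have hs := (hD _).1 (hPD (P.inv_mem s.2))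
    have h1 : (s : G)⁻¹ * y * s * x = x * ((s : G)⁻¹ * y * s) := by
      rw [_root_.inv_inv] at hs
      have hx' : Commute (x : G) y := hx
      rcases hs with hs | hs <;> rw [hs]
      · exact hx'.eq.symm
      · exact (hx'.inv_right).eq.symm
    change (s : G) * x * (s : G)⁻¹ * y = y * ((s : G) * x * (s : G)⁻¹)
    calc (s : G) * x * (s : G)⁻¹ * y = s * (x * ((s : G)⁻¹ * y * s)) * (s : G)⁻¹ := by group
      _ = _ := by rw [← h1]; group⟩
  obtain ⟨b, hbP0, hbn, hbidx⟩ := exists_cyclic_of_no_involution hP P0 ⟨e, heP⟩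
    ((hP0 _).2 (hec y).symm) (fun s => Subtype.ext (hec s)) (Subtype.ext he2)
    (fun z hz hz2 hz1 hze hzs => hcase ⟨z, congrArg Subtype.val hz2,
      fun h => hz1 (Subtype.ext h), fun h => hze (Subtype.ext h), (hP0 z).1 hz, fun s hs =>
        (hzs ⟨s, hs⟩).imp (congrArg Subtype.val) (congrArg Subtype.val)⟩)
  have hyb : Commute y b := ((hP0 b).1 hbP0).symm
  obtain ⟨k, hk⟩ := hP b
  have hk' : (b : G) ^ 2 ^ k = 1 := congrArg Subtype.val hk
  obtain ⟨hyg, hbg⟩ := mem_zpowers_mul_of_coprime hyb hy hk'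
    ((Nat.Coprime.pow_left k (Nat.coprime_two_left.2 hm)).symm)
  set g : G := y * b with hg
  have hbconj : ∀ s ∈ P, s * b * s⁻¹ ∈ Subgroup.zpowers (b : G) := fun s hs => by
    obtain ⟨i, hi⟩ := hbn.conj_mem b (Subgroup.mem_zpowers b) ⟨s, hs⟩
    exact ⟨i, congrArg Subtype.val hi⟩
  obtain ⟨τ, hτ2, hτg⟩ := hrev g
  have hτg' : τ * g * τ⁻¹ = g⁻¹ := by rw [hsq hτ2, hτg]
  let E : Subgroup G := Subgroup.normalizer (Subgroup.zpowers (b : G) : Set G) ⊓ D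
  have hτE : τ ∈ E := by
    refine ⟨?_, (hD τ).2 (Or.inr (inverts_zpow hτg' hyg))⟩
    have h1 := inverts_zpow hτg' hbg
    refine Subgroup.mem_normalizer_iff.2 fun x => ?_
    constructor
    · intro hx
      rw [inverts_zpow h1 hx]
      exact Subgroup.inv_mem _ hx
    · intro hx
      have h2 := inverts_zpow h1 hx
      have h3 : τ * (τ * x * τ⁻¹) * τ⁻¹ = x := by
        rw [hsq hτ2, show τ * (τ * x * τ) * τ = (τ * τ) * x * (τ * τ) by group, hτ2]; group
      rw [← h3, h2]
      exact Subgroup.inv_mem _ hx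
  have hPn : ∀ s ∈ P, ∀ x ∈ Subgroup.zpowers (b : G), s * x * s⁻¹ ∈ Subgroup.zpowers (b : G) := by
    rintro s hs _ ⟨i, rfl⟩
    change s * (b : G) ^ i * s⁻¹ ∈ _
    rw [← conj_zpow]
    exact Subgroup.zpow_mem _ (hbconj s hs) i
  have hPE : P ≤ E := by
    refine le_inf (fun s hs => ?_) hPD
    rw [Subgroup.mem_normalizer_iff]
    refine fun x => ⟨fun hx => hPn s hs x hx, fun hx => ?_⟩
    have := hPn s⁻¹ (P.inv_mem hs) _ hx
    rwa [show s⁻¹ * (s * x * s⁻¹) * s⁻¹⁻¹ = x by group] at this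
  obtain ⟨x, hxE, hxP⟩ := sylow_conj_mem P E D hP hmax hPE inf_le_right τ hτE hτ2
  set σ := x * τ * x⁻¹ with hσ
  have hσ2 : σ * σ = 1 := by
    rw [hσ, show x * τ * x⁻¹ * (x * τ * x⁻¹) = x * (τ * τ) * x⁻¹ by group, hτ2, mul_one,
      mul_inv_cancel]
  have hσy : σ * y * σ⁻¹ = y⁻¹ := by
    refine conj_inverts y x τ ?_ (inverts_zpow hτg' hyg)
    rcases (hD _).1 (D.inv_mem hxE.2) with h | h <;> rw [_root_.inv_inv] at h
    · exact ⟨1, by rw [h, zpow_one]⟩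
    · exact ⟨-1, by rw [h, _root_.zpow_neg_one]⟩
  have hσb : σ * b * σ⁻¹ = (b : G)⁻¹ := by
    refine conj_inverts _ x τ ?_ (inverts_zpow hτg' hbg)
    have h1 := (Subgroup.mem_normalizer_iff.1 (Subgroup.inv_mem _ hxE.1) (b : G)).1
      (Subgroup.mem_zpowers _)
    obtain ⟨i, hi⟩ := h1
    rw [_root_.inv_inv] at hi
    exact ⟨i, hi.symm⟩
  have hσg : σ * g * σ⁻¹ = g⁻¹ := by
    rw [hg, show σ * (y * b) * σ⁻¹ = (σ * y * σ⁻¹) * (σ * b * σ⁻¹) by group, hσy, hσb,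
      _root_.mul_inv_rev, (hyb.inv_inv).eq]
  have hgP : ∀ p ∈ P, ∀ k ∈ Subgroup.zpowers g, p * k * p⁻¹ ∈ Subgroup.zpowers g := by
    rintro p hp _ ⟨i, rfl⟩
    change p * g ^ i * p⁻¹ ∈ _
    rw [← conj_zpow]
    refine Subgroup.zpow_mem _ ?_ i
    rw [hg, show p * (y * b) * p⁻¹ = (p * y * p⁻¹) * (p * b * p⁻¹) by group]
    refine Subgroup.mul_mem _ ?_ (Subgroup.zpowers_le.2 hbg (hbconj p hp))
    rcases (hD p).1 (hPD hp) with h | h <;> rw [h]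
    · exact hyg
    · exact Subgroup.inv_mem _ hyg
  obtain ⟨T, hT⟩ := exists_prod_subgroup P (Subgroup.zpowers g) hgP
  obtain ⟨N, hN⟩ := exists_prod_subgroup (Subgroup.zpowers σ) (Subgroup.zpowers g)
    (fun p hp => hgP p (Subgroup.zpowers_le.2 hxP hp))
  have hNT : N ≤ T := fun t ht => by
    obtain ⟨p, hp, k, hk, rfl⟩ := (hN t).1 ht
    exact (hT _).2 ⟨p, Subgroup.zpowers_le.2 hxP hp, k, hk, rfl⟩
  have hPT : P ≤ T := fun p hp => (hT p).2 ⟨p, hp, 1, Subgroup.one_mem _, (mul_one p).symm⟩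
  have hgT : Subgroup.zpowers g ≤ T := fun p hp => (hT p).2 ⟨1, P.one_mem, p, hp, (one_mul p).symm⟩
  have hgN : Subgroup.zpowers g ≤ N := fun p hp =>
    (hN p).2 ⟨1, Subgroup.one_mem _, p, hp, (one_mul p).symm⟩
  have hσN : σ ∈ N := (hN σ).2 ⟨σ, Subgroup.mem_zpowers σ, 1, Subgroup.one_mem _, (mul_one σ).symm⟩
  refine ⟨T, ?_, hgT hyg, hPT⟩
  have hNorth : TotOrth N := by
    refine TotOrth.dihedral ⟨g, hgN (Subgroup.mem_zpowers g)⟩ ⟨σ, hσN⟩ (Subtype.ext hσ2)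
      (Subtype.ext (by rw [hsq hσ2] at hσg; exact hσg)) fun t => ?_
    obtain ⟨p, hp, k, hk, h⟩ := (hN t).1 t.2
    have hσp : p = 1 ∨ p = σ := by
      have h3 : IsOfFinOrder σ := isOfFinOrder_of_finite σ
      obtain ⟨i, hi⟩ := h3.mem_zpowers_iff_mem_range_orderOf.1 hp |> Finset.mem_image.1
      have h4 : orderOf σ ≤ 2 := orderOf_le_of_pow_eq_one two_pos (by rw [pow_two, hσ2])
      have h5 := Finset.mem_range.1 hi.1
      have h6 : i = 0 ∨ i = 1 := by omega
      rcases h6 with rfl | rfl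
      · left; rw [← hi.2, pow_zero]
      · right; rw [← hi.2, pow_one]
    have hpow : ∀ k ∈ Subgroup.zpowers g, ∃ i : ℕ, k = g ^ i := fun k hk => by
      obtain ⟨i, hi⟩ := (mem_powers_iff_mem_zpowers.2 hk)
      exact ⟨i, hi.symm⟩
    rcases hσp with rfl | rfl
    · obtain ⟨i, hi⟩ := hpow k hk
      exact ⟨i, Or.inl (Subtype.ext (by rw [h, one_mul, hi]; rfl))⟩
    · obtain ⟨i, hi⟩ := hpow k⁻¹ (Subgroup.inv_mem _ hk)
      refine ⟨i, Or.inr (Subtype.ext ?_)⟩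
      have h7 := inverts_zpow hσg hk
      change (t : G) = g ^ i * σ
      rw [h, ← hi, ← h7, inv_mul_cancel_right]
  obtain ⟨a, haP, ha⟩ : ∃ a ∈ P, ∀ x : P, x ∈ P0 → (x : G) ∈ N ∨ a⁻¹ * x ∈ N := by
    have hbN : ∀ u : P, u ∈ Subgroup.zpowers b → (u : G) ∈ N := by
      rintro _ ⟨i, rfl⟩
      exact hgN (Subgroup.zpow_mem _ hbg i)
    by_cases hle : P0 ≤ Subgroup.zpowers b
    · exact ⟨1, P.one_mem, fun x hx => Or.inl (hbN x (hle hx))⟩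
    · obtain ⟨p, hp, hpb⟩ := Set.not_subset.1 hle
      refine ⟨(p : G)⁻¹, P.inv_mem p.2, fun x hx => ?_⟩
      by_cases hxb : x ∈ Subgroup.zpowers b
      · exact Or.inl (hbN x hxb)
      · right
        rw [_root_.inv_inv]
        exact hbN (p * x) (hbidx p hp x hx hpb hxb)
  have hcov : ∀ p ∈ P, p ∈ N ∨ a⁻¹ * p ∈ N := by
    intro p hp
    rcases (hD p).1 (hPD hp) with h | h
    · exact ha ⟨p, hp⟩ ((hP0 _).2 (mul_inv_eq_iff_eq_mul.1 h))
    · have h1 : (⟨p * σ, P.mul_mem hp hxP⟩ : P) ∈ P0 := by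
        rw [hP0, ← mul_inv_eq_iff_eq_mul]
        change p * σ * y * (p * σ)⁻¹ = y
        rw [show p * σ * y * (p * σ)⁻¹ = p * (σ * y * σ⁻¹) * p⁻¹ by group, hσy,
          show p * y⁻¹ * p⁻¹ = (p * y * p⁻¹)⁻¹ by group, h, _root_.inv_inv]
      have h2 : p = p * σ * σ := by rw [mul_assoc, hσ2, mul_one]
      rw [h2]
      refine (ha _ h1).imp (fun h3 => N.mul_mem h3 hσN) fun h3 => ?_
      rw [← mul_assoc]
      exact N.mul_mem h3 hσN
  refine NoSymplectic.of_index_le_two _ (index_le_two_of_cover _ ⟨a, hPT haP⟩ fun t => ?_)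
    (hNorth.subgroupOf hNT)
  obtain ⟨p, hp, k, hk, h⟩ := (hT t).1 t.2
  refine (hcov p hp).imp (fun h1 => ?_) fun h1 => ?_
  · rw [Subgroup.mem_subgroupOf, h]
    exact N.mul_mem h1 (hgN hk)
  · rw [Subgroup.mem_subgroupOf]
    change a⁻¹ * (t : G) ∈ N
    rw [h, ← mul_assoc]
    exact N.mul_mem h1 (hgN hk)

end

section

variable {F V : Type} [Field F] [AddCommGroup V] [Module F V]

theorem finite_isoGroup [Finite F] [FiniteDimensional F V] (B : V →ₗ[F] V →ₗ[F] F) :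
    Finite (isoGroup B) := by
  have : Finite V := Module.finite_of_finite F
  have : Finite (Module.End F V) := Finite.of_injective (fun f : V →ₗ[F] V => (f : V → V))
    DFunLike.coe_injective
  infer_instance

theorem exists_rev [FiniteDimensional F V] (h2 : (2 : F) ≠ 0) {B : V →ₗ[F] V →ₗ[F] F}
    (hs : ∀ x y, B x y = B y x) (hB : NonDegOn B ⊤) (g : isoGroup B) :
    ∃ τ : isoGroup B, τ * τ = 1 ∧ τ * g * τ = g⁻¹ := by
  obtain ⟨τ, h1, h3, h4⟩ := rev_of_mem_isoGroup h2 hs hB g.2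
  exact ⟨⟨τ, h1⟩, Subtype.ext h3, Subtype.ext h4⟩

/-- The isometry of an orthogonal direct sum assembled from isometries of the summands. -/
def glueHom (B : V →ₗ[F] V →ₗ[F] F) (U W : Submodule F V) (hc : IsCompl U W) :
    isoGroup (resForm B U) × isoGroup (resForm B W) →* Module.End F V where
  toFun p := (U.prodEquivOfIsCompl W hc).toLinearMap ∘ₗ
    (LinearMap.prodMap p.1.1.1 p.2.1.1) ∘ₗ (U.prodEquivOfIsCompl W hc).symm.toLinearMap
  map_one' := by
    ext x
    exact (U.prodEquivOfIsCompl W hc).apply_symm_apply x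
  map_mul' a b := by
    ext x
    simp only [LinearMap.comp_apply, Module.End.mul_apply, LinearEquiv.coe_coe,
      LinearEquiv.symm_apply_apply]
    rfl

theorem glueHom_apply (B : V →ₗ[F] V →ₗ[F] F) (U W : Submodule F V) (hc : IsCompl U W)
    (p : isoGroup (resForm B U) × isoGroup (resForm B W)) (u : U) (w : W) :
    glueHom B U W hc p ((u : V) + w) = (p.1.1.1 u : V) + (p.2.1.1 w : V) := by
  have h1 : (U.prodEquivOfIsCompl W hc).symm ((u : V) + w) = (u, w) := by
    rw [LinearEquiv.symm_apply_eq]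
    rfl
  change (U.prodEquivOfIsCompl W hc) (LinearMap.prodMap p.1.1.1 p.2.1.1
    ((U.prodEquivOfIsCompl W hc).symm ((u : V) + w))) = _
  rw [h1]
  rfl

theorem exists_add_of_isCompl {U W : Submodule F V} (hc : IsCompl U W) (x : V) :
    ∃ (u : U) (w : W), x = u + w := by
  obtain ⟨a, ha, b, hb, h⟩ := Submodule.mem_sup.1 (hc.sup_eq_top ▸ Submodule.mem_top : x ∈ U ⊔ W)
  exact ⟨⟨a, ha⟩, ⟨b, hb⟩, h.symm⟩

theorem TotOrth.centralizer_of_eigenspaces [Finite F] [FiniteDimensional F V] (h2 : (2 : F) ≠ 0)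
    {B : V →ₗ[F] V →ₗ[F] F} (hs : ∀ x y, B x y = B y x) (hB : NonDegOn B ⊤)
    (ih : ∀ U : Submodule F V, U ≠ ⊤ → NonDegOn B U → TotOrth (isoGroup (resForm B U)))
    (z : isoGroup B) (hz : z * z = 1) (hz1 : z ≠ 1) (hze : ¬ ∀ x, z.1.1 x = -x) :
    TotOrth (Subgroup.centralizer {z}) := by
  have hzz : ∀ x, z.1.1 (z.1.1 x) = x := fun x => by
    have := congrArg (fun g : isoGroup B => g.1.1 x) hz
    exact this
  let U : Submodule F V := LinearMap.ker (z.1.1 - 1)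
  let W : Submodule F V := LinearMap.ker (z.1.1 + 1)
  have hU : ∀ x, x ∈ U ↔ z.1.1 x = x := fun x => by
    rw [LinearMap.mem_ker, LinearMap.sub_apply, Module.End.one_apply, sub_eq_zero]
  have hW : ∀ x, x ∈ W ↔ z.1.1 x = -x := fun x => by
    rw [LinearMap.mem_ker, LinearMap.add_apply, Module.End.one_apply, add_eq_zero_iff_eq_neg]
  have hort : ∀ x ∈ U, ∀ y ∈ W, B x y = 0 := fun x hx y hy => by
    have h1 := z.2 x y
    rw [(hU x).1 hx, (hW y).1 hy, map_neg] at h1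
    have h3 : (2 : F) * B x y = 0 := by linear_combination -h1
    exact (mul_eq_zero.1 h3).resolve_left h2
  have hdec : ∀ x, ∃ u ∈ U, ∃ w ∈ W, x = u + w := fun x => by
    refine ⟨(2 : F)⁻¹ • (x + z.1.1 x), ?_, (2 : F)⁻¹ • (x - z.1.1 x), ?_, ?_⟩
    · rw [hU, map_smul, map_add, hzz, add_comm]
    · rw [hW, map_smul, map_sub, hzz, ← smul_neg, neg_sub]
    · rw [← smul_add, add_add_sub_cancel, ← two_smul F x, smul_smul, inv_mul_cancel₀ h2, one_smul]
  have hc : IsCompl U W := by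
    refine ⟨Submodule.disjoint_def.2 fun x hx hx' => ?_, codisjoint_iff.2 (eq_top_iff.2 ?_)⟩
    · rw [hU] at hx
      rw [hW, hx] at hx'
      have h3 : (2 : F) • x = 0 := by rw [two_smul]; nth_rw 1 [hx']; rw [neg_add_cancel]
      exact (smul_eq_zero.1 h3).resolve_left h2
    · intro x _
      obtain ⟨u, hu, w, hw, rfl⟩ := hdec x
      exact Submodule.add_mem_sup hu hw
  have hUn : NonDegOn B U := fun x hx hx' => hB x trivial fun y _ => by
    obtain ⟨u, hu, w, hw, rfl⟩ := hdec y
    rw [map_add, hx' u hu, hort x hx w hw, add_zero]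
  have hWn : NonDegOn B W := fun x hx hx' => hB x trivial fun y _ => by
    obtain ⟨u, hu, w, hw, rfl⟩ := hdec y
    rw [map_add, hx' w hw, hs, hort u hu x hx, add_zero]
  have hUt : U ≠ ⊤ := fun h => hz1 (Subtype.ext (Units.ext (LinearMap.ext fun x =>
    (hU x).1 (h ▸ trivial))))
  have hWt : W ≠ ⊤ := fun h => hze fun x => (hW x).1 (h ▸ trivial)
  have hUo := ih U hUt hUn
  have hWo := ih W hWt hWn
  have := finite_isoGroup (resForm B U)
  have := finite_isoGroup (resForm B W)
  have hprod : TotOrth (isoGroup (resForm B U) × isoGroup (resForm B W)) := by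
    refine (NoSymplectic.prod hUo hWo.noSymplectic).totOrth fun g => ?_
    obtain ⟨a, ha, hag⟩ := exists_rev (B := resForm B U) h2 (fun x y => hs x y) hUn.resForm_top g.1
    obtain ⟨b, hb, hbg⟩ := exists_rev (B := resForm B W) h2 (fun x y => hs x y) hWn.resForm_top g.2
    refine isConj_iff.2 ⟨(a, b), Prod.ext ?_ ?_⟩
    · change a * g.1 * a⁻¹ = g.1⁻¹
      rw [inv_eq_of_mul_eq_one_left ha, hag]
    · change b * g.2 * b⁻¹ = g.2⁻¹
      rw [inv_eq_of_mul_eq_one_left hb, hbg]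
  let f1 : isoGroup (resForm B U) × isoGroup (resForm B W) →* isoGroup B :=
    (glueHom B U W hc).toHomUnits.codRestrict (isoGroup B) fun p x y => by
      obtain ⟨u, w, rfl⟩ := exists_add_of_isCompl hc x
      obtain ⟨u', w', rfl⟩ := exists_add_of_isCompl hc y
      change B (glueHom B U W hc p _) (glueHom B U W hc p _) = _
      rw [glueHom_apply, glueHom_apply]
      simp only [map_add, LinearMap.add_apply]
      have e1 : B (p.1.1.1 u : V) (p.1.1.1 u' : V) = B u u' := p.1.2 u u'
      have e2 : B (p.2.1.1 w : V) (p.2.1.1 w' : V) = B w w' := p.2.2 w w'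
      rw [e1, e2, hort _ (p.1.1.1 u).2 _ (p.2.1.1 w').2, hs _ (p.1.1.1 u' : V),
        hort _ (p.1.1.1 u').2 _ (p.2.1.1 w).2, hort _ u.2 _ w'.2, hs w (u' : V),
        hort _ u'.2 _ w.2]
  have hf1 : ∀ p (u : U) (w : W), (f1 p).1.1 ((u : V) + w) = (p.1.1.1 u : V) + (p.2.1.1 w : V) :=
    glueHom_apply B U W hc
  refine hprod.of_surjective (f1.codRestrict (Subgroup.centralizer {z}) fun p => ?_) fun c => ?_
  · rw [Subgroup.mem_centralizer_singleton_iff]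
    refine Subtype.ext (Units.ext (LinearMap.ext fun x => ?_))
    obtain ⟨u, w, rfl⟩ := exists_add_of_isCompl hc x
    change (f1 p).1.1 (z.1.1 (u + w)) = z.1.1 ((f1 p).1.1 (u + w))
    have := hf1 p u (-w)
    rw [map_neg] at this
    have hz' : ∀ (a : U) (b : W), z.1.1 ((a : V) + b) = a + -b := fun a b => by
      rw [map_add, (hU _).1 a.2, (hW _).1 b.2]
    rw [hf1, hz', hz']
    exact this
  · have hcz : ∀ x, z.1.1 (c.1.1.1 x) = c.1.1.1 (z.1.1 x) := fun x => by
      have h1 := Subgroup.mem_centralizer_singleton_iff.1 c.2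
      exact (congrArg (fun g : isoGroup B => g.1.1 x) h1).symm
    have hcz' : ∀ x, z.1.1 (c.1.1⁻¹.1 x) = c.1.1⁻¹.1 (z.1.1 x) := fun x => by
      have h1 := Subgroup.mem_centralizer_singleton_iff.1 (Subgroup.inv_mem _ c.2)
      exact (congrArg (fun g : isoGroup B => g.1.1 x) h1).symm
    have hcU : UStable c.1.1 U := ⟨fun x hx => by rw [hU, hcz, (hU x).1 hx],
      fun x hx => by rw [hU, hcz', (hU x).1 hx]⟩
    have hcW : UStable c.1.1 W := ⟨fun x hx => by rw [hW, hcz, (hW x).1 hx, map_neg],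
      fun x hx => by rw [hW, hcz', (hW x).1 hx, map_neg]⟩
    refine ⟨(⟨_, resUnit_mem_isoGroup c.1.2 U hcU⟩, ⟨_, resUnit_mem_isoGroup c.1.2 W hcW⟩),
      Subtype.ext (Subtype.ext (Units.ext (LinearMap.ext fun x => ?_)))⟩
    obtain ⟨u, w, rfl⟩ := exists_add_of_isCompl hc x
    exact (hf1 _ u w).trans (map_add c.1.1.1 (u : V) w).symm

/-- Total orthogonality of orthogonal groups over finite fields of odd characteristic. -/
theorem totOrth_isoGroup_aux [Finite F] (h2 : (2 : F) ≠ 0) (n : ℕ) : ∀ (V : Type) [AddCommGroup V]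
    [Module F V] [FiniteDimensional F V] (B : V →ₗ[F] V →ₗ[F] F), Module.finrank F V = n →
    (∀ x y, B x y = B y x) → NonDegOn B ⊤ → TotOrth (isoGroup B) := by
  induction n using Nat.strong_induction_on with
  | _ n ih =>
  intro V _ _ _ B hn hs hB
  have := finite_isoGroup B
  let e : isoGroup B := ⟨-1, fun x y => by
    change B (-x) (-y) = B x y
    rw [map_neg, map_neg, LinearMap.neg_apply, _root_.neg_neg]⟩
  refine TotOrth.of_central_involution e (fun s => Subtype.ext ?_) (Subtype.ext ?_)
    (exists_rev h2 hs hB) fun z hz hz1 hze => ?_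
  · change s.1 * -1 = -1 * s.1
    rw [mul_neg_one, neg_one_mul]
  · change (-1 : (Module.End F V)ˣ) * -1 = 1
    rw [neg_one_mul, _root_.neg_neg]
  · refine TotOrth.centralizer_of_eigenspaces h2 hs hB (fun U hU hUn => ?_) z hz hz1 fun h => hze ?_
    · exact ih _ (hn ▸ Submodule.finrank_lt hU) U (resForm B U) rfl
        (fun x y => hs x y) hUn.resForm_top
    · exact Subtype.ext (Units.ext (LinearMap.ext h))

theorem totOrth_isoGroup [Finite F] [FiniteDimensional F V] (h2 : (2 : F) ≠ 0)
    (B : V →ₗ[F] V →ₗ[F] F) (hs : ∀ x y, B x y = B y x) (hB : NonDegOn B ⊤) :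
    TotOrth (isoGroup B) := totOrth_isoGroup_aux h2 _ V B rfl hs hB

end

section Bridge

variable {G : Type} [Group G] [Finite G]

theorem irr_of_simple (V : FDRep ℂ G) [Simple V] : Irr V.ρ := by
  have := Fintype.ofFinite G
  have hc : (Nat.card G : ℂ) ≠ 0 := Nat.cast_ne_zero.2 Nat.card_pos.ne'
  have := NeZero.mk hc
  have h := (FDRep.simple_iff_char_is_norm_one V).1 inferInstance
  let _ : Invertible (Nat.card G : ℂ) := invertibleOfNonzero hc
  have h1 := Representation.card_inv_mul_sum_char_mul_char_eq_finrank V.ρ V.ρ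
  have h2 : ∑ g : G, Representation.character V.ρ g * Representation.character V.ρ g⁻¹ = Nat.card G := h
  rw [h2, inv_mul_cancel₀ hc] at h1
  have h3 : Module.finrank ℂ (Representation.IntertwiningMap V.ρ V.ρ) = 1 := by
    exact_mod_cast h1.symm
  have hV : Nontrivial V := by
    by_contra hV
    rw [not_nontrivial_iff_subsingleton] at hV
    refine hc (h2.symm.trans (Finset.sum_eq_zero fun g _ => ?_))
    have : Representation.character V.ρ g = 0 := by
      rw [Representation.character, Subsingleton.elim (V.ρ g) 0, map_zero]
    rw [this, zero_mul]
  refine ⟨hV, fun p hp => ?_⟩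
  obtain ⟨f, hf1, hf2⟩ := exists_proj p hp
  let F : Representation.IntertwiningMap V.ρ V.ρ :=
    ⟨p.subtype ∘ₗ f, fun g => LinearMap.ext fun x => congrArg Subtype.val (hf2 g x)⟩
  have hid : (Representation.IntertwiningMap.id V.ρ) ≠ 0 := fun h0 => by
    obtain ⟨x, hx⟩ := exists_ne (0 : V)
    exact hx (congrArg (fun T : Representation.IntertwiningMap V.ρ V.ρ => T.toLinearMap x) h0)
  obtain ⟨c, hcF⟩ := (finrank_eq_one_iff_of_nonzero' _ hid).1 h3 F
  have hF : ∀ x : V, c • x = f x := fun x =>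
    congrArg (fun T : Representation.IntertwiningMap V.ρ V.ρ => T.toLinearMap x) hcF
  by_cases hc0 : c = 0
  · left
    rw [Submodule.eq_bot_iff]
    intro x hx
    have := hF x
    rw [hc0, zero_smul, hf1 ⟨x, hx⟩] at this
    exact this.symm
  · right
    rw [eq_top_iff]
    intro x _
    rw [← Submodule.smul_mem_iff p hc0, hF]
    exact (f x).2

theorem Irr.simple {W : Type} [AddCommGroup W] [Module ℂ W] [FiniteDimensional ℂ W]
    {ρ : Representation ℂ G W} (hρ : Irr ρ) : Simple (FDRep.of ρ) := by
  have := Fintype.ofFinite G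
  have hc : (Nat.card G : ℂ) ≠ 0 := Nat.cast_ne_zero.2 Nat.card_pos.ne'
  have := NeZero.mk hc
  refine (FDRep.simple_iff_char_is_norm_one (FDRep.of ρ)).2 ?_
  have h := sum_char_mul_char_inv hρ
  rw [← Nat.card_eq_fintype_card] at h
  exact h

open scoped ComplexOrder in
theorem char_inv_eq_star {W : Type*} [AddCommGroup W] [Module ℂ W] [FiniteDimensional ℂ W]
    (ρ : Representation ℂ G W) (g : G) : ρ.character g⁻¹ = star (ρ.character g) := by
  have := Fintype.ofFinite G
  let b := Module.finBasis ℂ W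
  let A : G → Matrix _ _ ℂ := fun g => LinearMap.toMatrix b b (ρ g)
  have hA : ∀ g h, A (g * h) = A g * A h := fun g h => by
    simp only [A, map_mul, LinearMap.toMatrix_mul]
  have hA1 : A 1 = 1 := by simp only [A, map_one, LinearMap.toMatrix_one]
  have htr : ∀ g, ρ.character g = (A g).trace := fun g =>
    LinearMap.trace_eq_matrix_trace ℂ b (ρ g)
  let M := ∑ h, (A h)ᴴ * A h
  have hM : M.PosDef := by
    have h1 : M = 1 + ∑ h ∈ Finset.univ.erase 1, (A h)ᴴ * A h := by
      change ∑ h, (A h)ᴴ * A h = _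
      rw [← Finset.add_sum_erase _ _ (Finset.mem_univ (1 : G)), hA1]
      simp
    rw [h1]
    exact Matrix.PosDef.one.add_posSemidef (Matrix.posSemidef_sum _ fun h _ =>
      Matrix.posSemidef_conjTranspose_mul_self _)
  have hinv : (A g)ᴴ * M * A g = M := by
    simp only [M, Finset.mul_sum, Finset.sum_mul]
    refine Fintype.sum_equiv (Equiv.mulRight g) _ _ fun h => ?_
    simp only [Equiv.coe_mulRight, hA, Matrix.conjTranspose_mul, Matrix.mul_assoc]
  have hMu : IsUnit M.det := (Matrix.isUnit_iff_isUnit_det _).1 hM.isUnit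
  have h2 : A g * A g⁻¹ = 1 := by rw [← hA, mul_inv_cancel, hA1]
  have h3 : (A g)ᴴ * M = M * A g⁻¹ := by
    calc (A g)ᴴ * M = (A g)ᴴ * M * (A g * A g⁻¹) := by rw [h2, Matrix.mul_one]
      _ = ((A g)ᴴ * M * A g) * A g⁻¹ := by simp only [Matrix.mul_assoc]
      _ = M * A g⁻¹ := by rw [hinv]
  have h4 : A g⁻¹ = M⁻¹ * ((A g)ᴴ * M) := by
    rw [h3, ← Matrix.mul_assoc, Matrix.nonsing_inv_mul _ hMu, Matrix.one_mul]
  rw [htr, htr, h4, Matrix.trace_mul_comm, Matrix.mul_assoc, Matrix.mul_nonsing_inv _ hMu,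
    Matrix.mul_one, Matrix.trace_conjTranspose]

end Bridge

section Regular

variable {G : Type} [Group G] [Fintype G]

/-- A class function orthogonal to all irreducible characters vanishes. -/
theorem classFunction_eq_zero (h : G → ℂ) (hcl : ∀ a g, h (a * g * a⁻¹) = h g)
    (hort : ∀ (W : Type) [AddCommGroup W] [Module ℂ W] [FiniteDimensional ℂ W]
      (ρ : Representation ℂ G W), Irr ρ → ∑ g, h g * ρ.character g⁻¹ = 0) : h = 0 := by
  have hop : ∀ (W : Type) [AddCommGroup W] [Module ℂ W] (ρ : Representation ℂ G W) (a : G) (x : W),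
      ρ a ((∑ g, h g • ρ g⁻¹) x) = (∑ g, h g • ρ g⁻¹) (ρ a x) := by
    intro W _ _ ρ a x
    simp only [LinearMap.sum_apply, LinearMap.smul_apply, map_sum, map_smul]
    refine Fintype.sum_equiv (MulAut.conj a).toEquiv _ _ fun g => ?_
    simp only [MulEquiv.toEquiv_eq_coe, MulEquiv.coe_toEquiv, MulAut.conj_apply, hcl,
      ← rep_mul]
    congr 3
    group
  have hirr : ∀ (W : Type) [AddCommGroup W] [Module ℂ W] [FiniteDimensional ℂ W]
      (ρ : Representation ℂ G W), Irr ρ → ∀ x, (∑ g, h g • ρ g⁻¹) x = 0 := by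
    intro W _ _ _ ρ hρ
    have := hρ.nontrivial
    obtain ⟨c, hc⟩ := Module.End.exists_eigenvalue (∑ g, h g • ρ g⁻¹ : Module.End ℂ W)
    have hst : Stable ρ (Module.End.eigenspace (∑ g, h g • ρ g⁻¹ : Module.End ℂ W) c) := by
      intro a x hx
      rw [Module.End.mem_eigenspace_iff] at hx ⊢
      rw [← hop, hx, map_smul]
    have htop := (hρ.eq_bot_or_top _ hst).resolve_left hc
    have hall : ∀ x, (∑ g, h g • ρ g⁻¹) x = c • x := fun x =>
      Module.End.mem_eigenspace_iff.1 (htop ▸ Submodule.mem_top)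
    have htr : LinearMap.trace ℂ W (∑ g, h g • ρ g⁻¹) = 0 := by
      rw [map_sum, ← hort W ρ hρ]
      exact Finset.sum_congr rfl fun g _ => by rw [map_smul, smul_eq_mul]; rfl
    have heq : (∑ g, h g • ρ g⁻¹) = c • (LinearMap.id : W →ₗ[ℂ] W) := LinearMap.ext hall
    rw [heq, map_smul, LinearMap.trace_id, smul_eq_mul, mul_eq_zero] at htr
    rcases htr with h0 | h0
    · intro x; rw [hall, h0, zero_smul]
    · exact absurd h0 (Nat.cast_ne_zero.2 Module.finrank_pos.ne')
  have hgen : ∀ (W : Type) [AddCommGroup W] [Module ℂ W] [FiniteDimensional ℂ W]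
      (ρ : Representation ℂ G W) (x : W), (∑ g, h g • ρ g⁻¹) x = 0 := by
    intro W _ _ _ ρ x
    have hst : Stable ρ (LinearMap.ker (∑ g, h g • ρ g⁻¹)) := by
      intro a x hx
      rw [LinearMap.mem_ker] at hx ⊢
      rw [← hop, hx, map_zero]
    obtain ⟨q, hq, hc⟩ := exists_compl _ hst
    by_cases hq0 : q = ⊥
    · have := hc.sup_eq_top
      rw [hq0, sup_bot_eq] at this
      exact LinearMap.mem_ker.1 (this ▸ Submodule.mem_top)
    · exfalso
      obtain ⟨p, hpq, hp, hirrp⟩ := exists_irr_le q hq hq0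
      have := hirrp.nontrivial
      obtain ⟨y, hy⟩ := exists_ne (0 : p)
      have h1 := congrArg Subtype.val (hirr p _ hirrp y)
      have h2 : (∑ g, h g • ρ g⁻¹) (y : W) = 0 := by
        rw [← Submodule.coe_zero (p := p), ← h1]
        simp only [LinearMap.sum_apply, LinearMap.smul_apply, Submodule.coe_sum,
          Submodule.coe_smul, subRep_coe]
      exact hy (Subtype.ext ((Submodule.disjoint_def.1 hc.disjoint) _ h2 (hpq y.2)))
  funext k
  have h1 := hgen (MonoidAlgebra ℂ G) (Representation.leftRegular ℂ G) (MonoidAlgebra.single 1 1)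
  have h2 := congrArg (fun x : MonoidAlgebra ℂ G => x.coeff k⁻¹) h1
  simpa [LinearMap.sum_apply, Finsupp.single_apply] using h2

theorem sum_finrank_mul_char {ι : Type} [Fintype ι] (R : ι → FDRep ℂ G)
    (hs : ∀ i, Simple (R i)) (hd : ∀ i j, Nonempty (R i ≅ R j) → i = j)
    (hcomp : ∀ ρ : FDRep ℂ G, Simple ρ → ∃ i, Nonempty (ρ ≅ R i)) (g : G) :
    ∑ i, (Module.finrank ℂ (R i) : ℂ) * (R i).character g = if g = 1 then (Nat.card G : ℂ) else 0 := by
  have hc : (Nat.card G : ℂ) ≠ 0 := Nat.cast_ne_zero.2 Nat.card_pos.ne'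
  let _ : Invertible (Nat.card G : ℂ) := invertibleOfNonzero hc
  have key := classFunction_eq_zero (G := G)
    (fun g => (if g = 1 then (Nat.card G : ℂ) else 0) -
      ∑ i, (Module.finrank ℂ (R i) : ℂ) * (R i).character g) ?_ ?_
  · exact (sub_eq_zero.1 (congrFun key g)).symm
  · intro a g
    simp only [FDRep.char_conj, conj_eq_one_iff]
  · intro W _ _ _ ρ hρ
    have hW := hρ.simple
    obtain ⟨j, ⟨e⟩⟩ := hcomp _ hW
    have hch : ∀ g, ρ.character g = (R j).character g := fun g => congrFun (FDRep.char_iso e) g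
    simp only [sub_mul, Finset.sum_sub_distrib, ite_mul, zero_mul, Finset.sum_ite_eq',
      Finset.mem_univ, if_true, inv_one, Finset.sum_mul]
    rw [Finset.sum_comm]
    have h1 : ∀ i, ∑ g, (Module.finrank ℂ (R i) : ℂ) * (R i).character g * ρ.character g⁻¹ =
        if i = j then (Module.finrank ℂ (R i) : ℂ) * Nat.card G else 0 := by
      intro i
      have := hs i
      have := hs j
      have h2 := FDRep.char_orthonormal (R i) (R j)
      have h3 : Nonempty (R i ≅ R j) ↔ i = j := ⟨hd i j, fun h => h ▸ ⟨Iso.refl _⟩⟩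
      rw [inv_mul_eq_iff_eq_mul₀ hc] at h2
      simp only [mul_assoc, ← Finset.mul_sum, hch]
      rw [h2]
      simp only [h3]
      split_ifs <;> simp
    simp only [h1, Finset.sum_ite_eq', Finset.mem_univ, if_true]
    rw [hch, FDRep.char_one]
    ring

end Regular

section FrobeniusSchur

variable {G W : Type} [Group G] [Fintype G] [AddCommGroup W] [Module ℂ W]
  {ρ : Representation ℂ G W}

/-- The invariant bilinear form obtained by averaging the product of two functionals. -/
def avgForm (ρ : Representation ℂ G W) (φ ψ : W →ₗ[ℂ] ℂ) : W →ₗ[ℂ] W →ₗ[ℂ] ℂ :=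
  ∑ g, (LinearMap.mul ℂ ℂ).compl₁₂ (φ ∘ₗ ρ g) (ψ ∘ₗ ρ g)

theorem avgForm_apply (φ ψ : W →ₗ[ℂ] ℂ) (x y : W) :
    avgForm ρ φ ψ x y = ∑ g, φ (ρ g x) * ψ (ρ g y) := by
  simp [avgForm, LinearMap.sum_apply]

theorem avgForm_inv (φ ψ : W →ₗ[ℂ] ℂ) : Inv ρ (avgForm ρ φ ψ) := by
  intro a x y
  simp only [avgForm_apply, ← rep_mul]
  exact Fintype.sum_equiv (Equiv.mulRight a) _ _ fun g => rfl

variable [FiniteDimensional ℂ W]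

theorem sum_char_sq_eq (ρ : Representation ℂ G W) :
    ∑ g, ρ.character (g * g) = ∑ i, ∑ j, avgForm ρ ((Module.finBasis ℂ W).coord i)
      ((Module.finBasis ℂ W).coord j) (Module.finBasis ℂ W j) (Module.finBasis ℂ W i) := by
  simp only [avgForm_apply]
  have h : ∀ g, ρ.character (g * g) = ∑ i, ∑ j,
      (Module.finBasis ℂ W).coord i (ρ g (Module.finBasis ℂ W j)) *
      (Module.finBasis ℂ W).coord j (ρ g (Module.finBasis ℂ W i)) := fun g => by
    rw [Representation.character, LinearMap.trace_eq_matrix_trace ℂ (Module.finBasis ℂ W),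
      map_mul, LinearMap.toMatrix_mul]
    simp only [Matrix.trace, Matrix.diag, Matrix.mul_apply, LinearMap.toMatrix_apply,
      Module.Basis.coord_apply]
  simp only [h]
  rw [Finset.sum_comm]
  exact Finset.sum_congr rfl fun i _ => Finset.sum_comm

theorem sum_sq_char_eq (ρ : Representation ℂ G W) :
    ∑ g, ρ.character g * ρ.character g = ∑ i, ∑ j, avgForm ρ ((Module.finBasis ℂ W).coord i)
      ((Module.finBasis ℂ W).coord j) (Module.finBasis ℂ W i) (Module.finBasis ℂ W j) := by
  simp only [avgForm_apply]
  have h : ∀ g, ρ.character g * ρ.character g = ∑ i, ∑ j,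
      (Module.finBasis ℂ W).coord i (ρ g (Module.finBasis ℂ W i)) *
      (Module.finBasis ℂ W).coord j (ρ g (Module.finBasis ℂ W j)) := fun g => by
    rw [Representation.character, LinearMap.trace_eq_matrix_trace ℂ (Module.finBasis ℂ W)]
    simp only [Matrix.trace, Matrix.diag, LinearMap.toMatrix_apply,
      Module.Basis.coord_apply, Finset.sum_mul_sum]
  simp only [h]
  rw [Finset.sum_comm]
  exact Finset.sum_congr rfl fun i _ => Finset.sum_comm

/-- The Frobenius–Schur sum of an irreducible orthogonal representation. -/
theorem sum_char_sq_of_sym (hρ : Irr ρ) {C : W →ₗ[ℂ] W →ₗ[ℂ] ℂ} (hC : Inv ρ C)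
    (hCs : ∀ x y, C x y = C y x) (hC0 : C ≠ 0) :
    ∑ g, ρ.character (g * g) = Fintype.card G := by
  rw [← sum_char_mul_char_inv hρ]
  have h1 : ∀ g, ρ.character g⁻¹ = ρ.character g :=
    char_inv_of_form hC (hC.injective_of_irr hρ hC0)
  simp only [h1]
  rw [sum_char_sq_eq, sum_sq_char_eq]
  refine Finset.sum_congr rfl fun i _ => Finset.sum_congr rfl fun j _ => ?_
  obtain ⟨c, hc⟩ := (avgForm_inv (ρ := ρ) ((Module.finBasis ℂ W).coord i)
    ((Module.finBasis ℂ W).coord j)).eq_smul hρ hC hC0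
  rw [hc, LinearMap.smul_apply, LinearMap.smul_apply, LinearMap.smul_apply, LinearMap.smul_apply,
    hCs]

theorem sum_char_sq_of_no_form (hC : ∀ C, Inv ρ C → C = 0) :
    ∑ g, ρ.character (g * g) = 0 := by
  rw [sum_char_sq_eq]
  refine Finset.sum_eq_zero fun i _ => Finset.sum_eq_zero fun j _ => ?_
  rw [hC _ (avgForm_inv _ _)]
  rfl

theorem isRealValued_iff (ρ : Representation ℂ G W) :
    IsRealValued ρ.character ↔ ∀ g, ρ.character g⁻¹ = ρ.character g := by
  refine forall_congr' fun g => ?_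
  rw [char_inv_eq_star]
  constructor
  · rintro ⟨r, hr⟩
    rw [hr]
    exact Complex.conj_ofReal r
  · intro h
    obtain ⟨r, hr⟩ := Complex.conj_eq_iff_real.1 h
    exact ⟨r, hr⟩

/-- If every irreducible representation with real character is orthogonal, the degrees of those
representations add up to the number of solutions of `g * g = 1`. -/
theorem sum_finrank_real {ι : Type} [Fintype ι] (R : ι → FDRep ℂ G)
    (hs : ∀ i, Simple (R i)) (hd : ∀ i j, Nonempty (R i ≅ R j) → i = j)
    (hcomp : ∀ ρ : FDRep ℂ G, Simple ρ → ∃ i, Nonempty (ρ ≅ R i))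
    (horth : ∀ (W : Type) [AddCommGroup W] [Module ℂ W] [FiniteDimensional ℂ W]
      (ρ : Representation ℂ G W), Irr ρ → (∀ g, ρ.character g⁻¹ = ρ.character g) →
      ∃ B, Inv ρ B ∧ (∀ x y, B x y = B y x) ∧ B ≠ 0) :
    ∑ i ∈ Finset.univ.filter (fun i => IsRealValued (R i).character),
      (Module.finrank ℂ (R i) : ℝ) = Nat.card {g : G // g * g = 1} := by
  rw [Nat.card_eq_fintype_card, Fintype.card_subtype]
  have hreg := fun g : G => sum_finrank_mul_char R hs hd hcomp (g * g)
  have h1 : ∑ g : G, ∑ i, (Module.finrank ℂ (R i) : ℂ) * (R i).character (g * g) =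
      (Nat.card G : ℂ) * (Finset.univ.filter fun g : G => g * g = 1).card := by
    simp only [hreg]
    rw [← Finset.sum_filter, Finset.sum_const, nsmul_eq_mul, mul_comm]
  rw [Finset.sum_comm] at h1
  have h2 : ∀ i, ∑ g, (R i).character (g * g) =
      if IsRealValued (R i).character then (Nat.card G : ℂ) else 0 := by
    intro i
    have := hs i
    have hi := irr_of_simple (R i)
    have hr := isRealValued_iff (G := G) (R i).ρ
    split_ifs with h
    · obtain ⟨B, hB, hBs, hB0⟩ := horth _ _ hi (hr.1 h)
      rw [Nat.card_eq_fintype_card]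
      exact sum_char_sq_of_sym hi hB hBs hB0
    · refine sum_char_sq_of_no_form (ρ := (R i).ρ) fun C hC => ?_
      by_contra hC0
      exact h (hr.2 (char_inv_of_form hC (hC.injective_of_irr hi hC0)))
  simp only [← Finset.mul_sum, h2, mul_ite, mul_zero] at h1
  rw [← Finset.sum_filter, ← Finset.sum_mul, mul_comm] at h1
  have h3 := mul_left_cancel₀ (Nat.cast_ne_zero.2 Nat.card_pos.ne') h1
  exact_mod_cast h3

theorem TotOrth.isRealValued (hG : TotOrth G) (V : FDRep ℂ G) [Simple V] :
    IsRealValued V.character := by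
  have hi := irr_of_simple V
  obtain ⟨B, hB, -, hB0⟩ := hG _ _ hi
  exact (isRealValued_iff (G := G) V.ρ).2 (char_inv_of_form hB (hB.injective_of_irr hi hB0))

end FrobeniusSchur

section Central

/-- A central element acts by a sign on an irreducible representation with an invariant form. -/
theorem central_sign {G W : Type} [Group G] [AddCommGroup W] [Module ℂ W]
    [FiniteDimensional ℂ W] {ρ : Representation ℂ G W} (hρ : Irr ρ)
    {C : W →ₗ[ℂ] W →ₗ[ℂ] ℂ} (hC : Inv ρ C) (hC0 : C ≠ 0) {z : G} (hz : ∀ g, g * z = z * g) :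
    ∃ c : ℂ, c * c = 1 ∧ ∀ x, ρ z x = c • x := by
  have := hρ.nontrivial
  obtain ⟨c, hc⟩ := Module.End.exists_eigenvalue (ρ z)
  have hst : Stable ρ (Module.End.eigenspace (ρ z) c) := by
    intro g x hx
    rw [Module.End.mem_eigenspace_iff] at hx ⊢
    rw [← rep_mul, ← hz, rep_mul, hx, map_smul]
  have htop := (hρ.eq_bot_or_top _ hst).resolve_left hc
  have hall : ∀ x, ρ z x = c • x := fun x =>
    Module.End.mem_eigenspace_iff.1 (htop ▸ Submodule.mem_top)
  refine ⟨c, ?_, hall⟩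
  by_contra hcc
  refine hC0 (LinearMap.ext₂ fun x y => ?_)
  have h1 := hC z x y
  simp only [hall, map_smul, LinearMap.smul_apply, smul_eq_mul] at h1
  have h2 : (c * c - 1) * C x y = 0 := by linear_combination h1
  exact (mul_eq_zero.1 h2).resolve_left (sub_ne_zero.2 hcc)

/-- If a totally orthogonal subgroup together with the centre generates a subgroup of index at
most two, irreducible representations with real character are orthogonal. -/
theorem exists_sym_of_central_cover {G : Type} [Group G] [Finite G] (N H : Subgroup G)
    (hN : N.index ≤ 2) (hH : TotOrth H) (hHN : H ≤ N)
    (hNZ : ∀ t ∈ N, ∃ z ∈ Subgroup.center G, ∃ h ∈ H, t = z * h)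
    {W : Type} [AddCommGroup W] [Module ℂ W] [FiniteDimensional ℂ W] {ρ : Representation ℂ G W}
    (hρ : Irr ρ) (hr : ∀ g, ρ.character g⁻¹ = ρ.character g) :
    ∃ B, Inv ρ B ∧ (∀ x y, B x y = B y x) ∧ B ≠ 0 := by
  have := Fintype.ofFinite G
  refine (exists_sym_or_alt hρ hr).resolve_right ?_
  rintro ⟨C, hC, hCa, hC0⟩
  have := hρ.nontrivial
  obtain ⟨p, -, hp, hirr⟩ := exists_irr_le (ρ := (ρ.comp N.subtype : Representation ℂ N W)) ⊤
    (fun g w _ => Submodule.mem_top) top_ne_bot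
  have hdec : ∀ t : N, ∃ c : ℂ, c * c = 1 ∧ ∃ h : H, ∀ x, ρ t x = c • ρ h x := by
    intro t
    obtain ⟨z, hz, h, hh, e⟩ := hNZ t t.2
    obtain ⟨c, hc, hcx⟩ := central_sign hρ hC hC0 (z := z) (Subgroup.mem_center_iff.1 hz)
    exact ⟨c, hc, ⟨h, hh⟩, fun x => by rw [e, rep_mul, hcx]⟩
  have hpH : Stable (ρ.comp H.subtype : Representation ℂ H W) p := fun h w hw =>
    hp ⟨h, hHN h.2⟩ w hw
  have hirrH : Irr (subRep (ρ.comp H.subtype : Representation ℂ H W) p hpH) := by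
    refine ⟨hirr.nontrivial, fun q hq => hirr.eq_bot_or_top q fun t x hx => ?_⟩
    obtain ⟨c, -, h, hh⟩ := hdec t
    have h1 : subRep (ρ.comp N.subtype : Representation ℂ N W) p hp t x =
        c • subRep (ρ.comp H.subtype : Representation ℂ H W) p hpH h x :=
      Subtype.ext (hh x)
    rw [h1]
    exact q.smul_mem c (hq h x hx)
  obtain ⟨β, hβ, hβs, hβ0⟩ := hH p _ hirrH
  refine hβ0 (index_two_form hρ hC hCa hC0 N hN p hp hirr (β := β) ?_ hβs)
  intro t x y
  obtain ⟨c, hc, h, hh⟩ := hdec t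
  have h1 : ∀ x, subRep (ρ.comp N.subtype : Representation ℂ N W) p hp t x =
      c • subRep (ρ.comp H.subtype : Representation ℂ H W) p hpH h x := fun x =>
    Subtype.ext (hh x)
  rw [h1, h1, map_smul, map_smul, LinearMap.smul_apply, smul_smul, hc, one_smul, hβ]

end Central

section Matrices

variable {F : Type} [Field F] {m : Type} [Fintype m] [DecidableEq m]

theorem toBilin_symm (J : Matrix m m F) (hs : Jᵀ = J) (x y : m → F) :
    Matrix.toBilin' J x y = Matrix.toBilin' J y x := by
  rw [Matrix.toBilin'_apply', Matrix.toBilin'_apply', Matrix.dotProduct_mulVec, dotProduct_comm,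
    ← Matrix.mulVec_transpose, hs]

theorem toBilin_nonDegOn (J : Matrix m m F) (hJ : IsUnit J) (hs : Jᵀ = J) :
    NonDegOn (Matrix.toBilin' J) ⊤ := by
  intro x _ hx
  have h1 : J *ᵥ x = 0 := by
    refine dotProduct_eq_zero _ fun y => ?_
    rw [dotProduct_comm, ← Matrix.toBilin'_apply', toBilin_symm J hs]
    exact hx y Submodule.mem_top
  rw [← Matrix.one_mulVec x, ← Matrix.nonsing_inv_mul J ((Matrix.isUnit_iff_isUnit_det _).1 hJ),
    ← Matrix.mulVec_mulVec, h1, Matrix.mulVec_zero]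

theorem totOrth_fixGroup [Finite F] (h2 : (2 : F) ≠ 0) (J : Matrix m m F) (hJ : IsUnit J)
    (hs : Jᵀ = J) : TotOrth (fixGroup J) := by
  have key : ∀ (A : Matrix m m F) (x y : m → F), Matrix.toBilin' A x y = x ⬝ᵥ A *ᵥ y := fun A x y =>
    Matrix.toBilin'_apply' A x y
  let E : (Module.End F (m → F))ˣ ≃* GL m F :=
    Units.mapEquiv (LinearMap.toMatrixAlgEquiv' : _ ≃ₐ[F] Matrix m m F).toMulEquiv
  have hE : ∀ g, g ∈ isoGroup (Matrix.toBilin' J) ↔ E g ∈ fixGroup J := by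
    intro g
    have h1 : (E g : Matrix m m F) = LinearMap.toMatrix' g.1 := rfl
    have h3 : ∀ x, g.1 x = (E g : Matrix m m F) *ᵥ x := fun x => by
      rw [h1, LinearMap.toMatrix'_mulVec]
    have h2 : ∀ x y, Matrix.toBilin' J (g.1 x) (g.1 y) =
        Matrix.toBilin' ((E g : Matrix m m F)ᵀ * J * (E g : Matrix m m F)) x y := by
      intro x y
      rw [h3, h3, key, key, ← Matrix.mulVec_mulVec, ← Matrix.mulVec_mulVec,
        Matrix.dotProduct_mulVec x, Matrix.vecMul_transpose]
    constructor
    · intro hg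
      refine (Matrix.toBilin' (R₁ := F) (n := m)).injective (LinearMap.ext₂ fun x y => ?_)
      rw [← h2]
      exact hg x y
    · intro hg x y
      rw [h2]
      exact congrArg (fun A => Matrix.toBilin' A x y) hg
  let f : isoGroup (Matrix.toBilin' J) →* fixGroup J :=
    (E.toMonoidHom.comp (isoGroup (Matrix.toBilin' J)).subtype).codRestrict _
      fun g => (hE g).1 g.2
  refine (totOrth_isoGroup h2 (Matrix.toBilin' J) (toBilin_symm J hs)
    (toBilin_nonDegOn J hJ hs)).of_surjective f ?_
  rintro ⟨t, ht⟩
  refine ⟨⟨E.symm t, (hE _).2 (by rwa [MulEquiv.apply_symm_apply])⟩, Subtype.ext ?_⟩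
  exact E.apply_symm_apply t

theorem fixGroup_le_similitudeGroup (J : Matrix m m F) : fixGroup J ≤ similitudeGroup J :=
  fun _ hg => ⟨1, by rw [Units.val_one, one_smul]; exact hg⟩

/-- Similitudes with square multiplier are scalar multiples of isometries. -/
theorem exists_center_mul_fix (J : Matrix m m F) (t : similitudeGroup J) (s : Fˣ)
    (ht : (t.1 : Matrix m m F)ᵀ * J * (t.1 : Matrix m m F) = ((s * s : Fˣ) : F) • J) :
    ∃ z ∈ Subgroup.center (similitudeGroup J),
      ∃ h ∈ (fixGroup J).subgroupOf (similitudeGroup J), t = z * h := by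
  let Z : Fˣ →* GL m F := Units.map (Matrix.scalar m).toMonoidHom
  have hZ : ∀ c : Fˣ, (Z c : Matrix m m F) = (c : F) • (1 : Matrix m m F) := fun c => by
    rw [Matrix.smul_one_eq_diagonal]; rfl
  have hZm : ∀ c : Fˣ, Z c ∈ similitudeGroup J := fun c => ⟨c * c, by
    rw [hZ]; simp [smul_smul]⟩
  refine ⟨⟨Z s, hZm s⟩, Subgroup.mem_center_iff.2 fun g => Subtype.ext (Units.ext ?_),
    ⟨Z s⁻¹, hZm s⁻¹⟩ * t, Subgroup.mem_subgroupOf.2 ?_, ?_⟩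
  · change (g.1 : Matrix m m F) * (Z s : Matrix m m F) = (Z s : Matrix m m F) * (g.1 : Matrix m m F)
    rw [hZ]; simp
  · change ((Z s⁻¹ : Matrix m m F) * (t.1 : Matrix m m F))ᵀ * J *
      ((Z s⁻¹ : Matrix m m F) * (t.1 : Matrix m m F)) = J
    rw [hZ]
    simp only [Matrix.smul_mul, Matrix.one_mul, Matrix.transpose_smul, Matrix.mul_smul, ht,
      smul_smul, ← Units.val_mul]
    rw [show s⁻¹ * (s⁻¹ * (s * s)) = 1 by group, Units.val_one, one_smul]
  · rw [← mul_assoc]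
    have : (⟨Z s, hZm s⟩ : similitudeGroup J) * ⟨Z s⁻¹, hZm s⁻¹⟩ = 1 := Subtype.ext (by
      change Z s * Z s⁻¹ = 1
      rw [← map_mul, mul_inv_cancel, map_one])
    rw [this, one_mul]

theorem exists_index_le_two [Finite F] (J : Matrix m m F) :
    ∃ N : Subgroup (similitudeGroup J), N.index ≤ 2 ∧
      (fixGroup J).subgroupOf (similitudeGroup J) ≤ N ∧ ∀ t ∈ N,
      ∃ z ∈ Subgroup.center (similitudeGroup J),
      ∃ h ∈ (fixGroup J).subgroupOf (similitudeGroup J), t = z * h := by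
  have := Fintype.ofFinite F
  obtain ⟨N, hN⟩ := exists_prod_subgroup (Subgroup.center (similitudeGroup J))
    ((fixGroup J).subgroupOf (similitudeGroup J)) (fun z hz k hk => by
      rwa [← Subgroup.mem_center_iff.1 hz k, mul_inv_cancel_right])
  refine ⟨N, ?_, fun h hh => (hN h).2 ⟨1, one_mem _, h, hh, (one_mul h).symm⟩, fun t ht => (hN t).1 ht⟩
  have hsq : ∀ (t : similitudeGroup J) (c : Fˣ),
      (t.1 : Matrix m m F)ᵀ * J * (t.1 : Matrix m m F) = (c : F) • J → IsSquare c → t ∈ N := by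
    rintro t c hc ⟨s, rfl⟩
    exact (hN t).2 (exists_center_mul_fix J t s hc)
  by_cases hall : ∀ t : similitudeGroup J, ∃ c : Fˣ,
      (t.1 : Matrix m m F)ᵀ * J * (t.1 : Matrix m m F) = (c : F) • J ∧ IsSquare c
  · refine index_le_two_of_cover N 1 fun t => Or.inl ?_
    obtain ⟨c, hc, h⟩ := hall t
    exact hsq t c hc h
  · push Not at hall
    obtain ⟨a, ha⟩ := hall
    refine index_le_two_of_cover N a fun t => ?_
    obtain ⟨c, hc⟩ := t.2
    obtain ⟨d, hd⟩ := a.2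
    by_cases h : IsSquare c
    · exact Or.inl (hsq t c hc h)
    · right
      refine hsq _ (d⁻¹ * c) (sim_mul _ _ _ _ (sim_inv _ _ hd) hc) ?_
      have hd' := ha d hd
      have e : ∀ u : Fˣ, IsSquare u ↔ IsSquare (u : F) := fun u => by
        constructor
        · rintro ⟨s, rfl⟩; exact ⟨s, rfl⟩
        · rintro ⟨s, hs⟩
          have hs0 : s ≠ 0 := fun h0 => u.ne_zero (by rw [hs, h0, zero_mul])
          exact ⟨Units.mk0 s hs0, Units.ext hs⟩
      have hdd : ¬ IsSquare d⁻¹ := fun h => hd' (by simpa using h.inv)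
      rw [e] at h hdd ⊢
      rw [Units.val_mul]
      have q0 := (d⁻¹).ne_zero
      have q1 := c.ne_zero
      rw [← quadraticChar_one_iff_isSquare (mul_ne_zero q0 q1), map_mul,
        quadraticChar_neg_one_iff_not_isSquare.2 hdd, quadraticChar_neg_one_iff_not_isSquare.2 h]
      norm_num

end Matrices

section Split

variable {F V : Type} [Field F] [AddCommGroup V] [Module F V] [FiniteDimensional F V]

/-- Two complementary totally isotropic subspaces of a nondegenerate symmetric space are in duality:
the space has a hyperbolic basis. -/
theorem exists_hyperbolic {n : ℕ} (hn : Module.finrank F V = 2 * n) {B : V →ₗ[F] V →ₗ[F] F}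
    (hs : ∀ x y, B x y = B y x) (hB : NonDegOn B ⊤) {U W : Submodule F V} (hUW : IsCompl U W)
    (hU : ∀ x ∈ U, ∀ y ∈ U, B x y = 0) (hW : ∀ x ∈ W, ∀ y ∈ W, B x y = 0) :
    ∃ v : Fin n ⊕ Fin n → V, ∀ i j, B (v i) (v j) = Jsplit n F i j := by
  let φ : U →ₗ[F] Module.Dual F W := B.compl₁₂ U.subtype W.subtype
  let ψ : W →ₗ[F] Module.Dual F U := B.compl₁₂ W.subtype U.subtype
  have hφ : Function.Injective φ := by
    rw [← LinearMap.ker_eq_bot, LinearMap.ker_eq_bot']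
    intro x hx
    refine Subtype.ext (hB x Submodule.mem_top fun y _ => ?_)
    obtain ⟨⟨a, ha⟩, ⟨b, hb⟩, rfl⟩ := exists_add_of_isCompl hUW y
    dsimp only
    rw [map_add, hU x x.2 a ha, zero_add]
    exact LinearMap.congr_fun hx ⟨b, hb⟩
  have hψ : Function.Injective ψ := by
    rw [← LinearMap.ker_eq_bot, LinearMap.ker_eq_bot']
    intro x hx
    refine Subtype.ext (hB x Submodule.mem_top fun y _ => ?_)
    obtain ⟨⟨a, ha⟩, ⟨b, hb⟩, rfl⟩ := exists_add_of_isCompl hUW y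
    dsimp only
    rw [map_add, hW x x.2 b hb, add_zero]
    exact LinearMap.congr_fun hx ⟨a, ha⟩
  have h1 := LinearMap.finrank_le_finrank_of_injective hφ
  have h2 := LinearMap.finrank_le_finrank_of_injective hψ
  rw [Subspace.dual_finrank_eq] at h1 h2
  have h3 := Submodule.finrank_add_eq_of_isCompl hUW
  have hUn : Module.finrank F U = n := by omega
  let b : Module.Basis (Fin n) F U := (Module.finBasis F U).reindex (finCongr hUn)
  let e : W ≃ₗ[F] Module.Dual F U := LinearEquiv.ofInjectiveOfFinrankEq ψ hψ
    (by rw [Subspace.dual_finrank_eq]; omega)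
  have he : ∀ i j, B (e.symm (b.dualBasis i) : V) (b j) = (1 : Matrix (Fin n) (Fin n) F) i j := by
    intro i j
    have h4 : ψ (e.symm (b.dualBasis i)) = b.dualBasis i := e.apply_symm_apply _
    refine (LinearMap.congr_fun h4 (b j)).trans ?_
    rw [Module.Basis.dualBasis_apply_self, Matrix.one_apply]
    simp only [eq_comm]
  refine ⟨Sum.elim (fun i => (b i : V)) (fun i => (e.symm (b.dualBasis i) : V)), ?_⟩
  rintro (i | i) (j | j)
  · exact hU _ (b i).2 _ (b j).2
  · simp only [Sum.elim_inl, Sum.elim_inr, Jsplit, Matrix.fromBlocks_apply₁₂]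
    rw [hs, he, Matrix.one_apply, Matrix.one_apply]
    simp only [eq_comm]
  · simp only [Sum.elim_inl, Sum.elim_inr, Jsplit, Matrix.fromBlocks_apply₂₁]
    exact he i j
  · exact hW _ (e.symm (b.dualBasis i)).2 _ (e.symm (b.dualBasis j)).2

variable {n : ℕ}

theorem isSplit_of_anti_involution (h2 : (2 : F) ≠ 0)
    (J : Matrix (Fin n ⊕ Fin n) (Fin n ⊕ Fin n) F) (hJ : IsUnit J) (hs : Jᵀ = J)
    (g : Matrix (Fin n ⊕ Fin n) (Fin n ⊕ Fin n) F) (hg : g * g = 1) (hgJ : gᵀ * J * g = -J) :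
    IsSplit J := by
  have key : ∀ (A : Matrix (Fin n ⊕ Fin n) (Fin n ⊕ Fin n) F) x y,
      Matrix.toBilin' A x y = x ⬝ᵥ A *ᵥ y := fun A x y => Matrix.toBilin'_apply' A x y
  have hsym := toBilin_symm J hs
  have hnd := toBilin_nonDegOn J hJ hs
  have hgB : ∀ x y, Matrix.toBilin' J (g *ᵥ x) (g *ᵥ y) = - Matrix.toBilin' J x y := by
    intro x y
    have h3 : Matrix.toBilin' (gᵀ * J * g) x y = - Matrix.toBilin' J x y := by
      rw [hgJ, map_neg]; rfl
    rw [← h3, key, key, ← Matrix.mulVec_mulVec, ← Matrix.mulVec_mulVec,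
        Matrix.dotProduct_mulVec x, Matrix.vecMul_transpose]
  have hgg : ∀ x, g *ᵥ (g *ᵥ x) = x := fun x => by
    rw [Matrix.mulVec_mulVec, hg, Matrix.one_mulVec]
  let U : Submodule F (Fin n ⊕ Fin n → F) := LinearMap.ker (Matrix.toLin' g - LinearMap.id)
  let W : Submodule F (Fin n ⊕ Fin n → F) := LinearMap.ker (Matrix.toLin' g + LinearMap.id)
  have hU : ∀ x, x ∈ U ↔ g *ᵥ x = x := fun x => by
    simp only [U, LinearMap.mem_ker, LinearMap.sub_apply, Matrix.toLin'_apply, LinearMap.id_apply,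
      sub_eq_zero]
  have hW : ∀ x, x ∈ W ↔ g *ᵥ x = -x := fun x => by
    simp only [W, LinearMap.mem_ker, LinearMap.add_apply, Matrix.toLin'_apply, LinearMap.id_apply,
      add_eq_zero_iff_eq_neg]
  have hUW : IsCompl U W := by
    constructor
    · rw [Submodule.disjoint_def]
      intro x hx hx'
      rw [hU] at hx
      rw [hW, hx] at hx'
      have h3 : (2 : F) • x = 0 := by
        rw [two_smul]; nth_rewrite 1 [hx']; exact neg_add_cancel x
      exact (smul_eq_zero.1 h3).resolve_left h2
    · rw [codisjoint_iff, eq_top_iff]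
      intro x _
      refine Submodule.mem_sup.2 ⟨(2 : F)⁻¹ • (x + g *ᵥ x), (hU _).2 ?_,
        (2 : F)⁻¹ • (x - g *ᵥ x), (hW _).2 ?_, ?_⟩
      · rw [Matrix.mulVec_smul, Matrix.mulVec_add, hgg, add_comm]
      · rw [Matrix.mulVec_smul, Matrix.mulVec_sub, hgg, ← smul_neg, neg_sub]
      · rw [← smul_add, add_add_sub_cancel, ← two_smul F, smul_smul, inv_mul_cancel₀ h2, one_smul]
  have hzero : ∀ a : F, a = -a → a = 0 := fun a ha => by
    have : 2 * a = 0 := by linear_combination ha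
    exact (mul_eq_zero.1 this).resolve_left h2
  obtain ⟨v, hv⟩ := exists_hyperbolic (F := F) (n := n) (by
    rw [Module.finrank_fintype_fun_eq_card, Fintype.card_sum, Fintype.card_fin, two_mul])
    hsym hnd hUW
    (fun x hx y hy => hzero _ (by rw [← hgB, (hU x).1 hx, (hU y).1 hy]))
    (fun x hx y hy => hzero _ (by
      rw [← hgB, (hW x).1 hx, (hW y).1 hy, map_neg, map_neg, LinearMap.neg_apply,
        _root_.neg_neg]))
  let P : Matrix (Fin n ⊕ Fin n) (Fin n ⊕ Fin n) F := Matrix.of fun i j => v j i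
  have hP : Pᵀ * J * P = Jsplit n F := by
    ext i j
    have h3 : ∀ j, P *ᵥ Pi.single j 1 = v j := fun j => Matrix.mulVec_single_one P j
    rw [← hv, ← h3, ← h3, ← Matrix.toBilin'_single (Pᵀ * J * P), key, key, ← Matrix.mulVec_mulVec,
      ← Matrix.mulVec_mulVec, Matrix.dotProduct_mulVec (Pi.single i 1), Matrix.vecMul_transpose]
  have hPu : IsUnit P := by
    rw [Matrix.isUnit_iff_isUnit_det, isUnit_iff_ne_zero]
    intro h0
    have h3 : Jsplit n F * Jsplit n F = 1 := by
      simp [Jsplit, Matrix.fromBlocks_multiply]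
    have h4 := congrArg Matrix.det h3
    rw [← hP] at h4
    simp [Matrix.det_mul, h0] at h4
  exact ⟨hPu.unit, hP⟩

end Split

section Count

variable {F : Type} [Field F] {n : ℕ}

theorem card_involutions_eq (h2 : (2 : F) ≠ 0) (J : Matrix (Fin n ⊕ Fin n) (Fin n ⊕ Fin n) F)
    (hJ : IsUnit J) (hs : Jᵀ = J) (hns : ¬ IsSplit J) :
    Nat.card {g : similitudeGroup J // g * g = 1} = Nat.card {g : fixGroup J // g * g = 1} := by
  let f : {g : fixGroup J // g * g = 1} → {g : similitudeGroup J // g * g = 1} := fun g =>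
    ⟨⟨g.1.1, fixGroup_le_similitudeGroup J g.1.2⟩,
      Subtype.ext (congrArg (fun t : fixGroup J => t.1) g.2)⟩
  refine (Nat.card_congr (Equiv.ofBijective f ⟨?_, ?_⟩)).symm
  · intro a b h
    exact Subtype.ext (Subtype.ext (congrArg
      (fun t : {g : similitudeGroup J // g * g = 1} => t.1.1) h))
  · rintro ⟨g, hg⟩
    have hgg : g.1 * g.1 = 1 := congrArg (fun t : similitudeGroup J => t.1) hg
    have hgm : (g.1 : Matrix (Fin n ⊕ Fin n) (Fin n ⊕ Fin n) F) *
        (g.1 : Matrix (Fin n ⊕ Fin n) (Fin n ⊕ Fin n) F) = 1 :=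
      congrArg (fun t : GL (Fin n ⊕ Fin n) F => t.1) hgg
    suffices h : g.1 ∈ fixGroup J from ⟨⟨⟨g.1, h⟩, Subtype.ext hgg⟩, rfl⟩
    obtain ⟨c, hc⟩ := g.2
    have h1 := sim_mul _ _ _ _ hc hc
    rw [hgg] at h1
    have hJ0 : J ≠ 0 ∨ n = 0 := by
      rcases Nat.eq_zero_or_pos n with h | h
      · exact Or.inr h
      · left
        rintro rfl
        have : Nonempty (Fin n ⊕ Fin n) := ⟨Sum.inl ⟨0, h⟩⟩
        exact not_isUnit_zero hJ
    rcases hJ0 with hJ0 | rfl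
    · have h3 : ((c * c : Fˣ) : F) • J = (1 : F) • J := by
        rw [← h1]; simp
      have h4 := smul_left_injective F hJ0 h3
      rw [Units.val_mul, mul_self_eq_one_iff] at h4
      rcases h4 with h4 | h4
      · change (g.1 : Matrix _ _ F)ᵀ * J * (g.1 : Matrix _ _ F) = J
        rw [hc, h4, one_smul]
      · refine absurd (isSplit_of_anti_involution h2 J hJ hs _ hgm ?_) hns
        rw [hc, h4, neg_smul, one_smul]
    · change (g.1 : Matrix _ _ F)ᵀ * J * (g.1 : Matrix _ _ F) = J
      exact Subsingleton.elim _ _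

end Count

end OrthRep

theorem stmt_10 (n : ℕ) (hn : 1 ≤ n) (q : ℕ) (hq : ∃ p r : ℕ, p.Prime ∧ Odd p ∧ 0 < r ∧ q = p ^ r)
    (F : Type) [Field F] [Fintype F] [DecidableEq F] (hF : Fintype.card F = q)
    (J : Matrix (Fin n ⊕ Fin n) (Fin n ⊕ Fin n) F) (hJunit : IsUnit J) (hJsymm : Jᵀ = J)
    (hJnonsplit : ¬ IsSplit J)
    (ι : Type) [Fintype ι] (R : ι → FDRep ℂ ↥(similitudeGroup J))
    (hRsimple : ∀ i, Simple (R i))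
    (hRdistinct : ∀ i j : ι, Nonempty (R i ≅ R j) → i = j)
    (hRcomplete : ∀ ρ : FDRep ℂ ↥(similitudeGroup J), Simple ρ → ∃ i, Nonempty (ρ ≅ R i))
    (κ : Type) [Fintype κ] (S : κ → FDRep ℂ ↥(fixGroup J))
    (hSsimple : ∀ i, Simple (S i))
    (hSdistinct : ∀ i j : κ, Nonempty (S i ≅ S j) → i = j)
    (hScomplete : ∀ ρ : FDRep ℂ ↥(fixGroup J), Simple ρ → ∃ i, Nonempty (ρ ≅ S i)) :
    ∑ i ∈ Finset.univ.filter (fun i => IsRealValued (R i).character),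
        (Module.finrank ℂ (R i) : ℝ)
      = ∑ j : κ, (Module.finrank ℂ (S j) : ℝ) := by
  have h2 : (2 : F) ≠ 0 := by
    obtain ⟨p, r, -, hp, -, rfl⟩ := hq
    refine Ring.two_ne_zero fun h => ?_
    have h1 := FiniteField.even_card_iff_char_two.1 h
    rw [hF] at h1
    exact (Nat.not_even_iff_odd.2 hp.pow) (Nat.even_iff.2 h1)
  have hO := OrthRep.totOrth_fixGroup h2 J hJunit hJsymm
  have hR := OrthRep.sum_finrank_real R hRsimple hRdistinct hRcomplete
    (fun W _ _ _ ρ hρ hr => by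
      obtain ⟨N, hN, hle, hdec⟩ := OrthRep.exists_index_le_two J
      exact OrthRep.exists_sym_of_central_cover N _ hN
        (hO.subgroupOf (OrthRep.fixGroup_le_similitudeGroup J)) hle hdec hρ hr)
  have hS := OrthRep.sum_finrank_real S hSsimple hSdistinct hScomplete (fun W _ _ _ ρ hρ _ => hO W ρ hρ)
  rw [OrthRep.card_involutions_eq h2 J hJunit hJsymm hJnonsplit, ← hS] at hR
  refine hR.trans ?_
  rw [Finset.filter_true_of_mem]
  intro j _
  have := hSsimple j
  exact hO.isRealValued (S j)

end
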